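/- (Nonlinear instability of Lane-Emden stars) Let 3 < α < 5 (equivalently 6/5 < γ < 4/3), let w be a Lane-Emden enthalpy profile, and let μ₀ > 0 be the largest eigenvalue of the linearized problem (the variational value μ₀ = sup{Q(φ) : ‖φ‖ < ∞, I(φ) = 1}, assumed positive and finite). Then there exist θ₀ > 0, C > 0 and δ₀ with 0 < δ₀ < 2θ₀ such that for every δ with 0 < δ ≤ δ₀ there exist T > T^δ := (1/√μ₀) ln(2θ₀/δ) and a smooth solution ζ^δ of the Euler–Poisson perturbation equation on [0,T) × (0,R) with finite energies, satisfying √(E(0)) ≤ C δ but sup_{0 ≤ t ≤ T^δ} √(E⁰(t)) ≥ θ₀. -/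

import Mathlib

open MeasureTheory Real Filter Set

/-- The quadratic form `Q(φ)` of the linearized Euler-Poisson operator. -/
noncomputable def Qfun (α R : ℝ) (w φ : ℝ → ℝ) : ℝ :=
  -((1 + α) / α) * (∫ r in Set.Ioo 0 R, w r ^ (1 + α) * r ^ 4 * (deriv φ r) ^ 2)
    - (4 - 3 * (1 + α) / α) *
      (∫ r in Set.Ioo 0 R, deriv (fun s => w s ^ (1 + α)) r * r ^ 3 * (φ r) ^ 2)

/-- The weighted `L²` normalization `I(φ)`. -/
noncomputable def Ifun (α R : ℝ) (w φ : ℝ → ℝ) : ℝ :=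
  ∫ r in Set.Ioo 0 R, w r ^ α * r ^ 4 * (φ r) ^ 2

/-- Finiteness of the norm `‖φ‖²`. -/
def FiniteNorm (α R : ℝ) (w φ : ℝ → ℝ) : Prop :=
  MeasureTheory.IntegrableOn (fun r => w r ^ (1 + α) * r ^ 4 * (deriv φ r) ^ 2)
      (Set.Ioo 0 R) ∧
  MeasureTheory.IntegrableOn (fun r => deriv (fun s => w s ^ (1 + α)) r * r ^ 3 * (φ r) ^ 2)
      (Set.Ioo 0 R) ∧
  MeasureTheory.IntegrableOn (fun r => w r ^ α * r ^ 4 * (φ r) ^ 2) (Set.Ioo 0 R)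

/-- The mixed derivative `∂_t^i ∂_r^k ζ`. -/
noncomputable def dtr (ζ : ℝ → ℝ → ℝ) (i k : ℕ) (t r : ℝ) : ℝ :=
  iteratedDeriv i (fun τ => iteratedDeriv k (fun s => ζ τ s) r) t

/-- `ζ` solves the Euler-Poisson perturbation equation for times in `Tset`. -/
def SolvesEP (α c R : ℝ) (w : ℝ → ℝ) (ζ : ℝ → ℝ → ℝ) (Tset : Set ℝ) : Prop :=
  ∀ t ∈ Tset, ∀ r ∈ Set.Ioo (0:ℝ) R,
    w r ^ α * dtr ζ 2 0 t r
      + ((1 + ζ t r) ^ 2 / r) *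
        deriv (fun s => w s ^ (1 + α) *
          ((1 + ζ t s) ^ 2 * (1 + ζ t s + s * deriv (fun x => ζ t x) s))
            ^ (-(1 + α) / α)) r
      + (w r ^ α / ((1 + ζ t r) ^ 2 * r ^ 3)) * (1 + α) * c *
          (∫ s in Set.Ioo (0:ℝ) r, w s ^ α * s ^ 2) = 0

/-- The instantaneous zeroth-order energy `E⁰(t)`. -/
noncomputable def E0 (α R : ℝ) (w : ℝ → ℝ) (ζ : ℝ → ℝ → ℝ) (t : ℝ) : ℝ :=
  ∫ r in Set.Ioo 0 R,
    (w r ^ α * r ^ 4 * (dtr ζ 1 0 t r) ^ 2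
      + ((1 + α) / α) * w r ^ (1 + α) * r ^ 4 * (dtr ζ 0 1 t r) ^ 2
      + w r ^ α * r ^ 4 * (ζ t r) ^ 2)

/-- The mixed-derivative energy `E^{j,k}(t)`; for `k = 0` this is the temporal energy
`E^j(t)`. -/
noncomputable def Ejk (α R : ℝ) (w : ℝ → ℝ) (ζ : ℝ → ℝ → ℝ) (j k : ℕ) (t : ℝ) : ℝ :=
  ∫ r in Set.Ioo 0 R,
    (w r ^ (α + k) * r ^ 4 * (dtr ζ (j - k + 1) k t r) ^ 2
      + ((1 + α) / α) * w r ^ (1 + α + k) * r ^ 4 * (dtr ζ (j - k) (k + 1) t r) ^ 2)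

/-- The total instant (temporal) energy `E(t) = E⁰(t) + Σ_{j=1}^{⌈α⌉+3} E^j(t)`. -/
noncomputable def Etot (α R : ℝ) (w : ℝ → ℝ) (ζ : ℝ → ℝ → ℝ) (t : ℝ) : ℝ :=
  E0 α R w ζ t + ∑ j ∈ Finset.Icc 1 (⌈α⌉₊ + 3), Ejk α R w ζ j 0 t

/-- All energy integrands appearing in the energies are integrable at time `t`. -/
def FiniteEnergies (α R : ℝ) (w : ℝ → ℝ) (ζ : ℝ → ℝ → ℝ) (t : ℝ) : Prop :=
  MeasureTheory.IntegrableOn (fun r => w r ^ α * r ^ 4 * (ζ t r) ^ 2) (Set.Ioo 0 R) ∧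
  ∀ j ∈ Finset.range (⌈α⌉₊ + 4), ∀ k ∈ Finset.range (j + 1),
    MeasureTheory.IntegrableOn
      (fun r => w r ^ (α + k) * r ^ 4 * (dtr ζ (j - k + 1) k t r) ^ 2) (Set.Ioo 0 R) ∧
    MeasureTheory.IntegrableOn
      (fun r => w r ^ (1 + α + k) * r ^ 4 * (dtr ζ (j - k) (k + 1) t r) ^ 2)
      (Set.Ioo 0 R)

namespace LaneEmden

/-! ### The Wiener algebra of absolutely summable power series -/

section WienerAlgebra

variable (E : Type*) [NormedCommRing E] [NormedAlgebra ℝ E]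

/-- Power series whose coefficients are absolutely summable, as a subalgebra. -/
def wienerSubalgebra : Subalgebra ℝ (PowerSeries E) where
  carrier := {f | Summable fun n => ‖PowerSeries.coeff n f‖}
  mul_mem' := by
    intro f g hf hg
    have := summable_norm_sum_mul_antidiagonal_of_summable_norm hf hg
    simpa only [mem_ofPred_eq, PowerSeries.coeff_mul] using this
  add_mem' := by
    intro f g hf hg
    refine Summable.of_nonneg_of_le (fun _ => norm_nonneg _) (fun n => ?_) (hf.add hg)
    rw [map_add]
    exact norm_add_le _ _
  algebraMap_mem' := by
    intro r
    refine summable_of_ne_finset_zero (s := {0}) fun n hn => ?_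
    have hn' : n ≠ 0 := by simpa using hn
    rw [PowerSeries.algebraMap_apply, PowerSeries.coeff_C, if_neg hn', norm_zero]

/-- The Banach algebra of absolutely summable power series with coefficients in `E`. -/
def Wiener : Type _ := wienerSubalgebra E

variable {E}

namespace Wiener

noncomputable instance : CommRing (Wiener E) := inferInstanceAs (CommRing (wienerSubalgebra E))

noncomputable instance : Algebra ℝ (Wiener E) := inferInstanceAs (Algebra ℝ (wienerSubalgebra E))

/-- The underlying power series. -/
noncomputable def toPS : Wiener E →ₐ[ℝ] PowerSeries E := (wienerSubalgebra E).val

lemma toPS_injective : Function.Injective (toPS : Wiener E → PowerSeries E) :=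
  Subtype.val_injective

lemma summable_toPS (f : Wiener E) : Summable fun n => ‖PowerSeries.coeff n f.toPS‖ := f.2

/-- The element with prescribed absolutely summable coefficients. -/
def mk (a : ℕ → E) (h : Summable fun n => ‖a n‖) : Wiener E :=
  ⟨PowerSeries.mk a, by
    change Summable fun n => ‖PowerSeries.coeff n (PowerSeries.mk a)‖
    simpa using h⟩

/-- The map to the sequence space `ℓ¹`. -/
noncomputable def toLp : Wiener E →+ lp (fun _ : ℕ => E) 1 where
  toFun f := ⟨fun n => PowerSeries.coeff n f.toPS, by
    have h := f.summable_toPS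
    exact (memℓp_gen_iff (by simp)).2 (by simpa using h)⟩
  map_zero' := by ext n; simp
  map_add' f g := by ext n; exact map_add (PowerSeries.coeff n) f.toPS g.toPS

lemma toLp_injective : Function.Injective (toLp : Wiener E → lp (fun _ : ℕ => E) 1) := by
  intro f g h
  apply toPS_injective
  ext n
  exact congrFun (congrArg Subtype.val h) n

noncomputable instance : NormedAddCommGroup (Wiener E) :=
  NormedAddCommGroup.induced (Wiener E) (lp (fun _ : ℕ => E) 1) toLp toLp_injective

lemma norm_def (f : Wiener E) : ‖f‖ = ∑' n, ‖PowerSeries.coeff n f.toPS‖ := by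
  change ‖toLp f‖ = _
  rw [lp.norm_eq_tsum_rpow (by simp)]
  simp [toLp]

noncomputable instance : NormedCommRing (Wiener E) :=
  { (inferInstance : NormedAddCommGroup (Wiener E)),
    (inferInstance : CommRing (Wiener E)) with
    norm_mul_le := by
      intro f g
      rw [norm_def, norm_def, norm_def,
        tsum_mul_tsum_eq_tsum_sum_antidiagonal_of_summable_norm
          (by simpa using f.summable_toPS) (by simpa using g.summable_toPS)]
      refine Summable.tsum_le_tsum (fun n => ?_) (f * g).summable_toPS ?_
      · rw [map_mul, PowerSeries.coeff_mul]
        refine (norm_sum_le _ _).trans (Finset.sum_le_sum fun p _ => norm_mul_le _ _)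
      · have := summable_norm_sum_mul_antidiagonal_of_summable_norm
          (R := ℝ) (f := fun n => ‖PowerSeries.coeff n f.toPS‖)
          (g := fun n => ‖PowerSeries.coeff n g.toPS‖)
          (by simpa using f.summable_toPS) (by simpa using g.summable_toPS)
        exact this.of_norm }

noncomputable instance : NormedAlgebra ℝ (Wiener E) :=
  { (inferInstance : Algebra ℝ (Wiener E)) with
    norm_smul_le := by
      intro r f
      rw [norm_def, norm_def, ← tsum_mul_left]
      refine le_of_eq (tsum_congr fun n => ?_)
      rw [map_smul, PowerSeries.coeff_smul, norm_smul] }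

/-- The coefficient functional. -/
noncomputable def coeff (n : ℕ) : Wiener E →L[ℝ] E :=
  LinearMap.mkContinuous
    { toFun := fun f => PowerSeries.coeff n f.toPS
      map_add' := by intro f g; simp
      map_smul' := by intro r f; simp } 1 (by
      intro f
      rw [one_mul, norm_def]
      exact f.summable_toPS.le_tsum n fun _ _ => norm_nonneg _)

lemma coeff_apply (n : ℕ) (f : Wiener E) : coeff n f = PowerSeries.coeff n f.toPS := rfl

lemma summable_norm_coeff (f : Wiener E) : Summable fun n => ‖coeff n f‖ := f.summable_toPS

lemma norm_eq_tsum (f : Wiener E) : ‖f‖ = ∑' n, ‖coeff n f‖ := norm_def f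

lemma norm_coeff_le (n : ℕ) (f : Wiener E) : ‖coeff n f‖ ≤ ‖f‖ := by
  rw [norm_eq_tsum]
  exact f.summable_norm_coeff.le_tsum n fun _ _ => norm_nonneg _

@[simp] lemma coeff_mk (a : ℕ → E) (h) (n : ℕ) : coeff n (mk a h) = a n := by
  change PowerSeries.coeff n (PowerSeries.mk a) = a n
  simp

@[ext] lemma ext {f g : Wiener E} (h : ∀ n, coeff n f = coeff n g) : f = g := by
  apply toPS_injective
  ext n
  exact h n

lemma coeff_mul (n : ℕ) (f g : Wiener E) :
    coeff n (f * g) = ∑ p ∈ Finset.HasAntidiagonal.antidiagonal n, coeff p.1 f * coeff p.2 g := by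
  simp only [coeff_apply, map_mul, PowerSeries.coeff_mul]

lemma coeff_one (n : ℕ) : coeff n (1 : Wiener E) = if n = 0 then 1 else 0 := by
  simp only [coeff_apply, map_one, PowerSeries.coeff_one]

instance [CompleteSpace E] : CompleteSpace (Wiener E) := by
  have hiso : Isometry (toLp : Wiener E → lp (fun _ : ℕ => E) 1) :=
    AddMonoidHomClass.isometry_of_norm toLp fun _ => rfl
  have hsurj : Function.Surjective (toLp : Wiener E → lp (fun _ : ℕ => E) 1) := by
    intro a
    have h : Summable fun n => ‖a.1 n‖ := by
      simpa using (memℓp_gen_iff (p := 1) (by simp)).1 a.2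
    refine ⟨mk a.1 h, ?_⟩
    ext n
    exact coeff_mk a.1 h n
  exact (IsometryEquiv.mk' toLp (Function.surjInv hsurj)
    (Function.surjInv_eq hsurj) hiso).completeSpace

variable {F : Type*} [NormedCommRing F] [NormedAlgebra ℝ F]

/-- Coefficientwise application of a uniformly bounded sequence of operators. -/
noncomputable def multiplier (M : ℕ → E →L[ℝ] F) (C : ℝ) (hM : ∀ n, ‖M n‖ ≤ C) :
    Wiener E →L[ℝ] Wiener F :=
  have key : ∀ (f : Wiener E) (n : ℕ), ‖M n (coeff n f)‖ ≤ C * ‖coeff n f‖ := fun f n =>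
    ((M n).le_opNorm _).trans (mul_le_mul_of_nonneg_right (hM n) (norm_nonneg _))
  have hs : ∀ f : Wiener E, Summable fun n => ‖M n (coeff n f)‖ := fun f =>
    Summable.of_nonneg_of_le (fun _ => norm_nonneg _) (key f) (f.summable_norm_coeff.mul_left C)
  LinearMap.mkContinuous
    { toFun := fun f => mk (fun n => M n (coeff n f)) (hs f)
      map_add' := by intro f g; ext n; simp
      map_smul' := by intro r f; ext n; simp } C (by
      intro f
      rw [norm_eq_tsum, norm_eq_tsum, ← tsum_mul_left]
      refine Summable.tsum_le_tsum (fun n => ?_) (summable_norm_coeff _)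
        (f.summable_norm_coeff.mul_left C)
      simpa using key f n)

@[simp] lemma coeff_multiplier (M : ℕ → E →L[ℝ] F) (C : ℝ) (hM : ∀ n, ‖M n‖ ≤ C)
    (f : Wiener E) (n : ℕ) : coeff n (multiplier M C hM f) = M n (coeff n f) := by
  exact PowerSeries.coeff_mk (R := F) n (fun n => M n (coeff n f))

/-- The element concentrated in degree `n`. -/
noncomputable def single (n : ℕ) : E →L[ℝ] Wiener E :=
  have hs : ∀ e : E, Summable fun k => ‖(if k = n then e else 0 : E)‖ := fun e =>
    summable_of_ne_finset_zero (s := {n}) fun k hk => by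
      have : k ≠ n := by simpa using hk
      simp [this]
  LinearMap.mkContinuous
    { toFun := fun e => mk (fun k => if k = n then e else 0) (hs e)
      map_add' := by intro f g; ext k; by_cases h : k = n <;> simp [h]
      map_smul' := by intro r f; ext k; by_cases h : k = n <;> simp [h] } 1 (by
      intro e
      rw [norm_eq_tsum, tsum_eq_single n]
      · simp
      · intro k hk; simp [hk])

lemma coeff_single (n k : ℕ) (e : E) : coeff k (single n e) = if k = n then e else 0 := by
  exact PowerSeries.coeff_mk (R := E) k (fun k => if k = n then e else 0)

lemma norm_single (n : ℕ) (e : E) : ‖single n e‖ = ‖e‖ := by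
  rw [norm_eq_tsum, tsum_eq_single n]
  · simp [coeff_single]
  · intro k hk; simp [coeff_single, hk]

lemma hasSum_single [CompleteSpace E] (f : Wiener E) :
    HasSum (fun n => single n (coeff n f)) f := by
  have hs : Summable fun n => single n (coeff n f) :=
    Summable.of_norm (by simpa only [norm_single] using f.summable_norm_coeff)
  have : ∑' n, single n (coeff n f) = f := by
    ext k
    rw [(coeff k).map_tsum hs, tsum_eq_single k]
    · simp [coeff_single]
    · intro n hn; simp [coeff_single, hn.symm]
  simpa only [this] using hs.hasSum

/-- Coefficientwise application of a contractive algebra homomorphism. -/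
noncomputable def map (ψ : E →ₐ[ℝ] F) (hψ : ∀ x, ‖ψ x‖ ≤ ‖x‖) : Wiener E →ₐ[ℝ] Wiener F :=
  have hs : ∀ f : Wiener E, Summable fun n => ‖ψ (coeff n f)‖ := fun f =>
    Summable.of_nonneg_of_le (fun _ => norm_nonneg _) (fun _ => hψ _) f.summable_norm_coeff
  AlgHom.ofLinearMap
    { toFun := fun f => mk (fun n => ψ (coeff n f)) (hs f)
      map_add' := by intro f g; ext n; simp
      map_smul' := by intro r f; ext n; simp }
    (by ext n; by_cases h : n = 0 <;> simp [coeff_one, h])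
    (by intro f g; ext n; simp [coeff_mul])

@[simp] lemma coeff_map (ψ : E →ₐ[ℝ] F) (hψ : ∀ x, ‖ψ x‖ ≤ ‖x‖) (f : Wiener E) (n : ℕ) :
    coeff n (map ψ hψ f) = ψ (coeff n f) := by
  exact PowerSeries.coeff_mk (R := F) n (fun n => ψ (coeff n f))

lemma norm_map_le (ψ : E →ₐ[ℝ] F) (hψ : ∀ x, ‖ψ x‖ ≤ ‖x‖) (f : Wiener E) :
    ‖map ψ hψ f‖ ≤ ‖f‖ := by
  rw [norm_eq_tsum, norm_eq_tsum]
  refine Summable.tsum_le_tsum (fun n => ?_) (summable_norm_coeff _) (summable_norm_coeff _)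
  simpa using hψ _

/-- The dilation `f(z) ↦ f(ρ z)`. -/
noncomputable def dilate (ρ : ℝ) (hρ : |ρ| ≤ 1) : Wiener E →ₐ[ℝ] Wiener E :=
  have hs : ∀ f : Wiener E, Summable fun n => ‖ρ ^ n • coeff n f‖ := fun f =>
    Summable.of_nonneg_of_le (fun _ => norm_nonneg _) (fun n => by
      rw [norm_smul, norm_pow]
      exact mul_le_of_le_one_left (norm_nonneg _) (pow_le_one₀ (norm_nonneg _) hρ))
      f.summable_norm_coeff
  AlgHom.ofLinearMap
    { toFun := fun f => mk (fun n => ρ ^ n • coeff n f) (hs f)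
      map_add' := by intro f g; ext n; simp
      map_smul' := by intro r f; ext n; simpa using smul_comm _ _ _ }
    (by ext n; by_cases h : n = 0 <;> simp [coeff_one, h])
    (by
      intro f g; ext n
      simp only [coeff_mul, coeff_mk, LinearMap.coe_mk, AddHom.coe_mk, Finset.smul_sum]
      refine Finset.sum_congr rfl fun p hp => ?_
      rw [smul_mul_smul_comm, ← pow_add, Finset.HasAntidiagonal.mem_antidiagonal.1 hp])

@[simp] lemma coeff_dilate (ρ : ℝ) (hρ : |ρ| ≤ 1) (f : Wiener E) (n : ℕ) :
    coeff n (dilate ρ hρ f) = ρ ^ n • coeff n f := by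
  exact PowerSeries.coeff_mk (R := E) n (fun n => ρ ^ n • coeff n f)

lemma norm_dilate_le (ρ : ℝ) (hρ : |ρ| ≤ 1) (f : Wiener E) :
    ‖dilate ρ hρ f‖ ≤ ‖f‖ := by
  rw [norm_eq_tsum, norm_eq_tsum]
  refine Summable.tsum_le_tsum (fun n => ?_) (summable_norm_coeff _) (summable_norm_coeff _)
  rw [coeff_dilate, norm_smul, norm_pow]
  exact mul_le_of_le_one_left (norm_nonneg _) (pow_le_one₀ (norm_nonneg _) hρ)

lemma norm_dilate_le_mul (ρ : ℝ) (hρ : |ρ| ≤ 1) (f : Wiener E) (h0 : coeff 0 f = 0) :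
    ‖dilate ρ hρ f‖ ≤ |ρ| * ‖f‖ := by
  rw [norm_eq_tsum, norm_eq_tsum, ← tsum_mul_left]
  refine Summable.tsum_le_tsum (fun n => ?_) (summable_norm_coeff _)
    ((summable_norm_coeff _).mul_left _)
  rw [coeff_dilate, norm_smul, norm_pow]
  rcases n with _ | n
  · simp [h0]
  · refine mul_le_mul_of_nonneg_right ?_ (norm_nonneg _)
    rw [pow_succ]
    exact mul_le_of_le_one_left (norm_nonneg _) (pow_le_one₀ (norm_nonneg _) hρ)

lemma coeff_zero_mul (f g : Wiener E) : coeff 0 (f * g) = coeff 0 f * coeff 0 g := by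
  simp [coeff_mul]

/-- Constants as elements of the Wiener algebra. -/
noncomputable def const : E →ₐ[ℝ] Wiener E :=
  AlgHom.ofLinearMap (single 0 : E →L[ℝ] Wiener E).toLinearMap
    (by ext n; simp [coeff_one, coeff_single])
    (by
      intro f g; ext n
      rcases n with _ | n
      · simp [coeff_zero_mul, coeff_single]
      · simp only [ContinuousLinearMap.coe_coe, coeff_single, coeff_mul]
        rw [Finset.sum_eq_zero]
        · simp
        · rintro ⟨i, j⟩ hp
          have : i + j = n + 1 := by simpa using hp
          by_cases hi : i = 0
          · have hj : j ≠ 0 := by omega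
            simp [hj]
          · simp [hi])

lemma coeff_const (e : E) (n : ℕ) : coeff n (const e) = if n = 0 then e else 0 :=
  coeff_single 0 n e

lemma norm_const (e : E) : ‖const e‖ = ‖e‖ := norm_single 0 e

lemma coeff_const_mul (e : E) (f : Wiener E) (n : ℕ) :
    coeff n (const e * f) = e * coeff n f := by
  rw [coeff_mul, Finset.sum_eq_single (0, n)]
  · simp [coeff_const]
  · rintro ⟨i, j⟩ hp hne
    have h : i + j = n := by simpa using hp
    have hi : i ≠ 0 := by
      rintro rfl
      exact hne (by simpa using h)
    simp [coeff_const, hi]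
  · simp

/-- Differentiation of Wiener-algebra-valued functions is coefficientwise. -/
lemma hasDerivAt_of_coeff [CompleteSpace E] {s : Set ℝ} (hs : IsOpen s)
    (hs' : IsPreconnected s)
    {f f' : ℝ → Wiener E} {u : ℕ → ℝ} (hu : Summable u)
    (hf : ∀ n, ∀ x ∈ s, HasDerivAt (fun y => coeff n (f y)) (coeff n (f' x)) x)
    (hb : ∀ n, ∀ x ∈ s, ‖coeff n (f' x)‖ ≤ u n) {x : ℝ} (hx : x ∈ s) :
    HasDerivAt f (f' x) x := by
  have h := hasDerivAt_tsum_of_isPreconnected (𝕜 := ℝ) (F := Wiener E)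
    (g := fun n y => single n (coeff n (f y))) (g' := fun n y => single n (coeff n (f' y)))
    hu hs hs' (fun n y hy => (single n).hasFDerivAt.comp_hasDerivAt y (hf n y hy))
    (fun n y hy => by simpa only [norm_single] using hb n y hy) hx (hasSum_single (f x)).summable hx
  simpa only [(hasSum_single _).tsum_eq] using h

end Wiener

end WienerAlgebra

/-! ### Functional calculus for real power series of radius at least one -/

section FunctionalCalculus

/-- The real power series with coefficients `c` converges on the open unit disc. -/
def UnitDiscSeries (c : ℕ → ℝ) : Prop :=
  ∀ ρ : ℝ, 0 ≤ ρ → ρ < 1 → Summable fun n => |c n| * ρ ^ n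

/-- The coefficients of the derivative of a power series. -/
def derivSeries (c : ℕ → ℝ) (n : ℕ) : ℝ := (n + 1) * c (n + 1)

lemma UnitDiscSeries.deriv {c : ℕ → ℝ} (hc : UnitDiscSeries c) :
    UnitDiscSeries (derivSeries c) := by
  intro ρ h0 h1
  obtain ⟨σ, hσ, hσ1⟩ := exists_between h1
  have hσ0 : 0 < σ := h0.trans_lt hσ
  have hlt : ρ / σ < 1 := (div_lt_one hσ0).2 hσ
  have hlim : Tendsto (fun n : ℕ => ((n : ℝ) + 1) * (ρ / σ) ^ n) atTop (nhds 0) := by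
    have h1 := tendsto_self_mul_const_pow_of_lt_one (div_nonneg h0 hσ0.le) hlt
    have h2 := tendsto_pow_atTop_nhds_zero_of_lt_one (div_nonneg h0 hσ0.le) hlt
    simpa [add_mul] using h1.add h2
  obtain ⟨K, hK⟩ := hlim.bddAbove_range
  have hs := ((summable_nat_add_iff 1).2 (hc σ hσ0.le hσ1)).mul_left (K * σ⁻¹)
  refine Summable.of_nonneg_of_le (fun n => by positivity) (fun n => ?_) hs
  have hKn : ((n : ℝ) + 1) * (ρ / σ) ^ n ≤ K := hK (mem_range_self n)
  have : |derivSeries c n| * ρ ^ n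
      = (((n : ℝ) + 1) * (ρ / σ) ^ n) * (σ⁻¹ * (|c (n + 1)| * σ ^ (n + 1))) := by
    rw [derivSeries, abs_mul, abs_of_nonneg (by positivity : (0 : ℝ) ≤ n + 1), div_pow, pow_succ]
    field_simp
  rw [this, mul_assoc K]
  exact mul_le_mul_of_nonneg_right hKn (by positivity)

variable {A : Type*} [NormedCommRing A] [NormedAlgebra ℝ A]

/-- Evaluation of a real power series in a commutative Banach algebra. -/
noncomputable def powSeries (c : ℕ → ℝ) (x : A) : A := ∑' n, c n • x ^ n

lemma norm_pow_le_one_mul {A : Type*} [NormedCommRing A] (x : A) (n : ℕ) :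
    ‖x ^ n‖ ≤ ‖(1 : A)‖ * ‖x‖ ^ n := by
  induction n with
  | zero => simp
  | succ n ih =>
    rw [pow_succ, pow_succ, ← mul_assoc]
    exact (norm_mul_le _ _).trans (mul_le_mul_of_nonneg_right ih (norm_nonneg _))

lemma norm_term_le (c : ℕ → ℝ) {x : A} {ρ : ℝ} (hx : ‖x‖ ≤ ρ) (n : ℕ) :
    ‖c n • x ^ n‖ ≤ ‖(1 : A)‖ * (|c n| * ρ ^ n) := by
  rw [norm_smul, Real.norm_eq_abs]
  calc |c n| * ‖x ^ n‖ ≤ |c n| * (‖(1 : A)‖ * ρ ^ n) := by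
        refine mul_le_mul_of_nonneg_left ((norm_pow_le_one_mul x n).trans ?_) (abs_nonneg _)
        gcongr
    _ = _ := by ring

lemma UnitDiscSeries.summable [CompleteSpace A] {c : ℕ → ℝ} (hc : UnitDiscSeries c) {x : A}
    (hx : ‖x‖ < 1) : Summable fun n => c n • x ^ n :=
  Summable.of_norm_bounded ((hc _ (norm_nonneg x) hx).mul_left _) (norm_term_le c le_rfl)

lemma UnitDiscSeries.norm_powSeries_le {c : ℕ → ℝ} (hc : UnitDiscSeries c) {ρ : ℝ} (h1 : ρ < 1)
    {x : A} (hx : ‖x‖ ≤ ρ) : ‖powSeries c x‖ ≤ ‖(1 : A)‖ * ∑' n, |c n| * ρ ^ n := by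
  have h0 : 0 ≤ ρ := (norm_nonneg x).trans hx
  rw [← tsum_mul_left]
  exact tsum_of_norm_bounded ((hc ρ h0 h1).mul_left _).hasSum (norm_term_le c hx)

lemma powSeries_zero (c : ℕ → ℝ) : powSeries c (0 : A) = algebraMap ℝ A (c 0) := by
  rw [powSeries, tsum_eq_single 0]
  · simp [Algebra.algebraMap_eq_smul_one]
  · intro n hn; simp [hn]

lemma UnitDiscSeries.map_powSeries [CompleteSpace A] {c : ℕ → ℝ} (hc : UnitDiscSeries c)
    {B : Type*} [NormedCommRing B] [NormedAlgebra ℝ B] (ψ : A →ₐ[ℝ] B) (hψ : Continuous ψ)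
    {x : A} (hx : ‖x‖ < 1) : ψ (powSeries c x) = powSeries c (ψ x) := by
  rw [powSeries, (hc.summable hx).map_tsum ψ hψ, powSeries]
  simp

lemma UnitDiscSeries.hasFDerivAt [CompleteSpace A] {c : ℕ → ℝ} (hc : UnitDiscSeries c) {x : A}
    (hx : ‖x‖ < 1) :
    HasFDerivAt (powSeries c)
      (ContinuousLinearMap.mul ℝ A (powSeries (derivSeries c) x)) x := by
  obtain ⟨ρ, hρ, hρ1⟩ := exists_between hx
  have hρ0 : 0 < ρ := (norm_nonneg x).trans_lt hρ
  have hterm : ∀ n : ℕ, ∀ y ∈ Metric.ball (0 : A) ρ,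
      HasFDerivAt (fun z : A => c n • z ^ n)
        (ContinuousLinearMap.mul ℝ A ((n * c n) • y ^ (n - 1))) y := by
    intro n y _
    have h := (HasFDerivAt.pow (𝕜 := ℝ) (hasFDerivAt_id y) n).const_smul (c n)
    refine h.congr_fderiv ?_
    ext z
    change c n • ((n • y ^ (n - 1)) * z) = ((n * c n) • y ^ (n - 1)) * z
    rw [nsmul_eq_mul, Algebra.smul_def, Algebra.smul_def, map_mul, map_natCast]
    ring
  have hs : Summable fun n : ℕ => ‖(1 : A)‖ * (|(n * c n)| * ρ ^ (n - 1)) := by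
    refine Summable.mul_left _ ((summable_nat_add_iff 1).1 ?_)
    simpa [derivSeries] using hc.deriv ρ hρ0.le hρ1
  have hb : ∀ n : ℕ, ∀ y ∈ Metric.ball (0 : A) ρ,
      ‖ContinuousLinearMap.mul ℝ A ((n * c n) • y ^ (n - 1))‖
        ≤ ‖(1 : A)‖ * (|(n * c n)| * ρ ^ (n - 1)) := by
    intro n y hy
    refine (ContinuousLinearMap.opNorm_mul_apply_le ℝ A _).trans ?_
    have hy' : ‖y‖ ≤ ρ := by simpa using (mem_ball_zero_iff.1 hy).le
    have h1 := norm_pow_le_one_mul y (n - 1)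
    rw [norm_smul, Real.norm_eq_abs]
    calc |(n * c n)| * ‖y ^ (n - 1)‖ ≤ |(n * c n)| * (‖(1 : A)‖ * ρ ^ (n - 1)) := by
          refine mul_le_mul_of_nonneg_left (h1.trans ?_) (abs_nonneg _)
          gcongr
      _ = _ := by ring
  have hmain := hasFDerivAt_tsum_of_isPreconnected hs Metric.isOpen_ball
    (convex_ball (0 : A) ρ).isPreconnected hterm hb (x₀ := 0) (by simpa using hρ0)
    (hc.summable (by simp)) (x := x) (by simpa using hρ)
  refine hmain.congr_fderiv ?_
  have hsd : Summable fun n : ℕ => (n * c n) • x ^ (n - 1) := by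
    refine (summable_nat_add_iff 1).1 ?_
    simpa [derivSeries] using hc.deriv.summable hx
  rw [← (ContinuousLinearMap.mul ℝ A).map_tsum hsd]
  congr 1
  rw [hsd.tsum_eq_zero_add]
  simp [powSeries, derivSeries]

lemma UnitDiscSeries.hasStrictFDerivAt [CompleteSpace A] {c : ℕ → ℝ} (hc : UnitDiscSeries c)
    {x : A} (hx : ‖x‖ < 1) :
    HasStrictFDerivAt (powSeries c)
      (ContinuousLinearMap.mul ℝ A (powSeries (derivSeries c) x)) x := by
  refine hasStrictFDerivAt_of_hasFDerivAt_of_continuousAt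
    (f' := fun y => ContinuousLinearMap.mul ℝ A (powSeries (derivSeries c) y)) ?_ ?_
  · filter_upwards [(isOpen_lt continuous_norm continuous_const).mem_nhds hx] with y hy
    exact hc.hasFDerivAt hy
  · exact (ContinuousLinearMap.mul ℝ A).continuous.continuousAt.comp
      (hc.deriv.hasFDerivAt hx).continuousAt

lemma UnitDiscSeries.hasDerivAt_comp [CompleteSpace A] {c : ℕ → ℝ} (hc : UnitDiscSeries c)
    {f : ℝ → A} {f' : A} {r : ℝ} (hf : HasDerivAt f f' r) (hx : ‖f r‖ < 1) :
    HasDerivAt (fun s => powSeries c (f s)) (powSeries (derivSeries c) (f r) * f') r :=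
  (hc.hasFDerivAt hx).comp_hasDerivAt r hf

/-- The coefficients of the binomial series `(1 + x) ^ s`. -/
noncomputable def binomCoeff (s : ℝ) (n : ℕ) : ℝ := Ring.choose s n

lemma unitDiscSeries_binomCoeff (s : ℝ) : UnitDiscSeries (binomCoeff s) := by
  intro ρ h0 h1
  have hr := (Real.one_add_rpow_hasFPowerSeriesOnBall_zero (a := s)).r_le
  lift ρ to NNReal using h0
  have h := (binomialSeries ℝ s).summable_norm_mul_pow (r := ρ)
    (lt_of_lt_of_le (by exact_mod_cast h1) hr)
  simpa [binomialSeries, FormalMultilinearSeries.ofScalars_norm, binomCoeff] using h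

lemma powSeries_binomCoeff (s : ℝ) {x : ℝ} (hx : |x| < 1) :
    powSeries (binomCoeff s) x = (1 + x) ^ s := by
  have h := (Real.one_add_rpow_hasFPowerSeriesOnBall_zero (a := s)).hasSum (y := x)
    (by simpa [Metric.mem_eball, edist_dist, dist_eq_norm] using hx)
  rw [zero_add] at h
  rw [← h.tsum_eq]
  simp [powSeries, binomCoeff, binomialSeries, FormalMultilinearSeries.ofScalars, mul_comm]

lemma binomCoeff_zero (s : ℝ) : binomCoeff s 0 = 1 := by simp [binomCoeff]

lemma derivSeries_binomCoeff_zero (s : ℝ) : derivSeries (binomCoeff s) 0 = s := by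
  simp [binomCoeff, derivSeries]

end FunctionalCalculus

/-! ### Lane-Emden profiles -/

/-- The properties of a Lane-Emden enthalpy profile that are used below. -/
structure IsProfile (α c R : ℝ) (w : ℝ → ℝ) : Prop where
  lt_α : 3 < α
  α_lt : α < 5
  c_pos : 0 < c
  R_pos : 0 < R
  cont : ContinuousOn w (Icc 0 R)
  smooth : ContDiffOn ℝ (⊤ : ℕ∞) w (Ico 0 R)
  apply_zero : w 0 = 1
  pos : ∀ r, 0 ≤ r → r < R → 0 < w r
  apply_R : w R = 0
  dec : ∀ r, 0 < r → r < R → deriv w r < 0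
  ode : ∀ r, 0 < r → r < R → deriv (deriv w) r + (2 / r) * deriv w r + c * w r ^ α = 0

/-- The function `w'(r) / r`. -/
noncomputable def radSlope (w : ℝ → ℝ) (r : ℝ) : ℝ := deriv w r / r

/-- The derivative of `w'(r) / r`, expressed by the Lane-Emden equation. -/
noncomputable def radSlopeDeriv (α c : ℝ) (w : ℝ → ℝ) (r : ℝ) : ℝ :=
  (-c * w r ^ α - 3 * radSlope w r) / r

namespace IsProfile

variable {α c R : ℝ} {w : ℝ → ℝ} (P : IsProfile α c R w)

include P

lemma α_pos : 0 < α := by linarith [P.lt_α]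

lemma contDiffAt {r : ℝ} (hr : r ∈ Ioo 0 R) : ContDiffAt ℝ (⊤ : ℕ∞) w r :=
  P.smooth.contDiffAt (Ico_mem_nhds hr.1 hr.2)

lemma hasDerivAt {r : ℝ} (hr : r ∈ Ioo 0 R) : HasDerivAt w (r * radSlope w r) r := by
  have h := ((P.contDiffAt hr).differentiableAt (by simp)).hasDerivAt
  rwa [radSlope, mul_div_cancel₀ _ hr.1.ne']

lemma hasDerivAt_deriv {r : ℝ} (hr : r ∈ Ioo 0 R) :
    HasDerivAt (deriv w) (deriv (deriv w) r) r := by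
  have h1 : ContDiffOn ℝ 1 (deriv w) (Ioo 0 R) :=
    ((P.smooth.mono Ioo_subset_Ico_self).of_le (m := 2)
      (WithTop.coe_le_coe.2 (le_top : (2 : ℕ∞) ≤ ⊤))).deriv_of_isOpen
      isOpen_Ioo (by norm_num)
  exact ((h1.differentiableOn (by norm_num)).differentiableAt (isOpen_Ioo.mem_nhds hr)).hasDerivAt

lemma hasDerivAt_radSlope {r : ℝ} (hr : r ∈ Ioo 0 R) :
    HasDerivAt (radSlope w) (radSlopeDeriv α c w r) r := by
  have h := (P.hasDerivAt_deriv hr).div (hasDerivAt_id r) hr.1.ne'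
  have hode := P.ode r hr.1 hr.2
  refine h.congr_deriv ?_
  have hr0 := hr.1.ne'
  have : deriv (deriv w) r = -(2 / r) * deriv w r - c * w r ^ α := by linarith
  rw [this, radSlopeDeriv, radSlope]
  simp only [id]
  field_simp
  ring

lemma w_pos {r : ℝ} (hr : r ∈ Ioo 0 R) : 0 < w r := P.pos r hr.1.le hr.2

lemma w_nonneg {r : ℝ} (hr : r ∈ Icc 0 R) : 0 ≤ w r := by
  rcases hr.2.lt_or_eq with h | h
  · exact (P.pos r hr.1 h).le
  · rw [h, P.apply_R]

lemma strictAntiOn : StrictAntiOn w (Icc 0 R) := by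
  refine strictAntiOn_of_deriv_neg (convex_Icc 0 R) P.cont fun r hr => ?_
  rw [interior_Icc] at hr
  exact P.dec r hr.1 hr.2

lemma w_le_one {r : ℝ} (hr : r ∈ Icc 0 R) : w r ≤ 1 := by
  rw [← P.apply_zero]
  exact P.strictAntiOn.antitoneOn (left_mem_Icc.2 P.R_pos.le) hr hr.1

lemma continuousOn_rpow {s : ℝ} (hs : 0 ≤ s) : ContinuousOn (fun r => w r ^ s) (Icc 0 R) :=
  P.cont.rpow_const fun _ _ => Or.inr hs

lemma hasDerivAt_rpow {r : ℝ} (hr : r ∈ Ioo 0 R) (s : ℝ) :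
    HasDerivAt (fun x => w x ^ s) (s * w r ^ (s - 1) * (r * radSlope w r)) r := by
  refine ((P.hasDerivAt hr).rpow_const (p := s) (Or.inl (P.w_pos hr).ne')).congr_deriv ?_
  ring

lemma flux {r : ℝ} (hr : r ∈ Ioo 0 R) :
    r ^ 3 * radSlope w r = -c * ∫ s in (0 : ℝ)..r, w s ^ α * s ^ 2 := by
  have hsub : Icc 0 r ⊆ Ico 0 R := fun x hx => ⟨hx.1, hx.2.trans_lt hr.2⟩
  have hcont : ContinuousOn (fun x => x ^ 2 * deriv w x) (Icc 0 r) := by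
    have h1 : ContinuousOn (derivWithin w (Ico 0 R)) (Ico 0 R) :=
      P.smooth.continuousOn_derivWithin (uniqueDiffOn_Ico 0 R) (by simp)
    refine ((continuousOn_id.pow 2).mul (h1.mono hsub)).congr fun x hx => ?_
    rcases hx.1.eq_or_lt with h | h
    · simp [← h]
    · show x ^ 2 * deriv w x = x ^ 2 * derivWithin w (Ico 0 R) x
      rw [derivWithin_of_mem_nhds (Ico_mem_nhds h (hx.2.trans_lt hr.2))]
  have hderiv : ∀ x ∈ Ioo 0 r,
      HasDerivAt (fun x => x ^ 2 * deriv w x) (-c * (w x ^ α * x ^ 2)) x := by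
    intro x hx
    have hx' : x ∈ Ioo 0 R := ⟨hx.1, hx.2.trans hr.2⟩
    refine (((hasDerivAt_id x).pow 2).mul (P.hasDerivAt_deriv hx')).congr_deriv ?_
    have hode := P.ode x hx'.1 hx'.2
    have h0 := hx.1.ne'
    have : deriv (deriv w) x = -(2 / x) * deriv w x - c * w x ^ α := by linarith
    rw [this]
    simp only [id, Pi.pow_apply]
    field_simp
    ring
  have hwi : IntervalIntegrable (fun x => -c * (w x ^ α * x ^ 2)) volume 0 r := by
    refine ContinuousOn.intervalIntegrable ?_
    rw [uIcc_of_le hr.1.le]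
    refine continuousOn_const.mul (((P.continuousOn_rpow P.α_pos.le).mono ?_).mul
      (continuousOn_id.pow 2))
    exact Icc_subset_Icc le_rfl hr.2.le
  have h := intervalIntegral.integral_eq_sub_of_hasDerivAt_of_le hr.1.le hcont hderiv hwi
  rw [intervalIntegral.integral_const_mul] at h
  rw [h, radSlope]
  have h0 := hr.1.ne'
  field_simp
  ring

lemma intervalIntegrable_mass {a b : ℝ} (ha : a ∈ Icc 0 R) (hb : b ∈ Icc 0 R) :
    IntervalIntegrable (fun s => w s ^ α * s ^ 2) volume a b := by
  refine ContinuousOn.intervalIntegrable (((P.continuousOn_rpow P.α_pos.le).mul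
    (continuousOn_id.pow 2)).mono ?_)
  exact OrdConnected.uIcc_subset ordConnected_Icc ha hb

lemma radSlope_ge {r : ℝ} (hr : r ∈ Ioo 0 R) : -(c / 3) ≤ radSlope w r := by
  have h := P.flux hr
  have hle : (∫ s in (0 : ℝ)..r, w s ^ α * s ^ 2) ≤ ∫ s in (0 : ℝ)..r, s ^ 2 := by
    refine intervalIntegral.integral_mono_on hr.1.le
      (P.intervalIntegrable_mass (left_mem_Icc.2 P.R_pos.le) ⟨hr.1.le, hr.2.le⟩)
      ((continuous_pow 2).intervalIntegrable _ _) fun x hx => ?_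
    have hx' : x ∈ Icc 0 R := ⟨hx.1, hx.2.trans hr.2.le⟩
    exact mul_le_of_le_one_left (sq_nonneg x)
      (rpow_le_one (P.w_nonneg hx') (P.w_le_one hx') P.α_pos.le)
  rw [integral_pow] at hle
  have h3 : 0 < r ^ 3 := pow_pos hr.1 3
  have hc := P.c_pos
  norm_num at hle
  have := mul_le_mul_of_nonneg_left hle hc.le
  refine le_of_mul_le_mul_left ?_ h3
  rw [h]
  nlinarith

lemma exists_radSlope_le : ∃ k > 0, ∀ r ∈ Ioo 0 R, radSlope w r ≤ -k := by
  have hR := P.R_pos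
  have hc := P.c_pos
  set b := w (R / 2) ^ α with hb
  have hb0 : 0 < b := rpow_pos_of_pos (P.pos _ (by linarith) (by linarith)) _
  have key : ∀ r ∈ Ioc 0 (R / 2), b * (r ^ 3 / 3) ≤ ∫ s in (0 : ℝ)..r, w s ^ α * s ^ 2 := by
    intro r hr
    have h1 : ∫ s in (0 : ℝ)..r, b * s ^ 2 = b * (r ^ 3 / 3) := by
      rw [intervalIntegral.integral_const_mul, integral_pow]; norm_num
    rw [← h1]
    refine intervalIntegral.integral_mono_on hr.1.le
      ((continuous_const.mul (continuous_pow 2)).intervalIntegrable _ _)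
      (P.intervalIntegrable_mass (left_mem_Icc.2 hR.le) ⟨hr.1.le, by linarith [hr.2]⟩)
      fun x hx => ?_
    refine mul_le_mul_of_nonneg_right ?_ (sq_nonneg x)
    refine rpow_le_rpow (P.pos _ (by linarith) (by linarith)).le ?_ P.α_pos.le
    exact P.strictAntiOn.antitoneOn ⟨hx.1, by linarith [hx.2, hr.2]⟩
      ⟨by linarith, by linarith⟩ (by linarith [hx.2, hr.2])
  refine ⟨c * b / 24, by positivity, fun r hr => ?_⟩
  have h := P.flux hr
  have h3 : 0 < r ^ 3 := pow_pos hr.1 3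
  have main : b * r ^ 3 / 24 ≤ ∫ s in (0 : ℝ)..r, w s ^ α * s ^ 2 := by
    rcases le_or_gt r (R / 2) with hle | hlt
    · have := key r ⟨hr.1, hle⟩
      nlinarith [mul_pos hb0 h3]
    · have h2 := key (R / 2) ⟨by linarith, le_rfl⟩
      have h4 : (∫ s in (0 : ℝ)..(R / 2), w s ^ α * s ^ 2) ≤
          ∫ s in (0 : ℝ)..r, w s ^ α * s ^ 2 := by
        refine intervalIntegral.integral_mono_interval le_rfl (by linarith) hlt.le ?_
          (P.intervalIntegrable_mass (left_mem_Icc.2 hR.le) ⟨hr.1.le, hr.2.le⟩)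
        filter_upwards [ae_restrict_mem measurableSet_Ioc] with x hx
        exact mul_nonneg (rpow_nonneg (P.w_nonneg ⟨hx.1.le, hx.2.trans hr.2.le⟩) _) (sq_nonneg x)
      have h5 : r ^ 3 ≤ R ^ 3 := pow_le_pow_left₀ hr.1.le hr.2.le 3
      nlinarith
  refine le_of_mul_le_mul_left ?_ h3
  rw [h]
  nlinarith [mul_le_mul_of_nonneg_left main hc.le]

lemma radSlope_neg {r : ℝ} (hr : r ∈ Ioo 0 R) : radSlope w r < 0 := by
  obtain ⟨k, hk, h⟩ := P.exists_radSlope_le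
  linarith [h r hr]

lemma abs_radSlope_le {r : ℝ} (hr : r ∈ Ioo 0 R) : |radSlope w r| ≤ c / 3 := by
  rw [abs_of_neg (P.radSlope_neg hr)]
  linarith [P.radSlope_ge hr]

lemma integrableOn_rpow_mul {e : ℝ} (he : -1 < e) :
    IntegrableOn (fun r => w r ^ e * r) (Ioo 0 R) := by
  obtain ⟨k, hk, hkr⟩ := P.exists_radSlope_le
  have h1 : IntegrableOn (fun r => -((e + 1) * w r ^ (e + 1 - 1) * (r * radSlope w r)))
      (Ioc 0 R) := by
    refine intervalIntegral.integrableOn_deriv_of_nonneg (g := fun r => -(w r ^ (e + 1)))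
      (P.continuousOn_rpow (by linarith)).neg (fun x hx => (P.hasDerivAt_rpow hx _).neg) ?_
    intro x hx
    have := rpow_pos_of_pos (P.w_pos hx) (e + 1 - 1)
    have h2 := mul_pos hx.1 (neg_pos.2 (P.radSlope_neg hx))
    have : 0 ≤ (e + 1) * w x ^ (e + 1 - 1) * (x * -radSlope w x) := by
      have : 0 < e + 1 := by linarith
      positivity
    linarith
  have h2 := (h1.mono_set Ioo_subset_Ioc_self).mul_const ((e + 1) * k)⁻¹
  have hmeas : AEStronglyMeasurable (fun r => w r ^ e * r) (volume.restrict (Ioo 0 R)) := by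
    refine ContinuousOn.aestronglyMeasurable (ContinuousOn.mul ?_ continuousOn_id)
      measurableSet_Ioo
    exact fun x hx => (P.hasDerivAt_rpow hx e).continuousAt.continuousWithinAt
  refine Integrable.mono' h2 hmeas ?_
  filter_upwards [ae_restrict_mem measurableSet_Ioo] with r hr
  have hw := rpow_pos_of_pos (P.w_pos hr) e
  have hk' := hkr r hr
  have he' : 0 < e + 1 := by linarith
  have hr0 := hr.1
  rw [Real.norm_eq_abs, abs_of_pos (mul_pos hw hr0), add_sub_cancel_right,
    ← div_eq_mul_inv, le_div_iff₀ (by positivity)]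
  have : w r ^ e * r * (e + 1) * k ≤ w r ^ e * r * (e + 1) * (-radSlope w r) :=
    mul_le_mul_of_nonneg_left (by linarith) (by positivity)
  linarith

lemma w_le_mul_sub {r : ℝ} (hr : r ∈ Ioo 0 R) : w r ≤ R * (c / 3) * (R - r) := by
  have h : ∀ x ∈ Ioo 0 R, ∀ y ∈ Ioo 0 R, ‖w y - w x‖ ≤ R * (c / 3) * ‖y - x‖ := fun x hx y hy =>
    Convex.norm_image_sub_le_of_norm_hasDerivWithin_le (f := w) (s := Ioo 0 R)
    (f' := fun r => r * radSlope w r) (C := R * (c / 3))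
    (fun x hx => (P.hasDerivAt hx).hasDerivWithinAt) (fun x hx => by
      rw [norm_mul, Real.norm_eq_abs, Real.norm_eq_abs, abs_of_pos hx.1]
      exact mul_le_mul hx.2.le (P.abs_radSlope_le hx) (abs_nonneg _) P.R_pos.le)
    (convex_Ioo 0 R) hx hy
  have h1 : Tendsto (fun x => w r - w x) (nhdsWithin R (Iio R)) (nhds (w r - w R)) := by
    refine tendsto_const_nhds.sub ?_
    have := (P.cont R (right_mem_Icc.2 P.R_pos.le)).mono_left
      (nhdsWithin_mono R (Ioo_subset_Icc_self : Ioo 0 R ⊆ Icc 0 R))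
    rwa [nhdsWithin_Ioo_eq_nhdsLT P.R_pos] at this
  rw [P.apply_R, sub_zero] at h1
  have h2 : Tendsto (fun x => R * (c / 3) * |r - x|) (nhdsWithin R (Iio R))
      (nhds (R * (c / 3) * |r - R|)) :=
    ((continuous_const.mul ((continuous_const.sub continuous_id).abs)).tendsto R).mono_left
      nhdsWithin_le_nhds
  have h3 := le_of_tendsto_of_tendsto h1 h2 (by
    filter_upwards [Ioo_mem_nhdsLT P.R_pos] with x hx
    exact (le_abs_self _).trans (h x hx r hr))
  rwa [abs_sub_comm, abs_of_pos (sub_pos.2 hr.2)] at h3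

end IsProfile

/-! ### Weighted Hardy estimates -/

section Comparison

variable {G : Type*} [NormedAddCommGroup G] [NormedSpace ℝ G]

lemma norm_sub_le_of_norm_deriv_le {F F' : ℝ → G} {B B' : ℝ → ℝ} {a b x y : ℝ}
    (hF : ∀ r ∈ Ioo a b, HasDerivAt F (F' r) r) (hB : ∀ r ∈ Ioo a b, HasDerivAt B (B' r) r)
    (hle : ∀ r ∈ Ioo a b, ‖F' r‖ ≤ B' r) (hx : x ∈ Ioo a b) (hy : y ∈ Ioo a b) (hxy : x ≤ y) :
    ‖F y - F x‖ ≤ B y - B x := by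
  have hs : Icc x y ⊆ Ioo a b := fun r hr => ⟨hx.1.trans_le hr.1, hr.2.trans_lt hy.2⟩
  have hs' : Ico x y ⊆ Ioo a b := Ico_subset_Icc_self.trans hs
  refine image_norm_le_of_norm_deriv_right_le_deriv_boundary' (f := fun r => F r - F x)
    (f' := F') (B := fun r => B r - B x) (B' := B') (a := x) (b := y) ?_ ?_ ?_ ?_ ?_ ?_
    (right_mem_Icc.2 hxy)
  · exact fun r hr => ((hF r (hs hr)).sub_const _).continuousAt.continuousWithinAt
  · exact fun r hr => ((hF r (hs' hr)).sub_const _).hasDerivWithinAt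
  · simp
  · exact fun r hr => ((hB r (hs hr)).sub_const _).continuousAt.continuousWithinAt
  · exact fun r hr => ((hB r (hs' hr)).sub_const _).hasDerivWithinAt
  · exact fun r hr => hle r (hs' hr)

lemma norm_le_of_norm_deriv_le_of_tendsto_left {F F' : ℝ → G} {B B' : ℝ → ℝ} {a b x : ℝ}
    (hF : ∀ r ∈ Ioo a b, HasDerivAt F (F' r) r) (hB : ∀ r ∈ Ioo a b, HasDerivAt B (B' r) r)
    (hle : ∀ r ∈ Ioo a b, ‖F' r‖ ≤ B' r) (hB0 : ∀ r ∈ Ioo a b, 0 ≤ B r)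
    (h0 : Tendsto F (nhdsWithin a (Ioi a)) (nhds 0)) (hx : x ∈ Ioo a b) : ‖F x‖ ≤ B x := by
  have h1 : Tendsto (fun y => B x + ‖F y‖) (nhdsWithin a (Ioi a)) (nhds (B x + ‖(0 : G)‖)) :=
    tendsto_const_nhds.add h0.norm
  rw [norm_zero, add_zero] at h1
  refine ge_of_tendsto h1 ?_
  filter_upwards [Ioo_mem_nhdsGT hx.1] with y hy
  have hy' : y ∈ Ioo a b := ⟨hy.1, hy.2.trans hx.2⟩
  have h2 := norm_sub_le_of_norm_deriv_le hF hB hle hy' hx hy.2.le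
  have h3 := norm_sub_norm_le (F x) (F y)
  linarith [hB0 y hy']

lemma norm_le_of_norm_deriv_le_of_tendsto_right {F F' : ℝ → G} {B B' : ℝ → ℝ} {a b x : ℝ}
    (hF : ∀ r ∈ Ioo a b, HasDerivAt F (F' r) r) (hB : ∀ r ∈ Ioo a b, HasDerivAt B (B' r) r)
    (hle : ∀ r ∈ Ioo a b, ‖F' r‖ ≤ -B' r) (hB0 : ∀ r ∈ Ioo a b, 0 ≤ B r)
    (h0 : Tendsto F (nhdsWithin b (Iio b)) (nhds 0)) (hx : x ∈ Ioo a b) : ‖F x‖ ≤ B x := by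
  have h1 : Tendsto (fun y => B x + ‖F y‖) (nhdsWithin b (Iio b)) (nhds (B x + ‖(0 : G)‖)) :=
    tendsto_const_nhds.add h0.norm
  rw [norm_zero, add_zero] at h1
  refine ge_of_tendsto h1 ?_
  filter_upwards [Ioo_mem_nhdsLT hx.2] with y hy
  have hy' : y ∈ Ioo a b := ⟨hx.1.trans hy.1, hy.2⟩
  have h2 := norm_sub_le_of_norm_deriv_le hF (fun r hr => (hB r hr).neg) hle hx hy' hy.1.le
  have h3 := norm_sub_norm_le (F x) (F y)
  rw [norm_sub_rev] at h2
  simp only [Pi.neg_apply] at h2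
  linarith [hB0 y hy']

end Comparison

namespace IsProfile

variable {α c R : ℝ} {w : ℝ → ℝ} (P : IsProfile α c R w)

include P

/-- The weighted Hardy estimate for first order equations that degenerate at the centre and at the
vacuum boundary. -/
lemma exists_hardy {a : ℝ} (ha : 1 < a) {b : ℕ} (hb : 2 ≤ b) :
    ∃ C > 0, ∀ (G : Type) [NormedAddCommGroup G] [NormedSpace ℝ G] (F F' : ℝ → G) (H₁ H₂ : ℝ),
      0 ≤ H₁ → 0 ≤ H₂ → (∀ r ∈ Ioo 0 R, HasDerivAt F (F' r) r) →
      (∀ r ∈ Ioo 0 R, ‖F' r‖ ≤ w r ^ (a - 1) * r ^ (b - 1) * (H₁ + H₂ / (w r * r))) →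
      Tendsto F (nhdsWithin 0 (Ioi 0)) (nhds 0) → Tendsto F (nhdsWithin R (Iio R)) (nhds 0) →
      ∀ r ∈ Ioo 0 R, ‖F r‖ ≤ C * (w r ^ a * r ^ b * (H₁ + H₂ / (w r * r))) := by
  obtain ⟨k, hk, hkr⟩ := P.exists_radSlope_le
  have hR := P.R_pos
  set ω := w (2 * R / 3) with hω
  have hω0 : 0 < ω := P.pos _ (by linarith) (by linarith)
  have hω1 : ω ≤ 1 := P.w_le_one ⟨by linarith, by linarith⟩
  set ρ := R / 3 with hρ
  have hρ0 : 0 < ρ := by positivity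
  obtain ⟨n, rfl⟩ : ∃ n, b = n + 2 := ⟨b - 2, by omega⟩
  have h12 : n + 2 - 1 = n + 1 := rfl
  rw [h12]
  have hn : (0 : ℝ) ≤ n := n.cast_nonneg
  have hn1 : (0 : ℝ) < n + 1 := by linarith
  have hωa := rpow_pos_of_pos hω0 a
  set K₀ := (ω ^ a)⁻¹ * ω⁻¹ with hK₀
  have hK₀0 : 0 < K₀ := by positivity
  set K₁ := R ^ n * (1 + R) / (ρ ^ (n + 2) * ρ * k * (a - 1)) * (1 + R) with hK₁
  have ha1 : 0 < a - 1 := by linarith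
  have hK₁0 : 0 < K₁ := by positivity
  refine ⟨K₀ + K₁, by positivity, ?_⟩
  intro G _ _ F F' H₁ H₂ hH₁ hH₂ hF hF' h0 hRt r hr
  have hpos : 0 ≤ w r ^ a * r ^ (n + 2) * (H₁ + H₂ / (w r * r)) := by
    have := P.w_pos hr
    have := hr.1
    positivity
  rcases lt_or_ge r (2 * R / 3) with hlt | hge
  · have hsub : ∀ x ∈ Ioo 0 (2 * R / 3), x ∈ Ioo 0 R ∧ ω ≤ w x ∧ w x ≤ 1 := fun x hx =>
      have hx' : x ∈ Ioo 0 R := ⟨hx.1, by linarith [hx.2]⟩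
      ⟨hx', P.strictAntiOn.antitoneOn ⟨hx'.1.le, hx'.2.le⟩ ⟨by linarith, by linarith⟩ hx.2.le,
        P.w_le_one ⟨hx'.1.le, hx'.2.le⟩⟩
    have key : ‖F r‖ ≤ H₁ * r ^ (n + 2) + H₂ * ω⁻¹ * r ^ (n + 1) := by
      refine norm_le_of_norm_deriv_le_of_tendsto_left (a := 0) (b := 2 * R / 3)
        (F := F) (F' := F') (B := fun x => H₁ * x ^ (n + 2) + H₂ * ω⁻¹ * x ^ (n + 1))
        (B' := fun x => H₁ * ((n + 2 : ℕ) * x ^ (n + 1)) + H₂ * ω⁻¹ * ((n + 1 : ℕ) * x ^ n))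
        (fun x hx => hF x (hsub x hx).1)
        (fun x _ => ((hasDerivAt_pow (n + 2) x).const_mul H₁).add
          ((hasDerivAt_pow (n + 1) x).const_mul (H₂ * ω⁻¹))) ?_ ?_ h0 ⟨hr.1, hlt⟩
      · intro x hx
        obtain ⟨hx', hωx, hx1⟩ := hsub x hx
        have hw := P.w_pos hx'
        have hx0 := hx.1
        refine (hF' x hx').trans ?_
        have e1 : w x ^ (a - 1) ≤ 1 := rpow_le_one hw.le hx1 ha1.le
        have e0 : 0 ≤ w x ^ (a - 1) := rpow_nonneg hw.le _
        have e2 : H₂ / (w x * x) ≤ H₂ * ω⁻¹ / x := by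
          rw [← div_div, div_eq_mul_inv H₂]
          gcongr
        calc w x ^ (a - 1) * x ^ (n + 1) * (H₁ + H₂ / (w x * x))
            ≤ 1 * x ^ (n + 1) * (H₁ + H₂ * ω⁻¹ / x) := by gcongr
          _ = H₁ * (1 * x ^ (n + 1)) + H₂ * ω⁻¹ * (1 * x ^ n) := by field_simp; ring
          _ ≤ _ := by
            gcongr <;> push_cast <;> linarith
      · intro x hx
        have := hx.1
        positivity
    obtain ⟨hx', hωx, hx1⟩ := hsub r ⟨hr.1, hlt⟩
    have hw := P.w_pos hr
    have hr0 := hr.1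
    have e1 : ω ^ a ≤ w r ^ a := rpow_le_rpow hω0.le hωx (by linarith)
    have : H₁ * r ^ (n + 2) + H₂ * ω⁻¹ * r ^ (n + 1) ≤
        K₀ * (w r ^ a * r ^ (n + 2) * (H₁ + H₂ / (w r * r))) := by
      have e3 : 1 ≤ K₀ * w r ^ a * ω := by
        rw [hK₀]
        calc (1 : ℝ) = (ω ^ a)⁻¹ * ω⁻¹ * ω ^ a * ω := by field_simp
          _ ≤ _ := by gcongr
      have e4 : 1 ≤ K₀ * w r ^ a := e3.trans (mul_le_of_le_one_right (by positivity) hω1)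
      calc H₁ * r ^ (n + 2) + H₂ * ω⁻¹ * r ^ (n + 1)
          = 1 * (H₁ * r ^ (n + 2)) + 1 * (H₂ * ω⁻¹ * r ^ (n + 1)) := by ring
        _ ≤ K₀ * w r ^ a * (H₁ * r ^ (n + 2)) +
            K₀ * w r ^ a * ω * (H₂ * ω⁻¹ * r ^ (n + 1)) := by gcongr
        _ = K₀ * w r ^ a * (H₁ * r ^ (n + 2)) + K₀ * w r ^ a * (H₂ * r ^ (n + 1)) := by
            field_simp
        _ ≤ K₀ * w r ^ a * (H₁ * r ^ (n + 2)) + K₀ * w r ^ a * (H₂ / w r * r ^ (n + 1)) := by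
            gcongr
            exact le_div_self hH₂ hw hx1
        _ = _ := by field_simp; ring
    refine key.trans (this.trans ?_)
    gcongr
    linarith
  · have hsub : ∀ x ∈ Ioo ρ R, x ∈ Ioo 0 R := fun x hx => ⟨hρ0.trans hx.1, hx.2⟩
    set L := R ^ n * (1 + R) / (ρ * k * (a - 1)) with hL
    have hL0 : 0 < L := by positivity
    have key : ‖F r‖ ≤ L * (H₁ * w r ^ a + H₂ * w r ^ (a - 1)) := by
      refine norm_le_of_norm_deriv_le_of_tendsto_right (a := ρ) (b := R)
        (F := F) (F' := F') (B := fun x => L * (H₁ * w x ^ a + H₂ * w x ^ (a - 1)))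
        (B' := fun x => L * (H₁ * (a * w x ^ (a - 1) * (x * radSlope w x)) +
          H₂ * ((a - 1) * w x ^ (a - 1 - 1) * (x * radSlope w x))))
        (fun x hx => hF x (hsub x hx))
        (fun x hx => (((P.hasDerivAt_rpow (hsub x hx) a).const_mul H₁).add
          ((P.hasDerivAt_rpow (hsub x hx) (a - 1)).const_mul H₂)).const_mul L) ?_ ?_ hRt
        ⟨by linarith, hr.2⟩
      · intro x hx
        have hx' := hsub x hx
        have hw := P.w_pos hx'
        have hx0 := hx'.1
        refine (hF' x hx').trans ?_
        set W := w x ^ (a - 1 - 1) with hW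
        have hWpos : 0 < W := rpow_pos_of_pos hw _
        have e1 : w x ^ (a - 1) = W * w x := by
          rw [hW, ← rpow_add_one hw.ne', sub_add_cancel]
        rw [e1]
        have e2 : ρ * k ≤ x * -radSlope w x := by
          have := hkr x hx'
          have := hx.1.le
          gcongr
          linarith
        have e3 : L * ((a - 1) * (ρ * k)) = R ^ n * (1 + R) := by
          rw [hL]; field_simp
        have e4 : x ^ (n + 1) ≤ R ^ n * (1 + R) := by
          rw [pow_succ]
          have := hx.2.le
          gcongr
          linarith
        have e5 : x ^ n ≤ R ^ n * (1 + R) := by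
          have : x ^ n ≤ R ^ n := pow_le_pow_left₀ hx0.le hx.2.le n
          exact this.trans (le_mul_of_one_le_right (by positivity) (by linarith))
        calc W * w x * x ^ (n + 1) * (H₁ + H₂ / (w x * x))
            = W * w x * H₁ * x ^ (n + 1) + W * H₂ * x ^ n := by field_simp; ring
          _ ≤ W * w x * H₁ * (R ^ n * (1 + R)) + W * H₂ * (R ^ n * (1 + R)) := by gcongr
          _ = L * (H₁ * ((a - 1) * (W * w x) * (ρ * k)) + H₂ * ((a - 1) * W * (ρ * k))) := by
              rw [← e3]; ring
          _ ≤ L * (H₁ * (a * (W * w x) * (x * -radSlope w x)) +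
              H₂ * ((a - 1) * W * (x * -radSlope w x))) := by
              gcongr
              linarith
          _ = _ := by ring
      · intro x hx
        have := P.w_pos (hsub x hx)
        positivity
    have hw := P.w_pos hr
    have hr0 := hr.1
    have : L * (H₁ * w r ^ a + H₂ * w r ^ (a - 1)) ≤
        K₁ * (w r ^ a * r ^ (n + 2) * (H₁ + H₂ / (w r * r))) := by
      have e1 : w r ^ a = w r ^ (a - 1) * w r := by
        rw [← rpow_add_one hw.ne', sub_add_cancel]
      have hW : 0 < w r ^ (a - 1) := rpow_pos_of_pos hw _
      have e2 : K₁ = L * (ρ ^ (n + 2))⁻¹ * (1 + R) := by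
        rw [hK₁, hL]; field_simp
      have e3 : 1 ≤ (ρ ^ (n + 2))⁻¹ * r ^ (n + 2) := by
        rw [← div_eq_inv_mul, one_le_div (by positivity)]
        exact pow_le_pow_left₀ hρ0.le (by linarith) _
      have e4 : w r * (H₁ + H₂ / (w r * r)) * (1 + R) ≥ H₁ * w r + H₂ := by
        have e5 : w r * (H₁ + H₂ / (w r * r)) = H₁ * w r + H₂ / r := by field_simp
        have e6 : H₂ ≤ H₂ / r * R := by
          rw [div_mul_eq_mul_div, le_div_iff₀ hr0]
          exact mul_le_mul_of_nonneg_left hr.2.le hH₂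
        have e7 : 0 ≤ H₁ * w r * R := by positivity
        have e8 : 0 ≤ H₂ / r := by positivity
        rw [e5]
        nlinarith
      rw [e1, e2]
      calc L * (H₁ * (w r ^ (a - 1) * w r) + H₂ * w r ^ (a - 1))
          = L * w r ^ (a - 1) * 1 * (H₁ * w r + H₂) := by ring
        _ ≤ L * w r ^ (a - 1) * ((ρ ^ (n + 2))⁻¹ * r ^ (n + 2)) *
            (w r * (H₁ + H₂ / (w r * r)) * (1 + R)) := by gcongr
        _ = _ := by ring
    refine key.trans (this.trans ?_)
    gcongr
    linarith

end IsProfile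

/-! ### Bounded continuous radial functions -/

/-- Bounded continuous functions of the radius `r ∈ (0, R)`. -/
abbrev RadFun (R : ℝ) := BoundedContinuousFunction (Ioo (0 : ℝ) R) ℝ

namespace RadFun

variable {R : ℝ}

/-- Extension of a radial function by zero. -/
noncomputable def ext (f : RadFun R) (r : ℝ) : ℝ :=
  open Classical in if h : r ∈ Ioo 0 R then f ⟨r, h⟩ else 0

lemma ext_apply (f : RadFun R) {r : ℝ} (hr : r ∈ Ioo 0 R) : ext f r = f ⟨r, hr⟩ := dif_pos hr

lemma ext_coe (f : RadFun R) (r : Ioo (0 : ℝ) R) : ext f r = f r := ext_apply f r.2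

lemma ext_of_notMem (f : RadFun R) {r : ℝ} (hr : r ∉ Ioo 0 R) : ext f r = 0 := dif_neg hr

@[simp] lemma ext_add (f g : RadFun R) (r : ℝ) : ext (f + g) r = ext f r + ext g r := by
  by_cases hr : r ∈ Ioo 0 R <;> simp [ext, hr]

@[simp] lemma ext_sub (f g : RadFun R) (r : ℝ) : ext (f - g) r = ext f r - ext g r := by
  by_cases hr : r ∈ Ioo 0 R <;> simp [ext, hr]

@[simp] lemma ext_neg (f : RadFun R) (r : ℝ) : ext (-f) r = -ext f r := by
  by_cases hr : r ∈ Ioo 0 R <;> simp [ext, hr]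

@[simp] lemma ext_mul (f g : RadFun R) (r : ℝ) : ext (f * g) r = ext f r * ext g r := by
  by_cases hr : r ∈ Ioo 0 R <;> simp [ext, hr]

@[simp] lemma ext_smul (a : ℝ) (f : RadFun R) (r : ℝ) : ext (a • f) r = a * ext f r := by
  by_cases hr : r ∈ Ioo 0 R <;> simp [ext, hr]

@[simp] lemma ext_zero (r : ℝ) : ext (0 : RadFun R) r = 0 := by
  by_cases hr : r ∈ Ioo 0 R <;> simp [ext, hr]

lemma ext_one {r : ℝ} (hr : r ∈ Ioo 0 R) : ext (1 : RadFun R) r = 1 := by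
  simp [ext, hr]

lemma abs_ext_le (f : RadFun R) (r : ℝ) : |ext f r| ≤ ‖f‖ := by
  by_cases hr : r ∈ Ioo 0 R
  · rw [ext_apply f hr]; exact f.norm_coe_le_norm _
  · rw [ext_of_notMem f hr, abs_zero]; exact norm_nonneg f

lemma norm_le {f : RadFun R} {C : ℝ} (hC : 0 ≤ C) (h : ∀ r ∈ Ioo 0 R, |ext f r| ≤ C) :
    ‖f‖ ≤ C :=
  (BoundedContinuousFunction.norm_le hC).2 fun x => by
    rw [← ext_coe]; exact h x x.2

lemma eq_of_ext {f g : RadFun R} (h : ∀ r ∈ Ioo 0 R, ext f r = ext g r) : f = g := by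
  refine BoundedContinuousFunction.ext fun x => ?_
  rw [← ext_coe, ← ext_coe, h x x.2]

lemma continuousOn_ext (f : RadFun R) : ContinuousOn (ext f) (Ioo 0 R) := by
  rw [continuousOn_iff_continuous_domRestrict]
  convert f.continuous using 1
  ext x
  exact ext_coe f x

lemma continuousAt_ext (f : RadFun R) {r : ℝ} (hr : r ∈ Ioo 0 R) : ContinuousAt (ext f) r :=
  f.continuousOn_ext.continuousAt (isOpen_Ioo.mem_nhds hr)

lemma integrable_ext (f : RadFun R) : Integrable (ext f) := by
  have h : IntegrableOn (ext f) (Ioo 0 R) := by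
    refine Integrable.mono' (integrable_const ‖f‖)
      (f.continuousOn_ext.aestronglyMeasurable measurableSet_Ioo) ?_
    exact Eventually.of_forall fun r => f.abs_ext_le r
  refine h.integrable_of_forall_notMem_eq_zero fun x hx => ext_of_notMem f hx

/-- The bounded continuous function on `(0, R)` given by a function on the line. -/
noncomputable def ofFun (R : ℝ) (f : ℝ → ℝ) : RadFun R :=
  open Classical in
  if h : ContinuousOn f (Ioo 0 R) ∧ ∃ C, ∀ r ∈ Ioo 0 R, |f r| ≤ C then
    BoundedContinuousFunction.ofNormedAddCommGroup (fun x : Ioo 0 R => f x)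
      (continuousOn_iff_continuous_domRestrict.1 h.1) h.2.choose (fun x => h.2.choose_spec x x.2)
  else 0

lemma ext_ofFun {f : ℝ → ℝ} {C r : ℝ} (hc : ContinuousOn f (Ioo 0 R))
    (hC : ∀ r ∈ Ioo 0 R, |f r| ≤ C) (hr : r ∈ Ioo 0 R) : ext (ofFun R f) r = f r := by
  have h : ContinuousOn f (Ioo 0 R) ∧ ∃ C, ∀ r ∈ Ioo 0 R, |f r| ≤ C := ⟨hc, C, hC⟩
  rw [ext_apply _ hr, ofFun, dif_pos h]
  rfl

lemma norm_ofFun_le {f : ℝ → ℝ} {C : ℝ} (hc : ContinuousOn f (Ioo 0 R))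
    (hC : ∀ r ∈ Ioo 0 R, |f r| ≤ C) (h0 : 0 ≤ C) : ‖ofFun R f‖ ≤ C :=
  norm_le h0 fun r hr => by rw [ext_ofFun hc hC hr]; exact hC r hr

/-- The primitive of a radial function based at `x₀`. -/
noncomputable def prim (x₀ r : ℝ) : RadFun R →ₗ[ℝ] ℝ where
  toFun f := ∫ s in x₀..r, ext f s
  map_add' f g := by
    simp only [ext_add]
    exact intervalIntegral.integral_add f.integrable_ext.intervalIntegrable
      g.integrable_ext.intervalIntegrable
  map_smul' a f := by
    simp only [ext_smul]
    exact intervalIntegral.integral_const_mul _ _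

lemma prim_apply (x₀ r : ℝ) (f : RadFun R) : prim x₀ r f = ∫ s in x₀..r, ext f s := rfl

@[simp] lemma prim_self (x₀ : ℝ) (f : RadFun R) : prim x₀ x₀ f = 0 := by simp [prim_apply]

lemma prim_sub_prim (x₀ x y : ℝ) (f : RadFun R) : prim x₀ y f - prim x₀ x f = prim x y f :=
  intervalIntegral.integral_interval_sub_left f.integrable_ext.intervalIntegrable
    f.integrable_ext.intervalIntegrable

lemma abs_prim_le (x₀ r : ℝ) (f : RadFun R) : |prim x₀ r f| ≤ ‖f‖ * |r - x₀| := by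
  rw [prim_apply, ← Real.norm_eq_abs]
  exact intervalIntegral.norm_integral_le_of_norm_le_const fun x _ => f.abs_ext_le x

lemma hasDerivAt_prim (x₀ : ℝ) (f : RadFun R) {r : ℝ} (hr : r ∈ Ioo 0 R) :
    HasDerivAt (fun r => prim x₀ r f) (ext f r) r :=
  intervalIntegral.integral_hasDerivAt_right f.integrable_ext.intervalIntegrable
    (f.integrable_ext.aestronglyMeasurable.stronglyMeasurableAtFilter) (f.continuousAt_ext hr)

lemma continuous_prim (x₀ : ℝ) (f : RadFun R) : Continuous (fun r => prim x₀ r f) :=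
  intervalIntegral.continuous_primitive (fun _ _ => f.integrable_ext.intervalIntegrable) x₀

lemma lipschitz_prim (x₀ x y : ℝ) (f : RadFun R) :
    |prim x₀ y f - prim x₀ x f| ≤ ‖f‖ * |y - x| := by
  rw [prim_sub_prim]; exact abs_prim_le x y f

lemma prim_pos {f : RadFun R} {x y : ℝ} (hxy : x < y)
    (hpos : ∀ r ∈ Ioo x y, 0 < ext f r) : 0 < prim x y f :=
  intervalIntegral.intervalIntegral_pos_of_pos_on f.integrable_ext.intervalIntegrable hpos hxy

/-- Multiplication by the radius. -/
noncomputable def radius (R : ℝ) : RadFun R := ofFun R id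

lemma ext_radius {r : ℝ} (hr : r ∈ Ioo 0 R) : ext (radius R) r = r :=
  ext_ofFun (C := R) continuousOn_id (fun r hr => by
    rw [id, abs_of_pos hr.1]; exact hr.2.le) hr

/-- The primitive based at `R / 2` as an operator on bounded continuous functions. -/
noncomputable def primOp (R : ℝ) : RadFun R →L[ℝ] RadFun R :=
  LinearMap.mkContinuous
    { toFun := fun f => ofFun R fun r => prim (R / 2) r f
      map_add' := fun f g => by
        have H : ∀ f : RadFun R, ∀ r ∈ Ioo 0 R, |prim (R / 2) r f| ≤ ‖f‖ * R := fun f r hr =>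
          (abs_prim_le _ r f).trans (mul_le_mul_of_nonneg_left
            (abs_le.2 ⟨by linarith [hr.1, hr.2], by linarith [hr.1, hr.2]⟩) (norm_nonneg _))
        refine eq_of_ext fun r hr => ?_
        rw [ext_add, ext_ofFun (continuous_prim _ _).continuousOn (H _) hr,
          ext_ofFun (continuous_prim _ _).continuousOn (H _) hr,
          ext_ofFun (continuous_prim _ _).continuousOn (H _) hr, map_add]
      map_smul' := fun a f => by
        have H : ∀ f : RadFun R, ∀ r ∈ Ioo 0 R, |prim (R / 2) r f| ≤ ‖f‖ * R := fun f r hr =>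
          (abs_prim_le _ r f).trans (mul_le_mul_of_nonneg_left
            (abs_le.2 ⟨by linarith [hr.1, hr.2], by linarith [hr.1, hr.2]⟩) (norm_nonneg _))
        refine eq_of_ext fun r hr => ?_
        rw [RingHom.id_apply, ext_smul, ext_ofFun (continuous_prim _ _).continuousOn (H _) hr,
          ext_ofFun (continuous_prim _ _).continuousOn (H _) hr, map_smul, smul_eq_mul] }
    |R| fun f => by
      refine norm_ofFun_le (continuous_prim _ _).continuousOn (fun r hr => ?_) (by positivity)
      rw [mul_comm]
      refine (abs_prim_le _ r f).trans (mul_le_mul_of_nonneg_left ?_ (norm_nonneg _))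
      rw [abs_of_pos (hr.1.trans hr.2)]
      exact abs_le.2 ⟨by linarith [hr.1, hr.2], by linarith [hr.1, hr.2]⟩

lemma ext_primOp (f : RadFun R) {r : ℝ} (hr : r ∈ Ioo 0 R) :
    ext (primOp R f) r = prim (R / 2) r f :=
  ext_ofFun (C := ‖f‖ * R) (continuous_prim _ _).continuousOn (fun r hr =>
    (abs_prim_le _ r f).trans (mul_le_mul_of_nonneg_left
      (abs_le.2 ⟨by linarith [hr.1, hr.2], by linarith [hr.1, hr.2]⟩) (norm_nonneg _))) hr

lemma isCompactOperator_primOp (R : ℝ) : IsCompactOperator (primOp R) := by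
  refine (isCompactOperator_iff_image_closedBall_subset_compact (𝕜₁ := ℝ) (primOp R).toLinearMap
    zero_lt_one).2 ?_
  let 𝒦 : Set (BoundedContinuousFunction (Icc (0 : ℝ) R) ℝ) :=
    {f | (∀ x, f x ∈ Icc (-R) R) ∧ ∀ x y, |f x - f y| ≤ |(x : ℝ) - y|}
  have hclosed : IsClosed 𝒦 := by
    have h1 : ∀ x, Continuous fun f : BoundedContinuousFunction (Icc (0 : ℝ) R) ℝ => f x :=
      fun x => (BoundedContinuousFunction.evalCLM ℝ x).continuous
    have : 𝒦 = (⋂ x : Icc (0 : ℝ) R, {f | f x ∈ Icc (-R) R}) ∩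
        ⋂ x : Icc (0 : ℝ) R, ⋂ y : Icc (0 : ℝ) R, {f | |f x - f y| ≤ |(x : ℝ) - y|} := by
      refine Set.ext fun f => ?_
      simp only [𝒦, mem_ofPred_eq, mem_inter_iff, mem_iInter]
    rw [this]
    refine (isClosed_iInter fun x => isClosed_Icc.preimage (h1 x)).inter
      (isClosed_iInter fun x => isClosed_iInter fun y => ?_)
    exact isClosed_le ((h1 x).sub (h1 y)).abs continuous_const
  have hcomp : IsCompact 𝒦 := by
    refine BoundedContinuousFunction.arzela_ascoli₂ (Icc (-R) R) isCompact_Icc 𝒦 hclosed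
      (fun f x hf => hf.1 x) ?_
    refine (LipschitzWith.uniformEquicontinuous _ 1 fun f => ?_).equicontinuous
    refine LipschitzWith.of_dist_le_mul fun x y => ?_
    rw [NNReal.coe_one, one_mul]
    exact f.2.2 x y
  let incl : C(Ioo (0 : ℝ) R, Icc (0 : ℝ) R) :=
    ⟨fun x => ⟨x, Ioo_subset_Icc_self x.2⟩, by fun_prop⟩
  refine ⟨(fun f : BoundedContinuousFunction (Icc (0 : ℝ) R) ℝ => f.compContinuous incl) '' 𝒦,
    hcomp.image (BoundedContinuousFunction.continuous_compContinuous incl), ?_⟩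
  rintro _ ⟨f, hf, rfl⟩
  rw [mem_closedBall_zero_iff] at hf
  let g : BoundedContinuousFunction (Icc (0 : ℝ) R) ℝ :=
    BoundedContinuousFunction.mkOfCompact ⟨fun x => prim (R / 2) (x : ℝ) f,
      (continuous_prim (R / 2) f).comp continuous_subtype_val⟩
  refine ⟨g, ⟨fun x => ?_, fun x y => ?_⟩, ?_⟩
  · refine abs_le.1 ((abs_prim_le (R / 2) x f).trans ?_)
    have : |(x : ℝ) - R / 2| ≤ R :=
      abs_le.2 ⟨by linarith [x.2.1, x.2.2], by linarith [x.2.1, x.2.2]⟩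
    calc ‖f‖ * |(x : ℝ) - R / 2| ≤ 1 * R := by gcongr
      _ = R := one_mul R
  · refine (lipschitz_prim (R / 2) y x f).trans ?_
    exact mul_le_of_le_one_left (abs_nonneg _) hf
  · exact BoundedContinuousFunction.ext fun x =>
      ((ext_coe _ x).symm.trans (ext_primOp f x.2)).symm

/-- Evaluation at the midpoint `R / 2`. -/
noncomputable def midEval (hR : 0 < R) : RadFun R →L[ℝ] ℝ :=
  BoundedContinuousFunction.evalCLM ℝ ⟨R / 2, ⟨by linarith, by linarith⟩⟩

lemma midEval_apply (hR : 0 < R) (f : RadFun R) : midEval hR f = ext f (R / 2) :=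
  (ext_coe f ⟨R / 2, ⟨by linarith, by linarith⟩⟩).symm

end RadFun

namespace IsProfile

open RadFun

variable {α c R : ℝ} {w : ℝ → ℝ} (P : IsProfile α c R w)

include P

/-! ### The linearized operator -/

lemma continuousOn_w_rpow (s : ℝ) : ContinuousOn (fun r => w r ^ s) (Ioo 0 R) := fun _ hr =>
  (P.hasDerivAt_rpow hr s).continuousAt.continuousWithinAt

lemma continuousOn_radSlope : ContinuousOn (radSlope w) (Ioo 0 R) := fun _ hr =>
  (P.hasDerivAt_radSlope hr).continuousAt.continuousWithinAt

omit P in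
/-- The weight `w ^ α * r ^ 4`. -/
noncomputable def massDensity (_ : IsProfile α c R w) : RadFun R :=
  ofFun R fun r => w r ^ α * r ^ 4

lemma ext_massDensity {r : ℝ} (hr : r ∈ Ioo 0 R) : ext P.massDensity r = w r ^ α * r ^ 4 := by
  refine ext_ofFun (C := R ^ 4) ((P.continuousOn_w_rpow α).mul (by fun_prop)) (fun r hr => ?_) hr
  have h := P.w_nonneg (Ioo_subset_Icc_self hr)
  rw [abs_of_nonneg (mul_nonneg (rpow_nonneg h _) (by positivity))]
  calc w r ^ α * r ^ 4 ≤ 1 * R ^ 4 :=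
        mul_le_mul (rpow_le_one h (P.w_le_one (Ioo_subset_Icc_self hr)) P.α_pos.le)
          (pow_le_pow_left₀ hr.1.le hr.2.le 4) (by have := hr.1; positivity) zero_le_one
    _ = R ^ 4 := one_mul _

omit P in
/-- The function `-(1 + α) * w'(r) / r`. -/
noncomputable def gravity (_ : IsProfile α c R w) : RadFun R :=
  ofFun R fun r => -(1 + α) * radSlope w r

lemma ext_gravity {r : ℝ} (hr : r ∈ Ioo 0 R) : ext P.gravity r = -(1 + α) * radSlope w r := by
  refine ext_ofFun (C := (1 + α) * (c / 3)) (continuousOn_const.mul P.continuousOn_radSlope)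
    (fun r hr => ?_) hr
  have h := P.α_pos
  rw [abs_mul, abs_neg, abs_of_pos (by linarith : 0 < 1 + α)]
  exact mul_le_mul_of_nonneg_left (P.abs_radSlope_le hr) (by linarith)

lemma mass_pos : 0 < prim 0 R P.massDensity := prim_pos P.R_pos fun r hr => by
  have := P.w_pos hr
  have := hr.1
  rw [P.ext_massDensity hr]
  positivity

omit P in
/-- The average of a radial function with respect to the weight `w ^ α * r ^ 4`. -/
noncomputable def avg (P : IsProfile α c R w) : RadFun R →L[ℝ] ℝ :=
  ((prim 0 R P.massDensity)⁻¹ • (prim 0 R ∘ₗ LinearMap.mul ℝ (RadFun R) P.massDensity)).mkContinuous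
    (|(prim 0 R P.massDensity)⁻¹| * (‖P.massDensity‖ * |R - 0|)) fun f => by
      rw [LinearMap.smul_apply, norm_smul, LinearMap.comp_apply, LinearMap.mul_apply',
        Real.norm_eq_abs, Real.norm_eq_abs, mul_assoc]
      refine mul_le_mul_of_nonneg_left ((abs_prim_le _ _ _).trans ?_) (abs_nonneg _)
      rw [mul_right_comm]
      exact mul_le_mul_of_nonneg_right (norm_mul_le _ _) (abs_nonneg _)

lemma prim_massDensity_mul (f : RadFun R) :
    prim 0 R (P.massDensity * f) = prim 0 R P.massDensity * P.avg f := by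
  have := P.mass_pos.ne'
  simp [avg, this]

lemma avg_one : P.avg 1 = 1 := by
  have h := P.prim_massDensity_mul 1
  rw [mul_one] at h
  exact (mul_right_eq_self₀.1 h.symm).resolve_right P.mass_pos.ne'

lemma prim_centered (f : RadFun R) : prim 0 R (P.massDensity * (f - P.avg f • 1)) = 0 := by
  rw [P.prim_massDensity_mul, map_sub, map_smul, P.avg_one]
  simp

omit P in
lemma tendsto_prim_zero (f : RadFun R) :
    Tendsto (fun r => prim 0 r f) (nhdsWithin 0 (Ioi 0)) (nhds 0) := by
  have h := ((continuous_prim 0 f).tendsto 0).mono_left (nhdsWithin_le_nhds (s := Ioi 0))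
  rwa [prim_self] at h

lemma exists_abs_prim_centered_le : ∃ C > 0, ∀ f : RadFun R, ∀ r ∈ Ioo 0 R,
    |prim 0 r (P.massDensity * (f - P.avg f • 1))| ≤ C * (w r ^ (1 + α) * r ^ 5 * ‖f‖) := by
  have hα := P.α_pos
  obtain ⟨C, hC, H⟩ := P.exists_hardy (a := 1 + α) (by linarith) (b := 5) (by norm_num)
  refine ⟨C * (1 + ‖P.avg‖), by positivity, fun f r hr => ?_⟩
  have hR := ((continuous_prim 0 (P.massDensity * (f - P.avg f • 1))).tendsto R).mono_left
    (nhdsWithin_le_nhds (s := Iio R))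
  rw [P.prim_centered] at hR
  have hf : ∀ r ∈ Ioo 0 R, |ext (f - P.avg f • 1) r| ≤ (1 + ‖P.avg‖) * ‖f‖ := fun r hr => by
    rw [ext_sub, ext_smul, ext_one hr, mul_one, add_mul, one_mul]
    exact (abs_sub _ _).trans (add_le_add (abs_ext_le f r) (P.avg.le_opNorm f))
  have h := H ℝ (fun r => prim 0 r (P.massDensity * (f - P.avg f • 1))) _ ((1 + ‖P.avg‖) * ‖f‖) 0
    (by positivity) le_rfl (fun r hr => hasDerivAt_prim 0 _ hr) (fun r hr => by
      rw [zero_div, add_zero, ext_mul, P.ext_massDensity hr, norm_mul, Real.norm_eq_abs,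
        Real.norm_eq_abs, abs_of_nonneg (mul_nonneg (rpow_nonneg (P.w_pos hr).le _)
          (pow_nonneg hr.1.le 4))]
      have hw := P.w_pos hr
      have hr0 := hr.1
      rw [show 1 + α - 1 = α by ring, show 5 - 1 = 4 from rfl]
      exact mul_le_mul_of_nonneg_left (hf r hr) (by positivity))
    (tendsto_prim_zero _) hR r hr
  rw [Real.norm_eq_abs] at h
  refine h.trans (le_of_eq ?_)
  rw [zero_div]
  ring

lemma continuousOn_slopeFun (f : RadFun R) : ContinuousOn (fun r => -(α / (1 + α)) *
    (prim 0 r (P.massDensity * (f - P.avg f • 1)) / (w r ^ (1 + α) * r ^ 5))) (Ioo 0 R) := by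
  refine continuousOn_const.mul ((continuous_prim _ _).continuousOn.div
    ((P.continuousOn_w_rpow _).mul (by fun_prop)) fun r hr => ?_)
  have := P.w_pos hr
  have := hr.1
  positivity

lemma exists_abs_slopeFun_le : ∃ C > 0, ∀ f : RadFun R, ∀ r ∈ Ioo 0 R, |-(α / (1 + α)) *
    (prim 0 r (P.massDensity * (f - P.avg f • 1)) / (w r ^ (1 + α) * r ^ 5))| ≤ C * ‖f‖ := by
  obtain ⟨C, hC, H⟩ := P.exists_abs_prim_centered_le
  have hα := P.α_pos
  refine ⟨α / (1 + α) * C, by positivity, fun f r hr => ?_⟩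
  have hw := P.w_pos hr
  have hr0 := hr.1
  have hq : 0 < w r ^ (1 + α) * r ^ 5 := by positivity
  rw [abs_mul, abs_neg, abs_of_pos (by positivity : 0 < α / (1 + α)), abs_div, abs_of_pos hq,
    mul_assoc]
  refine mul_le_mul_of_nonneg_left ?_ (by positivity)
  rw [div_le_iff₀ hq]
  refine (H f r hr).trans (le_of_eq (by ring))

omit P in
/-- The operator `f ↦ ζ' / r`, where `ζ` solves the Neumann problem
`((1 + α) / α) * (w ^ (1 + α) * r ^ 4 * ζ')' = -w ^ α * r ^ 4 * (f - avg f)`. -/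
noncomputable def slopeOp (P : IsProfile α c R w) : RadFun R →L[ℝ] RadFun R :=
  LinearMap.mkContinuousOfExistsBound
    { toFun := fun f => ofFun R fun r => -(α / (1 + α)) *
        (prim 0 r (P.massDensity * (f - P.avg f • 1)) / (w r ^ (1 + α) * r ^ 5))
      map_add' := fun f g => by
        obtain ⟨C, -, hC⟩ := P.exists_abs_slopeFun_le
        refine eq_of_ext fun r hr => ?_
        rw [ext_add, ext_ofFun (P.continuousOn_slopeFun _) (hC _) hr,
          ext_ofFun (P.continuousOn_slopeFun _) (hC _) hr,
          ext_ofFun (P.continuousOn_slopeFun _) (hC _) hr, map_add,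
          show P.massDensity * (f + g - (P.avg f + P.avg g) • 1) =
            P.massDensity * (f - P.avg f • 1) + P.massDensity * (g - P.avg g • 1) by
              rw [add_smul]; ring, map_add]
        ring
      map_smul' := fun a f => by
        obtain ⟨C, -, hC⟩ := P.exists_abs_slopeFun_le
        refine eq_of_ext fun r hr => ?_
        rw [RingHom.id_apply, ext_smul, ext_ofFun (P.continuousOn_slopeFun _) (hC _) hr,
          ext_ofFun (P.continuousOn_slopeFun _) (hC _) hr, map_smul,
          show P.massDensity * (a • f - (a • P.avg f) • 1) =
            a • (P.massDensity * (f - P.avg f • 1)) by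
              rw [smul_assoc, ← mul_smul_comm, smul_sub], map_smul, smul_eq_mul]
        ring }
    (by
      obtain ⟨C, hC0, hC⟩ := P.exists_abs_slopeFun_le
      exact ⟨C, fun f => norm_ofFun_le (P.continuousOn_slopeFun _) (hC _) (by positivity)⟩)

lemma ext_slopeOp (f : RadFun R) {r : ℝ} (hr : r ∈ Ioo 0 R) : ext (P.slopeOp f) r = -(α / (1 + α)) *
    (prim 0 r (P.massDensity * (f - P.avg f • 1)) / (w r ^ (1 + α) * r ^ 5)) := by
  obtain ⟨C, -, hC⟩ := P.exists_abs_slopeFun_le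
  exact ext_ofFun (P.continuousOn_slopeFun _) (hC _) hr

lemma hasDerivAt_weight {r : ℝ} (hr : r ∈ Ioo 0 R) (a : ℝ) (b : ℕ) :
    HasDerivAt (fun r => w r ^ a * r ^ b)
      (w r ^ a * r ^ b * ((b * w r + a * (r ^ 2 * radSlope w r)) / (w r * r))) r := by
  refine ((P.hasDerivAt_rpow hr a).mul (hasDerivAt_pow b r)).congr_deriv ?_
  have hw := P.w_pos hr
  have hr0 := hr.1
  rw [rpow_sub_one hw.ne']
  rcases b with _ | b
  · simp
    field_simp
  · rw [Nat.add_sub_cancel]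
    field_simp
    ring

lemma hasDerivAt_slopeOp (f : RadFun R) {r : ℝ} (hr : r ∈ Ioo 0 R) :
    HasDerivAt (ext (P.slopeOp f)) ((-(α / (1 + α)) * (ext f r - P.avg f) -
      (5 * w r + (1 + α) * (r ^ 2 * radSlope w r)) * ext (P.slopeOp f) r) / (w r * r)) r := by
  have hw := P.w_pos hr
  have hr0 := hr.1
  have hα := P.α_pos
  have h1 : (ext (P.slopeOp f)) =ᶠ[nhds r] fun r => -(α / (1 + α)) *
    (prim 0 r (P.massDensity * (f - P.avg f • 1)) / (w r ^ (1 + α) * r ^ 5)) := by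
    filter_upwards [isOpen_Ioo.mem_nhds hr] with x hx using P.ext_slopeOp f hx
  refine HasDerivAt.congr_of_eventuallyEq ?_ h1
  refine (((hasDerivAt_prim 0 _ hr).div (P.hasDerivAt_weight hr (1 + α) 5)
    (by positivity)).const_mul _).congr_deriv ?_
  rw [P.ext_slopeOp f hr, ext_mul, P.ext_massDensity hr, ext_sub, ext_smul, ext_one hr,
    rpow_one_add' hw.le (by positivity)]
  push_cast
  field_simp
  ring

omit P in
/-- The solution operator of the Neumann problem, normalized so that its kernel is trivial. -/
noncomputable def neumannOp (P : IsProfile α c R w) : RadFun R →L[ℝ] RadFun R :=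
  (primOp R ∘L ContinuousLinearMap.mul ℝ (RadFun R) (radius R)) ∘L P.slopeOp +
    P.avg.smulRight (1 : RadFun R)

lemma neumannOp_apply (f : RadFun R) :
    P.neumannOp f = primOp R (radius R * P.slopeOp f) + P.avg f • 1 := rfl

lemma isCompactOperator_neumannOp : IsCompactOperator P.neumannOp := by
  refine IsCompactOperator.add (f := ((primOp R ∘L ContinuousLinearMap.mul ℝ (RadFun R) (radius R))
    ∘L P.slopeOp)) (g := P.avg.smulRight (1 : RadFun R)) ?_ ?_
  · rw [ContinuousLinearMap.comp_assoc]
    exact (isCompactOperator_primOp R).comp_clm _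
  · exact (isCompactOperator_of_locallyCompactSpace_rng
      (ContinuousLinearMap.toSpanSingleton ℝ (1 : RadFun R))).comp_clm P.avg

end IsProfile

namespace IsProfile

open RadFun

variable {α c R : ℝ} {w : ℝ → ℝ} (P : IsProfile α c R w)

include P

/-! ### The spectral family -/

omit P in
/-- The zeroth order coefficient of the linearized operator. -/
noncomputable def potential (P : IsProfile α c R w) : RadFun R :=
  (4 - 3 * ((1 + α) / α)) • P.gravity

omit P in
/-- The operator `1 + 𝒯 (s - U) - ℓ ⊗ 1`, where `𝒯` is the Neumann operator, `U` the potential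
and `ℓ` the evaluation at the midpoint. -/
noncomputable def spectralOp (P : IsProfile α c R w) (s : ℝ) : RadFun R →L[ℝ] RadFun R :=
  1 - ((midEval P.R_pos).smulRight (1 : RadFun R) -
    P.neumannOp ∘L ContinuousLinearMap.mul ℝ (RadFun R) (s • 1 - P.potential))

lemma spectralOp_apply (s : ℝ) (ζ : RadFun R) : P.spectralOp s ζ =
    ζ - (midEval P.R_pos ζ • 1 - P.neumannOp ((s • 1 - P.potential) * ζ)) := rfl

lemma spectralOp_sub (s t : ℝ) (ζ : RadFun R) :
    P.spectralOp s ζ = P.spectralOp t ζ + P.neumannOp ((s - t) • ζ) := by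
  rw [spectralOp_apply, spectralOp_apply, show (s • 1 - P.potential) * ζ =
    (t • 1 - P.potential) * ζ + (s - t) • ζ by
      simp only [sub_mul, smul_mul_assoc, one_mul]
      rw [sub_smul s t ζ]
      generalize s • ζ = x
      generalize t • ζ = y
      abel, map_add]
  abel

/-- The centred right-hand side of a solution of `spectralOp s ζ = neumannOp f`. -/
lemma eq_of_spectralOp_eq {s : ℝ} {ζ f : RadFun R} (h : P.spectralOp s ζ = P.neumannOp f) :
    P.avg (f - (s • 1 - P.potential) * ζ) = 0 ∧
      ζ = primOp R (radius R * P.slopeOp (f - (s • 1 - P.potential) * ζ)) +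
        midEval P.R_pos ζ • 1 := by
  have hR := P.R_pos
  have h1 : ζ = P.neumannOp (f - (s • 1 - P.potential) * ζ) + midEval P.R_pos ζ • 1 := by
    rw [map_sub, ← h, spectralOp_apply]
    abel
  have hmid : (R / 2) ∈ Ioo 0 R := ⟨by linarith, by linarith⟩
  have h2 := congrArg (midEval P.R_pos) h1
  rw [neumannOp_apply, map_add, map_add, map_smul, map_smul, midEval_apply _ (primOp R _),
    ext_primOp _ hmid, prim_self, midEval_apply _ (1 : RadFun R), ext_one hmid] at h2
  have h3 : P.avg (f - (s • 1 - P.potential) * ζ) = 0 := by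
    simp only [smul_eq_mul, mul_one, zero_add] at h2
    linarith
  refine ⟨h3, ?_⟩
  rw [neumannOp_apply, h3, zero_smul, add_zero] at h1
  exact h1

/-- The maximum principle for the Neumann problem. -/
lemma le_of_pos_below {h ζ : RadFun R} {k C : ℝ} (havg : P.avg h = 0)
    (hζ : ζ = primOp R (radius R * P.slopeOp h) + k • 1)
    (hpos : ∀ r ∈ Ioo 0 R, ext ζ r < C → 0 < ext h r) : ∀ r ∈ Ioo 0 R, C ≤ ext ζ r := by
  intro r₁ hr₁
  by_contra! hlt
  have hR := P.R_pos
  have hα := P.α_pos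
  set Z : ℝ → ℝ := fun r => prim (R / 2) r (radius R * P.slopeOp h) + k with hZ
  have hZζ : ∀ r ∈ Ioo 0 R, ext ζ r = Z r := fun r hr => by
    rw [hζ, ext_add, ext_primOp _ hr, ext_smul, ext_one hr, mul_one]
  have hZc : Continuous Z := (continuous_prim _ _).add continuous_const
  have hcen : ∀ r ∈ Ioo 0 R, HasDerivAt Z (r * (-(α / (1 + α)) *
      (prim 0 r (P.massDensity * h) / (w r ^ (1 + α) * r ^ 5)))) r := fun r hr => by
    refine ((hasDerivAt_prim (R / 2) _ hr).add_const k).congr_deriv ?_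
    rw [ext_mul, ext_radius hr, P.ext_slopeOp _ hr, havg, zero_smul, sub_zero]
  obtain ⟨r₀, hr₀, hmin⟩ := isCompact_Icc.exists_isMinOn (nonempty_Icc.2 hR.le) hZc.continuousOn
  have hlt0 : Z r₀ < C :=
    (hmin (Ioo_subset_Icc_self hr₁)).trans_lt (by rw [← hZζ r₁ hr₁]; exact hlt)
  have hmR : prim 0 R (P.massDensity * h) = 0 := by rw [P.prim_massDensity_mul, havg, mul_zero]
  have hJ0 : prim 0 r₀ (P.massDensity * h) = 0 := by
    rcases hr₀.1.eq_or_lt with h0 | h0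
    · rw [← h0, prim_self]
    rcases hr₀.2.eq_or_lt with h1 | h1
    · rw [h1, hmR]
    have hI : r₀ ∈ Ioo 0 R := ⟨h0, h1⟩
    have hd := (hmin.isLocalMin (Icc_mem_nhds h0 h1)).hasDerivAt_eq_zero (hcen r₀ hI)
    have hw := P.w_pos hI
    have hq : 0 < w r₀ ^ (1 + α) * r₀ ^ 5 := by positivity
    have hαα : α / (1 + α) ≠ 0 := by positivity
    simpa [h0.ne', hαα, hq.ne', hw.ne', (rpow_pos_of_pos hw _).ne'] using hd
  obtain ⟨d, hd, hball⟩ := Metric.eventually_nhds_iff.1 (hZc.continuousAt.eventually_lt_const hlt0)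
  have hmpos : ∀ r ∈ Ioo 0 R, Z r < C → 0 < ext (P.massDensity * h) r := fun r hr hrC => by
    have hw := P.w_pos hr
    have hr0 := hr.1
    have := hpos r hr (by rwa [hZζ r hr])
    rw [ext_mul, P.ext_massDensity hr]
    positivity
  have hfac : ∀ r ∈ Ioo 0 R, 0 < r * (α / (1 + α)) / (w r ^ (1 + α) * r ^ 5) := fun r hr => by
    have hw := P.w_pos hr
    have hr0 := hr.1
    positivity
  rcases hr₀.2.lt_or_eq with h1 | h1
  · set r₂ := min (r₀ + d / 2) ((r₀ + R) / 2) with hr₂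
    have h02 : r₀ < r₂ := lt_min (by linarith) (by linarith)
    have h2R : r₂ < R := (min_le_right _ _).trans_lt (by linarith)
    have h2d : r₂ ≤ r₀ + d / 2 := min_le_left _ _
    have hI : ∀ x ∈ Ioo r₀ r₂, x ∈ Ioo 0 R ∧ Z x < C := fun x hx =>
      ⟨⟨hr₀.1.trans_lt hx.1, hx.2.trans h2R⟩, hball (by
        rw [Real.dist_eq, abs_lt]; exact ⟨by linarith [hx.1], by linarith [hx.2]⟩)⟩
    have hanti : StrictAntiOn Z (Icc r₀ r₂) := by
      refine strictAntiOn_of_deriv_neg (convex_Icc _ _) hZc.continuousOn fun x hx => ?_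
      rw [interior_Icc] at hx
      rw [(hcen x (hI x hx).1).deriv]
      have hp : 0 < prim 0 x (P.massDensity * h) := by
        have : 0 < prim r₀ x (P.massDensity * h) :=
          prim_pos hx.1 fun y hy => hmpos y (hI y ⟨hy.1, hy.2.trans hx.2⟩).1
          (hI y ⟨hy.1, hy.2.trans hx.2⟩).2
        rw [← prim_sub_prim 0, hJ0] at this
        linarith
      have := mul_pos (hfac x (hI x hx).1) hp
      have e : x * (-(α / (1 + α)) * (prim 0 x (P.massDensity * h) / (w x ^ (1 + α) * x ^ 5))) =
        -(x * (α / (1 + α)) / (w x ^ (1 + α) * x ^ 5) * prim 0 x (P.massDensity * h)) := by ring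
      rw [e]
      linarith
    exact absurd (hmin ⟨hr₀.1.trans h02.le, h2R.le⟩)
      (not_le.2 (hanti (left_mem_Icc.2 h02.le) (right_mem_Icc.2 h02.le) h02))
  · set r₂ := max (r₀ - d / 2) (r₀ / 2) with hr₂
    have h02 : r₂ < r₀ := max_lt (by linarith) (by linarith)
    have h2R : 0 < r₂ := lt_of_lt_of_le (by linarith) (le_max_right _ _)
    have h2d : r₀ - d / 2 ≤ r₂ := le_max_left _ _
    have hI : ∀ x ∈ Ioo r₂ r₀, x ∈ Ioo 0 R ∧ Z x < C := fun x hx =>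
      ⟨⟨h2R.trans hx.1, h1 ▸ hx.2⟩, hball (by
        rw [Real.dist_eq, abs_lt]; exact ⟨by linarith [hx.1], by linarith [hx.2]⟩)⟩
    have hmono : StrictMonoOn Z (Icc r₂ r₀) := by
      refine strictMonoOn_of_deriv_pos (convex_Icc _ _) hZc.continuousOn fun x hx => ?_
      rw [interior_Icc] at hx
      rw [(hcen x (hI x hx).1).deriv]
      have hp : prim 0 x (P.massDensity * h) < 0 := by
        have : 0 < prim x r₀ (P.massDensity * h) :=
          prim_pos hx.2 fun y hy => hmpos y (hI y ⟨hx.1.trans hy.1, hy.2⟩).1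
            (hI y ⟨hx.1.trans hy.1, hy.2⟩).2
        rw [← prim_sub_prim 0, hJ0] at this
        linarith
      have := mul_pos (hfac x (hI x hx).1) (neg_pos.2 hp)
      have e : x * (-(α / (1 + α)) * (prim 0 x (P.massDensity * h) / (w x ^ (1 + α) * x ^ 5))) =
        x * (α / (1 + α)) / (w x ^ (1 + α) * x ^ 5) * -prim 0 x (P.massDensity * h) := by ring
      rw [e]
      exact this
    exact absurd (hmin ⟨h2R.le, h02.le.trans hr₀.2⟩)
      (not_le.2 (hmono (left_mem_Icc.2 h02.le) (right_mem_Icc.2 h02.le) h02))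

lemma le_ext_of_spectralOp_eq {s C : ℝ} {ζ f : RadFun R} (h : P.spectralOp s ζ = P.neumannOp f)
    (hpos : ∀ r ∈ Ioo 0 R, ext ζ r < C → 0 < ext f r - (s - ext P.potential r) * ext ζ r) :
    ∀ r ∈ Ioo 0 R, C ≤ ext ζ r := by
  obtain ⟨h1, h2⟩ := P.eq_of_spectralOp_eq h
  refine P.le_of_pos_below h1 h2 fun r hr hrC => ?_
  have := hpos r hr hrC
  rwa [ext_sub, ext_mul, ext_sub, ext_smul, ext_one hr, mul_one]

omit P in
/-- The parameters at which the linearized operator is invertible. -/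
def IsRegular (P : IsProfile α c R w) (s : ℝ) : Prop := IsUnit (P.spectralOp s)

lemma continuous_spectralOp : Continuous P.spectralOp := by
  have h1 : Continuous fun s : ℝ => s • (1 : RadFun R) - P.potential :=
    (continuous_id.smul continuous_const).sub continuous_const
  have h2 := (ContinuousLinearMap.compL ℝ (RadFun R) (RadFun R) (RadFun R)
    P.neumannOp).continuous.comp ((ContinuousLinearMap.mul ℝ (RadFun R)).continuous.comp h1)
  have h3 : ∀ {E : Type} [NormedAddCommGroup E] [NormedSpace ℝ E] (A : E →L[ℝ] E)
      (f : ℝ → (E →L[ℝ] E)), Continuous f → Continuous fun s => A - f s :=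
    fun A f hf => continuous_const.sub hf
  exact h3 (1 : RadFun R →L[ℝ] RadFun R) _ (h3 ((midEval P.R_pos).smulRight (1 : RadFun R)) _ h2)

lemma isOpen_isRegular : IsOpen {s | P.IsRegular s} :=
  (Units.isOpen (R := RadFun R →L[ℝ] RadFun R)).preimage P.continuous_spectralOp

lemma exists_eigenfunction {s : ℝ} (hs : ¬ P.IsRegular s) :
    ∃ φ : RadFun R, φ ≠ 0 ∧ P.spectralOp s φ = 0 := by
  set T := (midEval P.R_pos).smulRight (1 : RadFun R) -
    P.neumannOp ∘L ContinuousLinearMap.mul ℝ (RadFun R) (s • 1 - P.potential) with hT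
  have hc : IsCompactOperator T := by
    refine IsCompactOperator.sub (f := (midEval P.R_pos).smulRight (1 : RadFun R))
      (g := P.neumannOp ∘L ContinuousLinearMap.mul ℝ (RadFun R) (s • 1 - P.potential)) ?_ ?_
    · exact (isCompactOperator_of_locallyCompactSpace_rng
        (ContinuousLinearMap.toSpanSingleton ℝ (1 : RadFun R))).comp_clm (midEval P.R_pos)
    · exact P.isCompactOperator_neumannOp.comp_clm _
  rcases hc.hasEigenvalue_or_mem_resolventSet one_ne_zero with h | h
  · obtain ⟨φ, hφ⟩ := h.exists_hasEigenvector
    refine ⟨φ, hφ.2, ?_⟩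
    have h1 : T φ = φ := by simpa using hφ.apply_eq_smul
    have h2 : P.spectralOp s φ = φ - T φ := rfl
    rw [h2, h1, sub_self]
  · rw [spectrum.mem_resolventSet_iff, map_one] at h
    exact absurd h hs

omit P in
/-- The resolvent of the linearized operator. -/
noncomputable def resolventOp (P : IsProfile α c R w) (s : ℝ) : RadFun R →L[ℝ] RadFun R :=
  Ring.inverse (P.spectralOp s) ∘L P.neumannOp

lemma spectralOp_resolventOp {s : ℝ} (hs : P.IsRegular s) (f : RadFun R) :
    P.spectralOp s (P.resolventOp s f) = P.neumannOp f :=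
  DFunLike.congr_fun (Ring.mul_inverse_cancel _ hs) (P.neumannOp f)

lemma resolventOp_eq {s : ℝ} (hs : P.IsRegular s) {f ζ : RadFun R}
    (h : P.spectralOp s ζ = P.neumannOp f) : P.resolventOp s f = ζ := by
  have := DFunLike.congr_fun (Ring.inverse_mul_cancel _ hs) ζ
  change Ring.inverse (P.spectralOp s) (P.neumannOp f) = ζ
  rw [← h]
  exact this

lemma continuousAt_resolventOp {s : ℝ} (hs : P.IsRegular s) : ContinuousAt P.resolventOp s := by
  obtain ⟨u, hu⟩ := hs
  have h1 : ContinuousAt (fun s => Ring.inverse (P.spectralOp s)) s := by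
    have := NormedRing.inverse_continuousAt (R := RadFun R →L[ℝ] RadFun R) u
    rw [hu] at this
    exact ContinuousAt.comp (f := P.spectralOp) this P.continuous_spectralOp.continuousAt
  exact ((ContinuousLinearMap.compL ℝ (RadFun R) (RadFun R) (RadFun R)).flip
    P.neumannOp).continuous.continuousAt.comp h1

lemma abs_potential_le (r : ℝ) : |ext P.potential r| ≤ ‖P.potential‖ := abs_ext_le _ _

lemma le_ext_of_large {s : ℝ} (hs : ‖P.potential‖ < s) {ζ f : RadFun R}
    (h : P.spectralOp s ζ = P.neumannOp f) :
    ∀ r ∈ Ioo 0 R, -(‖f‖ / (s - ‖P.potential‖)) ≤ ext ζ r := by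
  refine P.le_ext_of_spectralOp_eq h fun r hr hrC => ?_
  have hd : 0 < s - ‖P.potential‖ := sub_pos.2 hs
  have h1 := abs_le.1 (P.abs_potential_le r)
  have h2 := abs_le.1 (abs_ext_le f r)
  have h3 : ‖f‖ < (s - ‖P.potential‖) * -ext ζ r := by
    have := (mul_lt_mul_iff_right₀ hd).2 (lt_neg.2 hrC)
    rwa [mul_div_cancel₀ _ hd.ne'] at this
  have h4 : 0 ≤ -ext ζ r := by
    have : 0 ≤ ‖f‖ / (s - ‖P.potential‖) := by positivity
    linarith
  nlinarith

lemma norm_le_of_large {s : ℝ} (hs : ‖P.potential‖ < s) {ζ f : RadFun R}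
    (h : P.spectralOp s ζ = P.neumannOp f) : ‖ζ‖ ≤ ‖f‖ / (s - ‖P.potential‖) := by
  have hd : 0 < s - ‖P.potential‖ := sub_pos.2 hs
  refine RadFun.norm_le (by positivity) fun r hr => abs_le.2 ⟨P.le_ext_of_large hs h r hr, ?_⟩
  have h' : P.spectralOp s (-ζ) = P.neumannOp (-f) := by rw [map_neg, map_neg, h]
  have := P.le_ext_of_large hs h' r hr
  rw [norm_neg, ext_neg] at this
  linarith

lemma isRegular_of_large {s : ℝ} (hs : ‖P.potential‖ < s) : P.IsRegular s := by
  by_contra hcon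
  obtain ⟨φ, hφ, h⟩ := P.exists_eigenfunction hcon
  have := P.norm_le_of_large hs (h.trans (map_zero P.neumannOp).symm)
  rw [norm_zero, zero_div] at this
  exact hφ (norm_le_zero_iff.1 this)

/-- Positivity of the resolvent above the spectrum. -/
lemma resolventOp_nonneg {a : ℝ} (ha : ∀ s, a ≤ s → P.IsRegular s) {f : RadFun R}
    (hf : ∀ r ∈ Ioo 0 R, 0 ≤ ext f r) : ∀ r ∈ Ioo 0 R, 0 ≤ ext (P.resolventOp a f) r := by
  set b := max a (‖P.potential‖ + 1) with hb
  obtain ⟨M, hM⟩ := isCompact_Icc.exists_bound_of_continuousOn (s := Icc a b)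
    (f := fun s => P.resolventOp s 1) fun s hs =>
      (((ContinuousLinearMap.apply ℝ (RadFun R) (1 : RadFun R)).continuous.continuousAt).comp
        (P.continuousAt_resolventOp (ha s hs.1))).continuousWithinAt
  have hM0 : 0 ≤ M := (norm_nonneg _).trans (hM a (left_mem_Icc.2 (le_max_left _ _)))
  set δ := 1 / (2 * (M + 1)) with hδ
  have hδ0 : 0 < δ := by positivity
  have hδM : δ * M ≤ 1 / 2 := by
    rw [hδ, div_mul_eq_mul_div, one_mul, div_le_div_iff₀ (by positivity) (by norm_num)]
    linarith
  have key : ∀ n : ℕ, ∀ s ∈ Icc a b, b - s ≤ n * δ → ∀ f : RadFun R,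
      (∀ r ∈ Ioo 0 R, 0 ≤ ext f r) → ∀ r ∈ Ioo 0 R, 0 ≤ ext (P.resolventOp s f) r := by
    intro n
    induction n with
    | zero =>
      intro s hs hbs f hf
      have hsb : b ≤ s := by simpa using hbs
      refine P.le_ext_of_spectralOp_eq (P.spectralOp_resolventOp (ha s hs.1) f) fun r hr h0 => ?_
      have h1 := abs_le.1 (P.abs_potential_le r)
      have h2 : ‖P.potential‖ + 1 ≤ b := le_max_right _ _
      nlinarith [hf r hr]
    | succ n ih =>
      intro s hs hbs f hf
      set s' := min b (s + δ) with hs'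
      have hss' : s ≤ s' := le_min hs.2 (by linarith)
      have hs'b : s' ≤ b := min_le_left _ _
      have hs'δ : s' - s ≤ δ := by have := min_le_right b (s + δ); linarith
      have hI : s' ∈ Icc a b := ⟨hs.1.trans hss', hs'b⟩
      have hbs' : b - s' ≤ n * δ := by
        rcases min_choice b (s + δ) with h | h
        · rw [hs', h, sub_self]; positivity
        · rw [hs', h]; push_cast at hbs; linarith
      set ζ := P.resolventOp s f with hζ
      have hζ' : P.resolventOp s' (f + (s' - s) • ζ) = ζ := by
        refine P.resolventOp_eq (ha s' hI.1) ?_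
        rw [P.spectralOp_sub s' s, P.spectralOp_resolventOp (ha s hs.1), map_add]
      have step : ∀ k : ℝ, 0 ≤ k → (∀ r ∈ Ioo 0 R, -k ≤ ext ζ r) →
          ∀ r ∈ Ioo 0 R, -(k / 2) ≤ ext ζ r := by
        intro k hk hle r hr
        have e : ζ = P.resolventOp s' (f + (s' - s) • (ζ + k • 1)) -
            ((s' - s) * k) • P.resolventOp s' 1 := by
          rw [← map_smul, ← map_sub, show f + (s' - s) • (ζ + k • 1) - ((s' - s) * k) • 1 =
            f + (s' - s) • ζ by rw [smul_add, smul_smul, ← add_assoc, add_sub_cancel_right], hζ']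
        have h1 := ih s' hI hbs' (f + (s' - s) • (ζ + k • 1)) (fun r hr => by
          rw [ext_add, ext_smul, ext_add, ext_smul, ext_one hr]
          have := hle r hr
          have := hf r hr
          have : 0 ≤ (s' - s) * (ext ζ r + k * 1) := mul_nonneg (by linarith) (by linarith)
          linarith) r hr
        have h2 : (s' - s) * k * ext (P.resolventOp s' 1) r ≤ k / 2 := by
          have h3 := (abs_ext_le (P.resolventOp s' 1) r).trans (hM s' hI)
          calc (s' - s) * k * ext (P.resolventOp s' 1) r
              ≤ (s' - s) * k * M := mul_le_mul_of_nonneg_left ((le_abs_self _).trans h3)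
                (mul_nonneg (by linarith) hk)
            _ ≤ δ * k * M := by gcongr
            _ = k * (δ * M) := by ring
            _ ≤ k * (1 / 2) := by gcongr
            _ = k / 2 := by ring
        rw [e, ext_sub, ext_smul]
        linarith
      have hall : ∀ m : ℕ, ∀ r ∈ Ioo 0 R, -(‖ζ‖ / 2 ^ m) ≤ ext ζ r := by
        intro m
        induction m with
        | zero => intro r hr; simpa using (abs_le.1 (abs_ext_le ζ r)).1
        | succ m ihm =>
          intro r hr
          have := step _ (by positivity) ihm r hr
          rwa [div_div, ← pow_succ] at this
      intro r hr
      have hlim : Tendsto (fun m : ℕ => -(‖ζ‖ / 2 ^ m)) atTop (nhds 0) := by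
        have := (tendsto_pow_atTop_nhds_zero_of_lt_one (r := (1 / 2 : ℝ)) (by norm_num)
          (by norm_num)).const_mul (-‖ζ‖)
        rw [mul_zero] at this
        refine this.congr fun m => ?_
        rw [div_pow, one_pow]
        ring
      exact le_of_tendsto' hlim fun m => hall m r hr
  obtain ⟨n, hn⟩ := exists_nat_ge ((b - a) / δ)
  exact key n a (left_mem_Icc.2 (le_max_left _ _)) ((div_le_iff₀ hδ0).1 hn) f hf

/-- Above the spectrum there is a solution bounded away from zero. -/
lemma exists_le_resolventOp_one {a : ℝ} (ha : ∀ s, a ≤ s → P.IsRegular s) :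
    ∃ η > 0, ∀ r ∈ Ioo 0 R, η ≤ ext (P.resolventOp a 1) r := by
  have h0 := P.resolventOp_nonneg ha (f := 1) fun r hr => by rw [ext_one hr]; exact zero_le_one
  have hD : 0 < |a| + ‖P.potential‖ + 1 := by positivity
  refine ⟨1 / (|a| + ‖P.potential‖ + 1), by positivity,
    P.le_ext_of_spectralOp_eq (P.spectralOp_resolventOp (ha a le_rfl) 1) fun r hr hlt => ?_⟩
  rw [lt_div_iff₀ hD] at hlt
  rw [ext_one hr]
  have h1 := abs_le.1 (P.abs_potential_le r)
  have h2 := le_abs_self a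
  have h3 := h0 r hr
  nlinarith

end IsProfile

lemma exists_abs_sub_mul_abs_lt {a b x₀ ε : ℝ} {G : ℝ → ℝ} (hab : a < b) (hx₀ : x₀ ∈ Icc a b)
    (hG : IntegrableOn G (Ioo a b)) (hε : 0 < ε) : ∃ x ∈ Ioo a b, |x - x₀| * |G x| < ε := by
  by_contra! hcon
  have h1 : ¬ IntervalIntegrable (fun x => (x - x₀)⁻¹) volume a b := by
    rw [intervalIntegrable_sub_inv_iff, not_or, not_not, uIcc_of_le hab.le]
    exact ⟨hab.ne, hx₀⟩
  apply h1
  rw [intervalIntegrable_iff_integrableOn_Ioo_of_le hab.le]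
  refine Integrable.mono' (g := fun x => ε⁻¹ * |G x|) (hG.abs.const_mul _) ?_ ?_
  · exact (measurable_id.sub_const x₀).inv.aestronglyMeasurable
  · refine (ae_restrict_iff' measurableSet_Ioo).2 (Eventually.of_forall fun x hx => ?_)
    rw [norm_inv, Real.norm_eq_abs]
    have h := hcon x hx
    have h2 : 0 < |x - x₀| := by
      rcases (abs_nonneg (x - x₀)).eq_or_lt with h0 | h0
      · rw [← h0, zero_mul] at h; linarith
      · exact h0
    rw [inv_mul_eq_div, le_div_iff₀ hε, inv_mul_le_iff₀ h2]
    exact h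

namespace IsProfile

open RadFun

variable {α c R : ℝ} {w : ℝ → ℝ} (P : IsProfile α c R w)

include P

/-! ### The variational characterization -/

omit P in
lemma hasDerivAt_of_eq_primOp {h ζ : RadFun R} {k : ℝ}
    (hζ : ζ = primOp R (radius R * h) + k • 1) {r : ℝ} (hr : r ∈ Ioo 0 R) :
    HasDerivAt (ext ζ) (r * ext h r) r := by
  have h1 : ext ζ =ᶠ[nhds r] fun r => prim (R / 2) r (radius R * h) + k := by
    filter_upwards [isOpen_Ioo.mem_nhds hr] with x hx
    rw [hζ, ext_add, ext_primOp _ hx, ext_smul, ext_one hx, mul_one]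
  refine HasDerivAt.congr_of_eventuallyEq ?_ h1
  refine ((hasDerivAt_prim (R / 2) _ hr).add_const k).congr_deriv ?_
  rw [ext_mul, ext_radius hr]

set_option maxHeartbeats 1000000 in
lemma Qfun_le_mul_Ifun {a : ℝ} (ha : ∀ s, a ≤ s → P.IsRegular s) {φ : ℝ → ℝ}
    (hφ : DifferentiableOn ℝ φ (Ioo 0 R)) (hfin : FiniteNorm α R w φ) :
    Qfun α R w φ ≤ a * Ifun α R w φ := by
  have hR := P.R_pos
  have hα := P.α_pos
  obtain ⟨η, hη, hu⟩ := P.exists_le_resolventOp_one ha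
  set u := P.resolventOp a 1 with hu_def
  obtain ⟨havg, huζ⟩ := P.eq_of_spectralOp_eq (P.spectralOp_resolventOp (ha a le_rfl) 1)
  rw [← hu_def] at havg huζ
  set h := 1 - (a • 1 - P.potential) * u with hh
  set J : ℝ → ℝ := fun r => prim 0 r (P.massDensity * h) with hJ
  set γ := (1 + α) / α with hγ
  have hγ0 : 0 < γ := by positivity
  obtain ⟨C, hC, hJle⟩ := P.exists_abs_prim_centered_le
  have hJle' : ∀ r ∈ Ioo 0 R, |J r| ≤ C * (w r ^ (1 + α) * r ^ 5 * ‖h‖) := fun r hr => by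
    have := hJle h r hr
    rwa [havg, zero_smul, sub_zero] at this
  have hJd : ∀ r ∈ Ioo 0 R,
      HasDerivAt J (w r ^ α * r ^ 4 * (1 - (a - ext P.potential r) * ext u r)) r := fun r hr => by
    refine (hasDerivAt_prim 0 _ hr).congr_deriv ?_
    rw [ext_mul, P.ext_massDensity hr, hh, ext_sub, ext_mul, ext_sub, ext_smul, ext_one hr, mul_one]
  have hud : ∀ r ∈ Ioo 0 R,
      HasDerivAt (ext u) (-(J r / (γ * (w r ^ (1 + α) * r ^ 4)))) r := fun r hr => by
    refine (hasDerivAt_of_eq_primOp huζ hr).congr_deriv ?_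
    have hw := P.w_pos hr
    have hr0 := hr.1
    rw [P.ext_slopeOp _ hr, havg, zero_smul, sub_zero, hγ]
    field_simp
    rfl
  have hφd : ∀ r ∈ Ioo 0 R, HasDerivAt φ (deriv φ r) r := fun r hr =>
    (hφ.differentiableAt (isOpen_Ioo.mem_nhds hr)).hasDerivAt
  set F : ℝ → ℝ := fun r => -(J r * φ r ^ 2 / ext u r) with hF
  set F' : ℝ → ℝ := fun r => -(((w r ^ α * r ^ 4 * (1 - (a - ext P.potential r) * ext u r)) *
    φ r ^ 2 + J r * (2 * φ r * deriv φ r)) * ext u r - J r * φ r ^ 2 *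
      -(J r / (γ * (w r ^ (1 + α) * r ^ 4)))) / ext u r ^ 2 with hF'
  have hFd : ∀ r ∈ Ioo 0 R, HasDerivAt F (F' r) r := fun r hr => by
    have := ((((hJd r hr).mul ((hφd r hr).pow 2)).div (hud r hr) (hη.trans_le (hu r hr)).ne')).neg
    refine this.congr_deriv ?_
    rw [hF']
    simp only [Pi.mul_apply, Pi.pow_apply]
    norm_num
    ring
  set g : ℝ → ℝ := fun r => γ * (w r ^ (1 + α) * r ^ 4 * deriv φ r ^ 2) +
    (a * (w r ^ α * r ^ 4 * φ r ^ 2) +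
      (4 - 3 * γ) * (deriv (fun s => w s ^ (1 + α)) r * r ^ 3 * φ r ^ 2)) with hg
  have hgle : ∀ r ∈ Ioo 0 R, F' r ≤ g r := fun r hr => by
    have hw := P.w_pos hr
    have hr0 := hr.1
    have hup := hη.trans_le (hu r hr)
    have hp : 0 < γ * (w r ^ (1 + α) * r ^ 4) := by positivity
    have hU : deriv (fun s => w s ^ (1 + α)) r * r ^ 3 * φ r ^ 2 * (4 - 3 * γ) =
        -(w r ^ α * r ^ 4 * φ r ^ 2) * ext P.potential r := by
      rw [(P.hasDerivAt_rpow hr (1 + α)).deriv, potential, ext_smul, P.ext_gravity hr,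
        show 1 + α - 1 = α by ring]
      ring
    have key : g r - F' r = (γ * (w r ^ (1 + α) * r ^ 4)) *
        (deriv φ r + J r * φ r / (γ * (w r ^ (1 + α) * r ^ 4) * ext u r)) ^ 2 +
        w r ^ α * r ^ 4 * φ r ^ 2 / ext u r := by
      simp only [hg, hF']
      rw [mul_comm (4 - 3 * γ), hU]
      generalize w r ^ (1 + α) * r ^ 4 = p at hp ⊢
      generalize ext P.potential r = U
      generalize w r ^ α * r ^ 4 = m
      have : 0 < p := pos_of_mul_pos_right hp hγ0.le
      field_simp
      ring
    have : 0 ≤ g r - F' r := by rw [key]; positivity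
    linarith
  obtain ⟨hi1, hi2, hi3⟩ := hfin
  have hgi : IntegrableOn g (Ioo 0 R) :=
    (hi1.const_mul _).add ((hi3.const_mul _).add (hi2.const_mul _))
  have hgi' : IntegrableOn (fun r => a * (w r ^ α * r ^ 4 * φ r ^ 2) +
      (4 - 3 * γ) * (deriv (fun s => w s ^ (1 + α)) r * r ^ 3 * φ r ^ 2)) (Ioo 0 R) :=
    (hi3.const_mul _).add (hi2.const_mul _)
  have hgint : ∫ r in Ioo 0 R, g r = a * Ifun α R w φ - Qfun α R w φ := by
    simp only [hg]
    rw [integral_add (hi1.const_mul _) hgi',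
      integral_add (hi3.const_mul _) (hi2.const_mul _), integral_const_mul, integral_const_mul,
      integral_const_mul, Qfun, Ifun, hγ, mul_div_assoc]
    ring
  by_contra! hlt
  set g₀ := (Ioo 0 R).indicator g with hg₀
  have hg₀i : Integrable g₀ := (integrable_indicator_iff measurableSet_Ioo).2 hgi
  have hPc : Continuous fun x => ∫ r in (0 : ℝ)..x, g₀ r :=
    intervalIntegral.continuous_primitive (fun _ _ => hg₀i.intervalIntegrable) 0
  set S := ∫ r in (0 : ℝ)..R, g₀ r with hS
  have hS0 : S < 0 := by
    rw [hS, intervalIntegral.integral_of_le hR.le, integral_Ioc_eq_integral_Ioo,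
      setIntegral_congr_fun measurableSet_Ioo (g := g) fun r hr => indicator_of_mem hr g, hgint]
    linarith
  have hFle : ∀ r ∈ Ioo 0 R, |F r| ≤ C * ‖h‖ / η * (w r * r * |w r ^ α * r ^ 4 * φ r ^ 2|) :=
    fun r hr => by
      have hw := P.w_pos hr
      have hr0 := hr.1
      have hup := hη.trans_le (hu r hr)
      rw [hF, abs_neg, abs_div, abs_mul, abs_of_pos hup, abs_of_nonneg (sq_nonneg (φ r)),
        abs_of_nonneg (by positivity : 0 ≤ w r ^ α * r ^ 4 * φ r ^ 2)]
      calc |J r| * φ r ^ 2 / ext u r ≤ C * (w r ^ (1 + α) * r ^ 5 * ‖h‖) * φ r ^ 2 / η := by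
            gcongr
            · exact hJle' r hr
            · exact hu r hr
        _ = _ := by
            rw [rpow_one_add' hw.le (by positivity)]
            ring
  set K := C * ‖h‖ / η * (1 + R * (R * (c / 3))) + 1 with hK
  have hc := P.c_pos
  have hK0 : 0 < K := by positivity
  have hε : 0 < -S / 8 / K := by have : 0 < -S := by linarith
                                 positivity
  have hw1 : ∀ r ∈ Ioo 0 R, w r ≤ 1 := fun r hr => P.w_le_one (Ioo_subset_Icc_self hr)
  have e0 : ∀ᶠ x in nhds (0 : ℝ), ∫ r in (0 : ℝ)..x, g₀ r > S / 4 := by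
    refine (hPc.tendsto 0).eventually (lt_mem_nhds ?_)
    rw [intervalIntegral.integral_same]
    linarith
  have eR : ∀ᶠ x in nhds R, ∫ r in (0 : ℝ)..x, g₀ r < 3 * S / 4 :=
    (hPc.tendsto R).eventually (gt_mem_nhds (by rw [← hS]; linarith))
  obtain ⟨d₁, hd₁, hb₁⟩ := Metric.eventually_nhds_iff.1 e0
  obtain ⟨d₂, hd₂, hb₂⟩ := Metric.eventually_nhds_iff.1 eR
  obtain ⟨x, hx, hxG⟩ := exists_abs_sub_mul_abs_lt (a := 0) (b := min d₁ (R / 2)) (x₀ := 0)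
    (lt_min hd₁ (by linarith)) ⟨le_rfl, le_min hd₁.le (by linarith)⟩
    (hi3.mono_set (Ioo_subset_Ioo_right ((min_le_right _ _).trans (by linarith)))) hε
  obtain ⟨y, hy, hyG⟩ := exists_abs_sub_mul_abs_lt (a := max (R - d₂) (R / 2)) (b := R) (x₀ := R)
    (max_lt (by linarith) (by linarith)) ⟨max_le (by linarith) (by linarith), le_rfl⟩
    (hi3.mono_set (Ioo_subset_Ioo_left
      ((by linarith : (0 : ℝ) ≤ R / 2).trans (le_max_right _ _)))) hε
  have hx1 : x < d₁ := hx.2.trans_le (min_le_left _ _)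
  have hx2 : x < R / 2 := hx.2.trans_le (min_le_right _ _)
  have hy1 : R - d₂ < y := (le_max_left _ _).trans_lt hy.1
  have hy2 : R / 2 < y := (le_max_right _ _).trans_lt hy.1
  have hxI : x ∈ Ioo 0 R := ⟨hx.1, by linarith⟩
  have hyI : y ∈ Ioo 0 R := ⟨by linarith, hy.2⟩
  have hsub : Icc x y ⊆ Ioo 0 R := fun z hz => ⟨hx.1.trans_le hz.1, hz.2.trans_lt hy.2⟩
  have hFTC : F y - F x ≤ ∫ r in x..y, g₀ r := by
    refine intervalIntegral.sub_le_integral_of_hasDeriv_right_of_le (g' := F') (by linarith)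
      (fun z hz => (hFd z (hsub hz)).continuousAt.continuousWithinAt)
      (fun z hz => (hFd z (hsub (Ioo_subset_Icc_self hz))).hasDerivWithinAt) hg₀i.integrableOn
      fun z hz => ?_
    rw [hg₀, indicator_of_mem (hsub (Ioo_subset_Icc_self hz))]
    exact hgle z (hsub (Ioo_subset_Icc_self hz))
  have h1 := hb₁ (y := x) (by rw [dist_zero_right, Real.norm_eq_abs, abs_of_pos hx.1]; exact hx1)
  have h2 := hb₂ (y := y) (by rw [Real.dist_eq, abs_lt]; exact ⟨by linarith, by linarith [hy.2]⟩)
  rw [← intervalIntegral.integral_interval_sub_left hg₀i.intervalIntegrable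
    hg₀i.intervalIntegrable] at hFTC
  have hmul : K * (-S / 8 / K) = -S / 8 := by field_simp
  have hsmall : ∀ z ∈ Ioo 0 R, ∀ ρ, w z * z ≤ (1 + R * (R * (c / 3))) * ρ →
      ρ * |w z ^ α * z ^ 4 * φ z ^ 2| < -S / 8 / K → |F z| ≤ -S / 8 := fun z hz ρ h1 h2 => by
    refine (hFle z hz).trans ?_
    calc C * ‖h‖ / η * (w z * z * |w z ^ α * z ^ 4 * φ z ^ 2|)
        ≤ C * ‖h‖ / η * ((1 + R * (R * (c / 3))) * ρ * |w z ^ α * z ^ 4 * φ z ^ 2|) := by gcongr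
      _ = (K - 1) * (ρ * |w z ^ α * z ^ 4 * φ z ^ 2|) := by rw [hK]; ring
      _ ≤ (K - 1) * (-S / 8 / K) := by
          refine mul_le_mul_of_nonneg_left h2.le ?_
          rw [hK]
          have : 0 ≤ C * ‖h‖ / η * (1 + R * (R * (c / 3))) := by positivity
          linarith
      _ ≤ -S / 8 := by linarith [hmul]
  have hQ0 : 0 ≤ R * (R * (c / 3)) := by positivity
  have hFx : |F x| ≤ -S / 8 := by
    refine hsmall x hxI (x - 0) ?_ (by rwa [abs_of_pos (by linarith [hx.1])] at hxG)
    rw [sub_zero]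
    exact mul_le_mul_of_nonneg_right ((hw1 x hxI).trans (le_add_of_nonneg_right hQ0)) hx.1.le
  have hFy : |F y| ≤ -S / 8 := by
    refine hsmall y hyI (R - y) ?_ (by rwa [abs_sub_comm, abs_of_pos (by linarith [hy.2])] at hyG)
    have h1 := mul_le_mul (P.w_le_mul_sub hyI) hy.2.le hyI.1.le
      (mul_nonneg (by positivity) (by linarith [hy.2]))
    refine h1.trans ?_
    have h3 : 0 ≤ R - y := by linarith [hy.2]
    have h4 : R * (c / 3) * (R - y) * R = R * (R * (c / 3)) * (R - y) := by ring
    rw [h4]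
    exact mul_le_mul_of_nonneg_right (le_add_of_nonneg_left zero_le_one) h3
  have := abs_le.1 hFx
  have := abs_le.1 hFy
  linarith

/-- The largest eigenvalue of the linearized operator. -/
lemma exists_max_not_isRegular {μ₀ : ℝ}
    (hμ₀ : IsLUB {q : ℝ | ∃ φ : ℝ → ℝ, DifferentiableOn ℝ φ (Ioo 0 R) ∧
      FiniteNorm α R w φ ∧ Ifun α R w φ = 1 ∧ q = Qfun α R w φ} μ₀) :
    ∃ μ ≥ μ₀, ¬ P.IsRegular μ ∧ ∀ s, μ < s → P.IsRegular s := by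
  have hex : ∃ s, μ₀ ≤ s ∧ ¬ P.IsRegular s := by
    by_contra! hcon
    obtain ⟨ε, hε, hball⟩ := Metric.isOpen_iff.1 P.isOpen_isRegular μ₀ (hcon μ₀ le_rfl)
    have ha : ∀ s, μ₀ - ε / 2 ≤ s → P.IsRegular s := fun s hs => by
      rcases le_or_gt μ₀ s with h | h
      · exact hcon s h
      · exact hball (by
          rw [Metric.mem_ball, Real.dist_eq, abs_lt]
          exact ⟨by linarith, by linarith⟩)
    have := hμ₀.2 (show μ₀ - ε / 2 ∈ upperBounds _ from by
      rintro q ⟨φ, hφ, hfin, hI, rfl⟩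
      have := P.Qfun_le_mul_Ifun ha hφ hfin
      rwa [hI, mul_one] at this)
    linarith
  obtain ⟨s₀, hs₀, hs₀'⟩ := hex
  have hbdd : ∀ s, ¬ P.IsRegular s → s ≤ ‖P.potential‖ := fun s hs => by
    by_contra! hlt
    exact hs (P.isRegular_of_large hlt)
  have hcl : IsClosed ({s | ¬ P.IsRegular s} ∩ Ici μ₀) :=
    P.isOpen_isRegular.isClosed_compl.inter isClosed_Ici
  have hmem := hcl.csSup_mem ⟨s₀, hs₀', hs₀⟩ ⟨‖P.potential‖, fun s hs => hbdd s hs.1⟩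
  refine ⟨_, hmem.2, hmem.1, fun s hs => ?_⟩
  by_contra hns
  exact absurd (le_csSup ⟨‖P.potential‖, fun s hs => hbdd s hs.1⟩
    (show s ∈ {s | ¬ P.IsRegular s} ∩ Ici μ₀ from ⟨hns, le_trans hmem.2 hs.le⟩)) (not_le.2 hs)

end IsProfile

section Bulk

variable {A : Type*} [NormedCommRing A] [NormedAlgebra ℝ A]

/-- The right-hand side of the radial equation for the slope, as a function of the perturbation,
its acceleration and its slope, in a commutative Banach algebra. -/
noncomputable def bulk (γ : ℝ) (b r₂ q : A) (x : A × A × A) : A :=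
  powSeries (binomCoeff (2 * γ - 4)) x.1 * powSeries (binomCoeff (γ + 1)) (x.1 + r₂ * x.2.2) *
      ((1 + x.1) ^ 2 * x.2.1 + b) - b * (1 + x.1 + r₂ * x.2.2)
    - (2 * γ) • (q * x.2.2 ^ 2 * powSeries (binomCoeff (-1)) x.1) - γ • (b * (r₂ * x.2.2))

/-- The part of `bulk` of order at least two, up to sign. -/
noncomputable def nonlin (γ : ℝ) (b r₂ q : A) (x : A × A × A) : A :=
  x.2.1 - (4 - 3 * γ) • (b * x.1) - bulk γ b r₂ q x

lemma map_bulk [CompleteSpace A] {B : Type*} [NormedCommRing B] [NormedAlgebra ℝ B]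
    (ψ : A →ₐ[ℝ] B) (hψ : Continuous ψ) (γ : ℝ) (b r₂ q : A) (x : A × A × A) (h1 : ‖x.1‖ < 1)
    (h2 : ‖x.1 + r₂ * x.2.2‖ < 1) :
    ψ (bulk γ b r₂ q x) = bulk γ (ψ b) (ψ r₂) (ψ q) (ψ x.1, ψ x.2.1, ψ x.2.2) := by
  simp only [bulk, map_sub, map_mul, map_add, map_smul, map_pow, map_one,
    (unitDiscSeries_binomCoeff _).map_powSeries ψ hψ h1,
    (unitDiscSeries_binomCoeff _).map_powSeries ψ hψ h2]

lemma map_nonlin [CompleteSpace A] {B : Type*} [NormedCommRing B] [NormedAlgebra ℝ B]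
    (ψ : A →ₐ[ℝ] B) (hψ : Continuous ψ) (γ : ℝ) (b r₂ q : A) (x : A × A × A) (h1 : ‖x.1‖ < 1)
    (h2 : ‖x.1 + r₂ * x.2.2‖ < 1) :
    ψ (nonlin γ b r₂ q x) = nonlin γ (ψ b) (ψ r₂) (ψ q) (ψ x.1, ψ x.2.1, ψ x.2.2) := by
  simp only [nonlin, map_sub, map_mul, map_smul, map_bulk ψ hψ γ b r₂ q x h1 h2]

lemma nonlin_zero (γ : ℝ) (b r₂ q : A) : nonlin γ b r₂ q 0 = 0 := by
  simp [nonlin, bulk, powSeries_zero, binomCoeff_zero]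

lemma hasStrictFDerivAt_nonlin [CompleteSpace A] (γ : ℝ) (b r₂ q : A) :
    HasStrictFDerivAt (nonlin γ b r₂ q) (0 : A × A × A →L[ℝ] A) 0 := by
  set p1 : A × A × A →L[ℝ] A := ContinuousLinearMap.fst ℝ A (A × A) with hp1
  set p2 : A × A × A →L[ℝ] A := (ContinuousLinearMap.fst ℝ A A).comp
    (ContinuousLinearMap.snd ℝ A (A × A)) with hp2
  set p3 : A × A × A →L[ℝ] A := (ContinuousLinearMap.snd ℝ A A).comp
    (ContinuousLinearMap.snd ℝ A (A × A)) with hp3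
  have d1 : HasStrictFDerivAt (fun x : A × A × A => x.1) p1 0 := p1.hasStrictFDerivAt
  have d2 : HasStrictFDerivAt (fun x : A × A × A => x.2.1) p2 0 := p2.hasStrictFDerivAt
  have d3 : HasStrictFDerivAt (fun x : A × A × A => x.2.2) p3 0 := p3.hasStrictFDerivAt
  have d4 := d3.const_mul r₂
  have dJ := d1.add d4
  have F1 : ∀ s : ℝ, HasStrictFDerivAt (fun x : A × A × A => powSeries (binomCoeff s) x.1)
      ((ContinuousLinearMap.mul ℝ A (powSeries (derivSeries (binomCoeff s)) 0)).comp p1) 0 :=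
    fun s => HasStrictFDerivAt.comp (0 : A × A × A)
      (g := powSeries (binomCoeff s)) (f := fun x : A × A × A => x.1)
      ((unitDiscSeries_binomCoeff s).hasStrictFDerivAt (x := (0 : A)) (by simp)) d1
  have FJ := HasStrictFDerivAt.comp (0 : A × A × A)
      (g := powSeries (binomCoeff (γ + 1))) (f := fun x : A × A × A => x.1 + r₂ * x.2.2)
      ((unitDiscSeries_binomCoeff (γ + 1)).hasStrictFDerivAt (x := _) (by simp)) dJ
  have dX := (d1.const_add 1).pow 2
  have e1 := ((F1 (2 * γ - 4)).mul FJ).mul ((dX.mul d2).add_const b)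
  have e2 := ((d1.const_add 1).add d4).const_mul b
  have e3 := (((d3.pow 2).const_mul q).mul (F1 (-1))).const_smul (2 * γ)
  have e4 := (d4.const_mul b).const_smul γ
  have e := (d2.sub ((d1.const_mul b).const_smul (4 - 3 * γ))).sub
    (((e1.sub e2).sub e3).sub e4)
  refine e.congr_fderiv ?_
  have n2 : algebraMap ℝ A 2 = 2 := map_ofNat _ 2
  have n3 : algebraMap ℝ A 3 = 3 := map_ofNat _ 3
  have n4 : algebraMap ℝ A 4 = 4 := map_ofNat _ 4
  ext x <;> simp [n2, n3, n4, powSeries_zero, binomCoeff_zero, derivSeries_binomCoeff_zero,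
      Algebra.smul_def, hp1, hp2, hp3] <;> ring

end Bulk

lemma opNorm_smul_eq {E F : Type*} [NormedAddCommGroup E] [NormedSpace ℝ E]
    [NormedAddCommGroup F] [NormedSpace ℝ F] (a : ℝ) (T : E →L[ℝ] F) :
    ‖a • T‖ = ‖a‖ * ‖T‖ := norm_smul a T

namespace IsProfile

open RadFun

variable {α c R : ℝ} {w : ℝ → ℝ} (P : IsProfile α c R w)

include P

/-! ### The invariant manifold of the growing mode -/

omit P in
/-- The product of the enthalpy and the squared radius. -/
noncomputable def radEnthalpy (_ : IsProfile α c R w) : RadFun R :=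
  ofFun R w * (radius R * radius R)

lemma ext_radEnthalpy {r : ℝ} (hr : r ∈ Ioo 0 R) : ext P.radEnthalpy r = w r * (r * r) := by
  rw [radEnthalpy, ext_mul, ext_mul, ext_radius (R := R) hr]
  rw [ext_ofFun (C := 1) (P.cont.mono Ioo_subset_Icc_self) (fun r hr => ?_) hr]
  rw [abs_of_nonneg (P.w_pos hr).le]
  exact P.w_le_one ⟨hr.1.le, hr.2.le⟩

omit P in
/-- The right-hand side of the slope equation for power series in the growing mode. -/
noncomputable def bulkSeries (P : IsProfile α c R w)
    (x : Wiener (RadFun R) × Wiener (RadFun R) × Wiener (RadFun R)) : Wiener (RadFun R) :=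
  bulk ((1 + α) / α) (Wiener.const P.gravity) (Wiener.const (radius R * radius R))
    (Wiener.const P.radEnthalpy) x

omit P in
/-- The nonlinearity for power series in the growing mode. -/
noncomputable def nonlinSeries (P : IsProfile α c R w)
    (x : Wiener (RadFun R) × Wiener (RadFun R) × Wiener (RadFun R)) : Wiener (RadFun R) :=
  nonlin ((1 + α) / α) (Wiener.const P.gravity) (Wiener.const (radius R * radius R))
    (Wiener.const P.radEnthalpy) x

lemma bulkSeries_eq (x : Wiener (RadFun R) × Wiener (RadFun R) × Wiener (RadFun R)) (n : ℕ) :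
    Wiener.coeff n (P.bulkSeries x) = Wiener.coeff n x.2.1 - P.potential * Wiener.coeff n x.1 -
      Wiener.coeff n (P.nonlinSeries x) := by
  rw [nonlinSeries, nonlin, map_sub, map_sub, map_smul, Wiener.coeff_const_mul, bulkSeries,
    potential, smul_mul_assoc]
  abel

omit P in
/-- The symbol of the solution operator for the perturbation. -/
noncomputable def solSymbol (P : IsProfile α c R w) (μ : ℝ) (n : ℕ) : RadFun R →L[ℝ] RadFun R :=
  if n < 2 then 0 else P.resolventOp ((n : ℝ) ^ 2 * μ)

omit P in
/-- The symbol of the solution operator for the slope. -/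
noncomputable def slopeSymbol (P : IsProfile α c R w) (μ : ℝ) (n : ℕ) :
    RadFun R →L[ℝ] RadFun R :=
  if n < 2 then 0 else P.slopeOp ∘L (ContinuousLinearMap.id ℝ (RadFun R) -
    ((((n : ℝ) ^ 2 * μ) • P.solSymbol μ n) -
      ContinuousLinearMap.mul ℝ (RadFun R) P.potential ∘L P.solSymbol μ n))

lemma slopeSymbol_apply {μ : ℝ} {n : ℕ} (hn : ¬ n < 2) (f : RadFun R) : P.slopeSymbol μ n f =
    P.slopeOp (f - (((n : ℝ) ^ 2 * μ) • 1 - P.potential) * P.solSymbol μ n f) := by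
  rw [slopeSymbol, if_neg hn, sub_mul, smul_mul_assoc, one_mul]
  rfl

lemma exists_symbol_bound {μ : ℝ} (hμ : 0 < μ) :
    ∃ C : ℝ, ∀ n, ‖P.solSymbol μ n‖ ≤ C ∧ ‖((n : ℝ) ^ 2 * μ) • P.solSymbol μ n‖ ≤ C ∧
      ‖P.slopeSymbol μ n‖ ≤ C := by
  have hlim : Tendsto (fun n : ℕ => (n : ℝ) ^ 2 * μ) atTop atTop :=
    ((tendsto_pow_atTop two_ne_zero).comp tendsto_natCast_atTop_atTop).atTop_mul_const hμ
  have hbd : ∀ᶠ n : ℕ in atTop, ‖((n : ℝ) ^ 2 * μ) • P.solSymbol μ n‖ ≤ 2 ∧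
      ‖P.solSymbol μ n‖ ≤ 2 := by
    filter_upwards [hlim.eventually_gt_atTop (2 * ‖P.potential‖), hlim.eventually_ge_atTop 1,
      eventually_ge_atTop 2] with n h1 h2 h3
    have h0 := norm_nonneg P.potential
    have hle : ‖P.solSymbol μ n‖ ≤ 1 / ((n : ℝ) ^ 2 * μ - ‖P.potential‖) := by
      rw [solSymbol, if_neg (by omega)]
      refine ContinuousLinearMap.opNorm_le_bound _ (one_div_nonneg.2 (by linarith)) fun f => ?_
      have hs : ‖P.potential‖ < (n : ℝ) ^ 2 * μ := by linarith
      have := P.norm_le_of_large hs (P.spectralOp_resolventOp (P.isRegular_of_large hs) f)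
      rwa [div_mul_eq_mul_div, one_mul]
    have hle2 : ‖((n : ℝ) ^ 2 * μ) • P.solSymbol μ n‖ ≤ 2 := by
      rw [opNorm_smul_eq, Real.norm_of_nonneg (by linarith)]
      calc ((n : ℝ) ^ 2 * μ) * ‖P.solSymbol μ n‖
          ≤ ((n : ℝ) ^ 2 * μ) * (1 / ((n : ℝ) ^ 2 * μ - ‖P.potential‖)) :=
            mul_le_mul_of_nonneg_left hle (by linarith)
        _ ≤ 2 := by
            rw [mul_one_div, div_le_iff₀ (by linarith)]
            linarith
    refine ⟨hle2, ?_⟩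
    rw [opNorm_smul_eq, Real.norm_of_nonneg (by linarith)] at hle2
    nlinarith [ContinuousLinearMap.opNorm_nonneg (P.solSymbol μ n)]
  obtain ⟨C1, hC1⟩ := (Filter.isBoundedUnder_of_eventually_le
    (hbd.mono fun n h => h.1)).bddAbove_range
  obtain ⟨C2, hC2⟩ := (Filter.isBoundedUnder_of_eventually_le
    (hbd.mono fun n h => h.2)).bddAbove_range
  have h1 : ∀ n : ℕ, ‖((n : ℝ) ^ 2 * μ) • P.solSymbol μ n‖ ≤ C1 := fun n => hC1 ⟨n, rfl⟩
  have h2 : ∀ n : ℕ, ‖P.solSymbol μ n‖ ≤ C2 := fun n => hC2 ⟨n, rfl⟩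
  have hC10 : 0 ≤ C1 := (ContinuousLinearMap.opNorm_nonneg _).trans (h1 0)
  have hC20 : 0 ≤ C2 := (ContinuousLinearMap.opNorm_nonneg _).trans (h2 0)
  have hC3 : 0 ≤ ‖P.slopeOp‖ * (1 + (C1 + ‖P.potential‖ * C2)) :=
    mul_nonneg (ContinuousLinearMap.opNorm_nonneg _) (by positivity)
  refine ⟨C1 + C2 + ‖P.slopeOp‖ * (1 + (C1 + ‖P.potential‖ * C2)), fun n =>
    ⟨(h2 n).trans (by linarith), (h1 n).trans (by linarith), ?_⟩⟩
  refine le_trans ?_ (le_add_of_nonneg_left (add_nonneg hC10 hC20))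
  refine ContinuousLinearMap.opNorm_le_bound _ hC3 fun f => ?_
  by_cases hn : n < 2
  · rw [slopeSymbol, if_pos hn, zero_apply, norm_zero]
    exact mul_nonneg hC3 (norm_nonneg f)
  rw [P.slopeSymbol_apply hn, mul_assoc]
  refine (P.slopeOp.le_opNorm _).trans (mul_le_mul_of_nonneg_left ?_
    (ContinuousLinearMap.opNorm_nonneg _))
  have e1 : ‖((n : ℝ) ^ 2 * μ) • P.solSymbol μ n f‖ ≤ C1 * ‖f‖ :=
    (((((n : ℝ) ^ 2 * μ) • P.solSymbol μ n)).le_opNorm f).trans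
      (mul_le_mul_of_nonneg_right (h1 n) (norm_nonneg _))
  have e2 : ‖P.solSymbol μ n f‖ ≤ C2 * ‖f‖ :=
    ((P.solSymbol μ n).le_opNorm f).trans (mul_le_mul_of_nonneg_right (h2 n) (norm_nonneg _))
  have e3 : ‖P.potential * P.solSymbol μ n f‖ ≤ ‖P.potential‖ * (C2 * ‖f‖) :=
    (norm_mul_le _ _).trans (mul_le_mul_of_nonneg_left e2 (norm_nonneg _))
  rw [sub_mul, smul_mul_assoc, one_mul]
  have := norm_sub_le f (((n : ℝ) ^ 2 * μ) • P.solSymbol μ n f - P.potential * P.solSymbol μ n f)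
  have := norm_sub_le (((n : ℝ) ^ 2 * μ) • P.solSymbol μ n f) (P.potential * P.solSymbol μ n f)
  linarith

lemma coeff_nonlinSeries_eq_zero
    {x : Wiener (RadFun R) × Wiener (RadFun R) × Wiener (RadFun R)}
    (h1 : ‖x.1‖ < 1) (h2 : ‖x.1 + Wiener.const (radius R * radius R) * x.2.2‖ < 1)
    (c1 : Wiener.coeff 0 x.1 = 0) (c2 : Wiener.coeff 0 x.2.1 = 0) (c3 : Wiener.coeff 0 x.2.2 = 0)
    {k : ℕ} (hk : k < 2) : Wiener.coeff k (P.nonlinSeries x) = 0 := by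
  have hsmall := (hasStrictFDerivAt_nonlin ((1 + α) / α) (Wiener.const P.gravity)
    (Wiener.const (radius R * radius R)) (Wiener.const P.radEnthalpy)).hasFDerivAt.isLittleO
  have hdil : ∀ ρ : ℝ, ∀ hρ : |ρ| ≤ 1, P.nonlinSeries
      (Wiener.dilate ρ hρ x.1, Wiener.dilate ρ hρ x.2.1, Wiener.dilate ρ hρ x.2.2) =
      Wiener.dilate ρ hρ (P.nonlinSeries x) := by
    intro ρ hρ
    have hc : ∀ e : RadFun R, Wiener.dilate ρ hρ (Wiener.const e) = Wiener.const e := by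
      intro e
      ext1 n
      rw [Wiener.coeff_dilate, Wiener.coeff_const]
      split_ifs with hn
      · rw [hn, pow_zero, one_smul]
      · rw [smul_zero]
    have hcont : Continuous (Wiener.dilate (E := RadFun R) ρ hρ) :=
      AddMonoidHomClass.continuous_of_bound _ 1 fun f => by
        rw [one_mul]; exact Wiener.norm_dilate_le ρ hρ f
    have := map_nonlin (Wiener.dilate ρ hρ) hcont ((1 + α) / α) (Wiener.const P.gravity)
      (Wiener.const (radius R * radius R)) (Wiener.const P.radEnthalpy) x h1 h2
    rw [hc, hc, hc] at this
    exact this.symm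
  by_contra hne
  have hpos : 0 < ‖Wiener.coeff k (P.nonlinSeries x)‖ := norm_pos_iff.2 hne
  set δ := ‖Wiener.coeff k (P.nonlinSeries x)‖ with hδ
  have hb := hsmall.bound (c := δ / (2 * (‖x‖ + 1))) (by positivity)
  obtain ⟨η, hη, hball⟩ := Metric.eventually_nhds_iff_ball.1 hb
  set ρ := min 1 (η / (2 * (‖x‖ + 1))) with hρdef
  have hρ0 : 0 < ρ := lt_min one_pos (by positivity)
  have hρ1 : |ρ| ≤ 1 := by rw [abs_of_pos hρ0]; exact min_le_left _ _
  set y : Wiener (RadFun R) × Wiener (RadFun R) × Wiener (RadFun R) :=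
    (Wiener.dilate ρ hρ1 x.1, Wiener.dilate ρ hρ1 x.2.1, Wiener.dilate ρ hρ1 x.2.2) with hy
  have hyn : ‖y‖ ≤ ρ * ‖x‖ := by
    have hx1 : ‖x.1‖ ≤ ‖x‖ := norm_fst_le x
    have hx2 : ‖x.2.1‖ ≤ ‖x‖ := (norm_fst_le x.2).trans (norm_snd_le x)
    have hx3 : ‖x.2.2‖ ≤ ‖x‖ := (norm_snd_le x.2).trans (norm_snd_le x)
    have a1 := Wiener.norm_dilate_le_mul ρ hρ1 x.1 c1
    have a2 := Wiener.norm_dilate_le_mul ρ hρ1 x.2.1 c2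
    have a3 := Wiener.norm_dilate_le_mul ρ hρ1 x.2.2 c3
    rw [abs_of_pos hρ0] at a1 a2 a3
    refine norm_prod_le_iff.2 ⟨a1.trans (by gcongr), norm_prod_le_iff.2
      ⟨a2.trans (by gcongr), a3.trans (by gcongr)⟩⟩
  have hyball :
      y ∈ Metric.ball (0 : Wiener (RadFun R) × Wiener (RadFun R) × Wiener (RadFun R)) η := by
    rw [mem_ball_zero_iff]
    refine hyn.trans_lt ?_
    calc ρ * ‖x‖ ≤ η / (2 * (‖x‖ + 1)) * ‖x‖ :=
          mul_le_mul_of_nonneg_right (min_le_right _ _) (norm_nonneg _)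
      _ < η := by
          rw [div_mul_eq_mul_div, div_lt_iff₀ (by positivity)]
          nlinarith [norm_nonneg x]
  have hfin := hball y hyball
  rw [nonlin_zero, zero_apply, sub_zero, sub_zero, sub_zero] at hfin
  have hfin2 : ‖P.nonlinSeries y‖ ≤ δ / (2 * (‖x‖ + 1)) * ‖y‖ := hfin
  rw [hy, hdil ρ hρ1, ← hy] at hfin2
  have h3 := (Wiener.norm_coeff_le k _).trans hfin2
  rw [Wiener.coeff_dilate, norm_smul, ← hδ, norm_pow, Real.norm_of_nonneg hρ0.le] at h3
  have h4 : ρ ≤ ρ ^ k := by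
    interval_cases k
    · rw [pow_zero]; exact min_le_left _ _
    · simp
  have h5 : ρ * δ ≤ δ / (2 * (‖x‖ + 1)) * (ρ * ‖x‖) :=
    (mul_le_mul_of_nonneg_right h4 hpos.le).trans (h3.trans (by gcongr))
  rw [div_mul_eq_mul_div, le_div_iff₀ (by positivity)] at h5
  nlinarith [norm_nonneg x, mul_pos hρ0 hpos, mul_nonneg (mul_pos hρ0 hpos).le (norm_nonneg x)]

end IsProfile

lemma HasStrictFDerivAt.map_nhds_id {X : Type*} [NormedAddCommGroup X] [NormedSpace ℝ X]
    [CompleteSpace X] {H : X → X} (h : HasStrictFDerivAt H (ContinuousLinearMap.id ℝ X) 0)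
    (h0 : H 0 = 0) : Filter.map H (nhds 0) = nhds 0 := by
  have := HasStrictFDerivAt.map_nhds_eq_of_equiv (f := H)
    (f' := ContinuousLinearEquiv.refl ℝ X) (a := (0 : X)) h
  rwa [h0] at this

namespace IsProfile

open RadFun

variable {α c R : ℝ} {w : ℝ → ℝ} (P : IsProfile α c R w)

include P

/-- A power series in the growing mode solving the nonlinear problem, of arbitrarily small norm. -/
theorem exists_series {μ : ℝ} (hμ : 0 < μ) (hμ0 : ¬ P.IsRegular μ)
    (hreg : ∀ s, μ < s → P.IsRegular s) {κ : ℝ} (hκ : 0 < κ) :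
    ∃ x : Wiener (RadFun R) × Wiener (RadFun R) × Wiener (RadFun R), ‖x‖ ≤ κ ∧
      Wiener.coeff 0 x.1 = 0 ∧ Wiener.coeff 0 x.2.2 = 0 ∧ Wiener.coeff 1 x.1 ≠ 0 ∧
      (∀ n, Wiener.coeff n x.2.1 = ((n : ℝ) ^ 2 * μ) • Wiener.coeff n x.1) ∧
      (∀ n, ∀ r ∈ Ioo 0 R, HasDerivAt (ext (Wiener.coeff n x.1))
        (r * ext (Wiener.coeff n x.2.2) r) r) ∧
      ∀ n, ∀ r ∈ Ioo 0 R, HasDerivAt (ext (Wiener.coeff n x.2.2))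
        ((α / (1 + α) * ext (Wiener.coeff n (P.bulkSeries x)) r -
          (5 * w r + (1 + α) * (r ^ 2 * radSlope w r)) * ext (Wiener.coeff n x.2.2) r) /
          (w r * r)) r := by
  obtain ⟨φ, hφ, hφ0⟩ := P.exists_eigenfunction hμ0
  obtain ⟨C, hC⟩ := P.exists_symbol_bound hμ
  set T : Wiener (RadFun R) →L[ℝ] Wiener (RadFun R) × Wiener (RadFun R) × Wiener (RadFun R) :=
    (Wiener.multiplier (P.solSymbol μ) C fun n => (hC n).1).prod
      ((Wiener.multiplier (fun n => ((n : ℝ) ^ 2 * μ) • P.solSymbol μ n) C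
        fun n => (hC n).2.1).prod
        (Wiener.multiplier (P.slopeSymbol μ) C fun n => (hC n).2.2)) with hT
  set v : Wiener (RadFun R) × Wiener (RadFun R) × Wiener (RadFun R) :=
    (Wiener.single 1 φ, Wiener.single 1 (μ • φ),
      Wiener.single 1 (P.slopeOp (0 - (μ • 1 - P.potential) * φ))) with hv
  set q : Wiener (RadFun R) := Wiener.const (radius R * radius R) with hq
  have hH : HasStrictFDerivAt (fun x => x - T (P.nonlinSeries x))
      (ContinuousLinearMap.id ℝ (Wiener (RadFun R) × Wiener (RadFun R) × Wiener (RadFun R))) 0 := by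
    have h1 := hasStrictFDerivAt_nonlin ((1 + α) / α) (Wiener.const P.gravity) q
      (Wiener.const P.radEnthalpy)
    have h2 := (hasStrictFDerivAt_id (𝕜 := ℝ)
      (0 : Wiener (RadFun R) × Wiener (RadFun R) × Wiener (RadFun R))).sub
      (T.hasStrictFDerivAt.comp 0 h1)
    refine h2.congr_fderiv ?_
    rw [ContinuousLinearMap.comp_zero, sub_zero]
  have hH0 : (0 : Wiener (RadFun R) × Wiener (RadFun R) × Wiener (RadFun R)) -
      T (P.nonlinSeries 0) = 0 := by
    rw [nonlinSeries, nonlin_zero, map_zero, sub_zero]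
  have hmap := HasStrictFDerivAt.map_nhds_id hH hH0
  have hcont : Tendsto (fun ε : ℝ => ε • v) (nhdsWithin 0 (Ioi 0)) (nhds 0) := by
    have : Tendsto (fun ε : ℝ => ε • v) (nhds 0) (nhds ((0 : ℝ) • v)) :=
      (continuous_id.smul continuous_const).tendsto 0
    rw [zero_smul] at this
    exact this.mono_left nhdsWithin_le_nhds
  set κ' : ℝ := min κ (1 / (2 * (1 + ‖q‖))) with hκ'
  have hκ'0 : 0 < κ' := lt_min hκ (by positivity)
  have himg : (fun x => x - T (P.nonlinSeries x)) '' Metric.closedBall 0 κ' ∈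
      nhds (0 : Wiener (RadFun R) × Wiener (RadFun R) × Wiener (RadFun R)) := by
    rw [← hmap]
    exact image_mem_map (Metric.closedBall_mem_nhds _ hκ'0)
  obtain ⟨ε, hε, hε0⟩ := ((hcont.eventually himg).and self_mem_nhdsWithin).exists
  obtain ⟨x, hx, hxeq⟩ := hε
  have hε0' : 0 < ε := hε0
  rw [mem_closedBall_zero_iff] at hx
  replace hxeq : x = ε • v + T (P.nonlinSeries x) := by
    have : x - T (P.nonlinSeries x) = ε • v := hxeq
    rw [← this]; abel
  set N := P.nonlinSeries x with hN
  have x1 : ∀ n, Wiener.coeff n x.1 = (if n = 1 then ε • φ else 0) + P.solSymbol μ n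
      (Wiener.coeff n N) := fun n => by
    conv_lhs => rw [hxeq]
    rw [Prod.fst_add, map_add, Prod.smul_fst, map_smul, hv, Wiener.coeff_single, smul_ite,
      smul_zero, hT]
    exact congrArg _ (Wiener.coeff_multiplier _ _ _ _ _)
  have x2 : ∀ n, Wiener.coeff n x.2.1 = (if n = 1 then ε • μ • φ else 0) +
      (((n : ℝ) ^ 2 * μ) • P.solSymbol μ n) (Wiener.coeff n N) := fun n => by
    conv_lhs => rw [hxeq]
    rw [Prod.snd_add, Prod.fst_add, map_add, Prod.smul_snd, Prod.smul_fst, map_smul, hv,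
      Wiener.coeff_single, smul_ite, smul_zero, hT]
    exact congrArg _ (Wiener.coeff_multiplier _ _ _ _ _)
  have x3 : ∀ n, Wiener.coeff n x.2.2 =
      (if n = 1 then ε • P.slopeOp (0 - (μ • 1 - P.potential) * φ) else 0) +
      P.slopeSymbol μ n (Wiener.coeff n N) := fun n => by
    conv_lhs => rw [hxeq]
    rw [Prod.snd_add, Prod.snd_add, map_add, Prod.smul_snd, Prod.smul_snd, map_smul, hv,
      Wiener.coeff_single, smul_ite, smul_zero, hT]
    exact congrArg _ (Wiener.coeff_multiplier _ _ _ _ _)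
  have hS : ∀ n < 2, P.solSymbol μ n = 0 := fun n hn => by rw [solSymbol, if_pos hn]
  have hS3 : ∀ n < 2, P.slopeSymbol μ n = 0 := fun n hn => by rw [slopeSymbol, if_pos hn]
  have hn1 : ‖x.1‖ ≤ κ' := (norm_fst_le x).trans hx
  have hn3 : ‖x.2.2‖ ≤ κ' := (norm_snd_le x.2).trans ((norm_snd_le x).trans hx)
  have hκq : κ' * (1 + ‖q‖) ≤ 1 / 2 := by
    calc κ' * (1 + ‖q‖) ≤ 1 / (2 * (1 + ‖q‖)) * (1 + ‖q‖) :=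
          mul_le_mul_of_nonneg_right (min_le_right _ _) (by positivity)
      _ = 1 / 2 := by field_simp
  have hsum : ‖x.1 + q * x.2.2‖ < 1 := by
    have := norm_add_le x.1 (q * x.2.2)
    have := norm_mul_le q x.2.2
    have := mul_le_mul_of_nonneg_left hn3 (norm_nonneg q)
    linarith
  have hx1 : ‖x.1‖ < 1 := by
    have := mul_nonneg hκ'0.le (norm_nonneg q)
    linarith
  have c1 : Wiener.coeff 0 x.1 = 0 := by simp [x1, hS 0 two_pos]
  have c2 : Wiener.coeff 0 x.2.1 = 0 := by simp [x2, hS 0 two_pos]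
  have c3 : Wiener.coeff 0 x.2.2 = 0 := by simp [x3, hS3 0 two_pos]
  have hN0 : ∀ k < 2, Wiener.coeff k N = 0 := fun k hk =>
    P.coeff_nonlinSeries_eq_zero hx1 hsum c1 c2 c3 hk
  have htau : ∀ n, Wiener.coeff n x.2.1 = ((n : ℝ) ^ 2 * μ) • Wiener.coeff n x.1 := by
    intro n
    rw [x1, x2, smul_add]
    by_cases hn : n = 1
    · subst hn
      rw [if_pos rfl, if_pos rfl, Nat.cast_one, one_pow, one_mul, smul_comm]
      rfl
    · rw [if_neg hn, if_neg hn, smul_zero]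
      rfl
  have key : ∀ n : ℕ, P.spectralOp ((n : ℝ) ^ 2 * μ) (Wiener.coeff n x.1) =
      P.neumannOp (Wiener.coeff n N) ∧
      Wiener.coeff n x.2.2 = P.slopeOp (Wiener.coeff n N -
        (((n : ℝ) ^ 2 * μ) • 1 - P.potential) * Wiener.coeff n x.1) := by
    intro n
    rcases Nat.lt_or_ge n 2 with hn | hn
    · rw [hN0 n hn]
      interval_cases n
      · rw [c1, c3]; simp
      · rw [x1, x3, hN0 1 one_lt_two, if_pos rfl, if_pos rfl]
        simp [hφ0]
        rw [mul_smul_comm, map_smul]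
    · have hn1 : n ≠ 1 := by omega
      have hlt : μ < (n : ℝ) ^ 2 * μ := by
        have : (2 : ℝ) ≤ n := by exact_mod_cast hn
        have h4 : (4 : ℝ) ≤ (n : ℝ) ^ 2 := by nlinarith
        have := mul_le_mul_of_nonneg_right h4 hμ.le
        linarith
      rw [x1, x3, if_neg hn1, if_neg hn1, zero_add, zero_add,
        P.slopeSymbol_apply (by omega : ¬ n < 2)]
      refine ⟨?_, rfl⟩
      rw [solSymbol, if_neg (by omega : ¬ n < 2)]
      exact P.spectralOp_resolventOp (hreg _ hlt) _
  refine ⟨x, hx.trans (min_le_left _ _), c1, c3, ?_, htau, ?_, ?_⟩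
  · rw [x1, if_pos rfl, hS 1 one_lt_two]
    simpa using ⟨hε0'.ne', hφ⟩
  · intro n r hr
    obtain ⟨-, h2⟩ := P.eq_of_spectralOp_eq (key n).1
    rw [← (key n).2] at h2
    exact hasDerivAt_of_eq_primOp h2 hr
  · intro n r hr
    obtain ⟨h1, -⟩ := P.eq_of_spectralOp_eq (key n).1
    have h3 := P.hasDerivAt_slopeOp (Wiener.coeff n N -
      (((n : ℝ) ^ 2 * μ) • 1 - P.potential) * Wiener.coeff n x.1) hr
    rw [← (key n).2, h1] at h3
    refine h3.congr_deriv ?_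
    have h4 : ext (Wiener.coeff n N - (((n : ℝ) ^ 2 * μ) • 1 - P.potential) *
        Wiener.coeff n x.1) r = - ext (Wiener.coeff n (P.bulkSeries x)) r := by
      rw [P.bulkSeries_eq, htau, ← hN, ← RadFun.ext_neg]
      congr 1
      rw [sub_mul, smul_mul_assoc, one_mul]
      abel
    rw [h4]
    ring

end IsProfile

/-! ### Weighted regularity -/

section WReg

variable {s : Set ℝ} {w : ℝ → ℝ}

/-- `WReg s w k f` says that `f` is bounded on `s` together with its first `k` derivatives along
the vector field `w ∂`. -/
def WReg {G : Type*} [NormedAddCommGroup G] [NormedSpace ℝ G] (s : Set ℝ) (w : ℝ → ℝ) :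
    ℕ → (ℝ → G) → Prop
  | 0, f => ∃ C, ∀ r ∈ s, ‖f r‖ ≤ C
  | k + 1, f => (∃ C, ∀ r ∈ s, ‖f r‖ ≤ C) ∧
      ∃ f' : ℝ → G, (∀ r ∈ s, HasDerivAt f (f' r) r) ∧ WReg s w k fun r => w r • f' r

namespace WReg

section Module

variable {G : Type*} [NormedAddCommGroup G] [NormedSpace ℝ G] {f g : ℝ → G} {k : ℕ}

lemma bounded (h : WReg s w k f) : ∃ C, ∀ r ∈ s, ‖f r‖ ≤ C := by
  cases k with
  | zero => exact h
  | succ k => exact h.1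

lemma of_succ (h : WReg s w (k + 1) f) : WReg s w k f := by
  induction k generalizing f with
  | zero => exact h.1
  | succ k ih =>
    obtain ⟨h0, f', h1, h2⟩ := h
    exact ⟨h0, f', h1, ih h2⟩

lemma mono {j : ℕ} (h : WReg s w k f) (hj : j ≤ k) : WReg s w j f := by
  induction k with
  | zero => rwa [Nat.le_zero.1 hj]
  | succ k ih =>
    rcases Nat.lt_or_ge k j with hlt | hge
    · rwa [show j = k + 1 by omega]
    · exact ih h.of_succ hge

lemma mono_set {t : Set ℝ} (h : WReg s w k f) (ht : t ⊆ s) : WReg t w k f := by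
  induction k generalizing f with
  | zero => obtain ⟨C, hC⟩ := h; exact ⟨C, fun r hr => hC r (ht hr)⟩
  | succ k ih =>
    obtain ⟨⟨C, hC⟩, f', h1, h2⟩ := h
    exact ⟨⟨C, fun r hr => hC r (ht hr)⟩, f', fun r hr => h1 r (ht hr), ih h2⟩

lemma congr (hs : IsOpen s) (h : WReg s w k f) (hfg : ∀ r ∈ s, f r = g r) : WReg s w k g := by
  have hb : ∃ C, ∀ r ∈ s, ‖g r‖ ≤ C := by
    obtain ⟨C, hC⟩ := h.bounded
    exact ⟨C, fun r hr => by rw [← hfg r hr]; exact hC r hr⟩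
  cases k with
  | zero => exact hb
  | succ k =>
    obtain ⟨-, f', h1, h2⟩ := h
    refine ⟨hb, f', fun r hr => (h1 r hr).congr_of_eventuallyEq ?_, h2⟩
    filter_upwards [hs.mem_nhds hr] with x hx using (hfg x hx).symm

lemma add (hf : WReg s w k f) (hg : WReg s w k g) : WReg s w k fun r => f r + g r := by
  have hb : ∃ C, ∀ r ∈ s, ‖f r + g r‖ ≤ C := by
    obtain ⟨C, hC⟩ := hf.bounded
    obtain ⟨D, hD⟩ := hg.bounded
    exact ⟨C + D, fun r hr => (norm_add_le _ _).trans (add_le_add (hC r hr) (hD r hr))⟩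
  induction k generalizing f g with
  | zero => exact hb
  | succ k ih =>
    obtain ⟨hf0, f', f1, f2⟩ := hf
    obtain ⟨hg0, g', g1, g2⟩ := hg
    refine ⟨hb, fun r => f' r + g' r, fun r hr => (f1 r hr).add (g1 r hr), ?_⟩
    have hb2 : ∃ C, ∀ r ∈ s, ‖w r • f' r + w r • g' r‖ ≤ C := by
      obtain ⟨C, hC⟩ := f2.bounded
      obtain ⟨D, hD⟩ := g2.bounded
      exact ⟨C + D, fun r hr => (norm_add_le _ _).trans (add_le_add (hC r hr) (hD r hr))⟩
    simpa only [smul_add] using ih f2 g2 hb2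

lemma clm {F : Type*} [NormedAddCommGroup F] [NormedSpace ℝ F] (L : G →L[ℝ] F)
    (hf : WReg s w k f) : WReg s w k fun r => L (f r) := by
  induction k generalizing f with
  | zero =>
    obtain ⟨C, hC⟩ := hf
    exact ⟨‖L‖ * C, fun r hr => (L.le_opNorm _).trans
      (mul_le_mul_of_nonneg_left (hC r hr) (norm_nonneg _))⟩
  | succ k ih =>
    obtain ⟨⟨C, hC⟩, f', f1, f2⟩ := hf
    refine ⟨⟨‖L‖ * C, fun r hr => (L.le_opNorm _).trans
      (mul_le_mul_of_nonneg_left (hC r hr) (norm_nonneg _))⟩, fun r => L (f' r),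
      fun r hr => L.hasFDerivAt.comp_hasDerivAt r (f1 r hr), ?_⟩
    simpa only [map_smul] using ih f2

lemma neg (hf : WReg s w k f) : WReg s w k fun r => -f r := by
  simpa using hf.clm (-ContinuousLinearMap.id ℝ G)

lemma sub (hf : WReg s w k f) (hg : WReg s w k g) : WReg s w k fun r => f r - g r := by
  simpa only [sub_eq_add_neg] using hf.add hg.neg

lemma const (e : G) : WReg s w k fun _ => e := by
  induction k generalizing e with
  | zero => exact ⟨‖e‖, fun r _ => le_rfl⟩
  | succ k ih =>
    refine ⟨⟨‖e‖, fun r _ => le_rfl⟩, fun _ => 0, fun r _ => hasDerivAt_const r e, ?_⟩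
    simpa only [smul_zero] using ih 0

lemma const_smul (a : ℝ) (hf : WReg s w k f) : WReg s w k fun r => a • f r := by
  simpa using hf.clm (a • ContinuousLinearMap.id ℝ G)

lemma bilin {E F : Type*} [NormedAddCommGroup E] [NormedSpace ℝ E] [NormedAddCommGroup F]
    [NormedSpace ℝ F] (B : E →L[ℝ] F →L[ℝ] G) {f : ℝ → E} {g : ℝ → F}
    (hf : WReg s w k f) (hg : WReg s w k g) : WReg s w k fun r => B (f r) (g r) := by
  induction k generalizing f g with
  | zero =>
    obtain ⟨C, hC⟩ := hf
    obtain ⟨D, hD⟩ := hg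
    refine ⟨‖B‖ * C * D, fun r hr => (B.le_opNorm₂ _ _).trans ?_⟩
    have := (norm_nonneg _).trans (hC r hr)
    have := hC r hr
    have := hD r hr
    gcongr
  | succ k ih =>
    obtain ⟨⟨C, hC⟩, f', f1, f2⟩ := id hf
    obtain ⟨⟨D, hD⟩, g', g1, g2⟩ := id hg
    refine ⟨⟨‖B‖ * C * D, fun r hr => (B.le_opNorm₂ _ _).trans ?_⟩,
      fun r => B (f r) (g' r) + B (f' r) (g r),
      fun r hr => B.hasDerivAt_of_bilinear (fun _ => f1 r hr) fun _ => g1 r hr, ?_⟩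
    · have := (norm_nonneg _).trans (hC r hr)
      have := hC r hr
      have := hD r hr
      gcongr
    · have := (ih hf.of_succ g2).add (ih f2 hg.of_succ)
      simpa only [smul_add, map_smul, smul_apply] using this

lemma smul {c : ℝ → ℝ} (hc : WReg s w k c) (hf : WReg s w k f) :
    WReg s w k fun r => c r • f r := by
  simpa using hc.bilin (ContinuousLinearMap.lsmul ℝ ℝ) hf

lemma weighted_iteratedDeriv (hs : IsOpen s) {w' : ℝ → ℝ} (hw : ∀ r ∈ s, HasDerivAt w (w' r) r)
    (hw0 : ∀ r ∈ s, w r ≠ 0) (hw' : ∀ k, WReg s w k w') {j : ℕ} (hf : WReg s w (k + j) f) :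
    WReg s w k fun r => w r ^ j • iteratedDeriv j f r := by
  induction j generalizing k with
  | zero => simpa using hf
  | succ j ih =>
    have h1 : WReg s w (k + 1) fun r => w r ^ j • iteratedDeriv j f r :=
      ih (by rwa [add_assoc, add_comm 1 j])
    obtain ⟨-, F', h2, h3⟩ := id h1
    have h4 : ∀ r ∈ s, DifferentiableAt ℝ (iteratedDeriv j f) r := fun r hr => by
      have h5 := ((hw r hr).pow j).differentiableAt.inv (pow_ne_zero j (hw0 r hr))
      refine (h5.smul (h2 r hr).differentiableAt).congr_of_eventuallyEq ?_
      filter_upwards [hs.mem_nhds hr] with x hx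
      simp [smul_smul, inv_mul_cancel₀ (pow_ne_zero j (hw0 x hx))]
    refine (h3.sub (((hw' k).const_smul j).smul h1.of_succ)).congr hs fun r hr => ?_
    have h6 := (h2 r hr).unique (((hw r hr).pow j).smul (h4 r hr).hasDerivAt)
    simp only [iteratedDeriv_succ, h6, Pi.pow_apply, smul_eq_mul]
    rcases j with _ | j
    · simp
    · simp only [Nat.add_sub_cancel, smul_add, smul_smul]
      rw [pow_succ, pow_succ]
      module

lemma contDiffOn (hs : IsOpen s) {n : ℕ} (hw : ContDiffOn ℝ n w s) (hw0 : ∀ r ∈ s, w r ≠ 0)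
    (hf : WReg s w (n + 1) f) : ContDiffOn ℝ n f s := by
  induction n generalizing f with
  | zero =>
    obtain ⟨-, f', h1, -⟩ := hf
    exact contDiffOn_zero.2 fun r hr => (h1 r hr).continuousAt.continuousWithinAt
  | succ n ih =>
    obtain ⟨-, f', h1, h2⟩ := hf
    rw [Nat.cast_succ]
    refine (contDiffOn_succ_iff_deriv_of_isOpen hs).2
      ⟨fun r hr => (h1 r hr).differentiableAt.differentiableWithinAt, by simp, ?_⟩
    have hw1 : ContDiffOn ℝ n w s := hw.of_le (by exact_mod_cast Nat.le_succ n)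
    refine ((hw1.inv hw0).smul (ih hw1 h2)).congr fun r hr => ?_
    change _ = (w r)⁻¹ • w r • f' r
    rw [(h1 r hr).deriv, smul_smul, inv_mul_cancel₀ (hw0 r hr), one_smul]

end Module

section Algebra

variable {A : Type*} [NormedCommRing A] [NormedAlgebra ℝ A] {f g : ℝ → A} {k : ℕ}

lemma mul (hf : WReg s w k f) (hg : WReg s w k g) : WReg s w k fun r => f r * g r := by
  simpa using hf.bilin (ContinuousLinearMap.mul ℝ A) hg

lemma pow (hf : WReg s w k f) (n : ℕ) : WReg s w k fun r => f r ^ n := by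
  induction n with
  | zero => simpa only [pow_zero] using const 1
  | succ n ih => simpa only [pow_succ] using ih.mul hf

lemma algebraMap {c : ℝ → ℝ} (hc : WReg s w k c) :
    WReg s w k fun r => algebraMap ℝ A (c r) := by
  simpa only [Algebra.algebraMap_eq_smul_one] using hc.smul (const (1 : A))

lemma powSeries [CompleteSpace A] {c : ℕ → ℝ} (hc : UnitDiscSeries c) {ρ : ℝ} (hρ : ρ < 1)
    (hle : ∀ r ∈ s, ‖f r‖ ≤ ρ) (hf : WReg s w k f) :
    WReg s w k fun r => LaneEmden.powSeries c (f r) := by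
  induction k generalizing c with
  | zero => exact ⟨_, fun r hr => hc.norm_powSeries_le hρ (hle r hr)⟩
  | succ k ih =>
    obtain ⟨-, f', f1, f2⟩ := id hf
    refine ⟨⟨_, fun r hr => hc.norm_powSeries_le hρ (hle r hr)⟩,
      fun r => LaneEmden.powSeries (derivSeries c) (f r) * f' r,
      fun r hr => hc.hasDerivAt_comp (f1 r hr) ((hle r hr).trans_lt hρ), ?_⟩
    simpa only [mul_smul_comm] using (ih hc.deriv hf.of_succ).mul f2

end Algebra

end WReg

end WReg

namespace IsProfile

variable {α c R : ℝ} {w : ℝ → ℝ} (P : IsProfile α c R w)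

include P

/-! ### Weighted regularity of the profile -/

omit P in
lemma abs_le_of_fuchs {b : ℕ} (hb : 2 ≤ b) {Y Y' g : ℝ → ℝ} {C : ℝ}
    (hY : ∀ r ∈ Ioo 0 R, HasDerivAt Y (Y' r) r) (heq : ∀ r ∈ Ioo 0 R, r * Y' r + b * Y r = g r)
    (hM : ∃ M, ∀ r ∈ Ioo 0 R, |r * Y r| ≤ M) (hC : ∀ r ∈ Ioo 0 R, |g r| ≤ C) :
    ∀ r ∈ Ioo 0 R, |Y r| ≤ C := by
  obtain ⟨M, hM⟩ := hM
  intro r hr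
  have hC0 : 0 ≤ C := (abs_nonneg _).trans (hC r hr)
  obtain ⟨n, rfl⟩ : ∃ n, b = n + 2 := ⟨b - 2, by omega⟩
  have hlim : Tendsto (fun x : ℝ => M * x ^ (n + 1)) (nhdsWithin 0 (Ioi 0)) (nhds 0) := by
    have : Continuous fun x : ℝ => M * x ^ (n + 1) := by fun_prop
    simpa using (this.tendsto 0).mono_left nhdsWithin_le_nhds
  have hbound : ∀ y ∈ Ioo 0 r, |r ^ (n + 2) * Y r - y ^ (n + 2) * Y y| ≤
      C * r ^ (n + 2) - C * y ^ (n + 2) := by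
    intro y hy
    have hsub : ∀ x ∈ Icc y r, x ∈ Ioo 0 R := fun x hx =>
      ⟨hy.1.trans_le hx.1, hx.2.trans_lt hr.2⟩
    have hd : ∀ x ∈ Icc y r, HasDerivAt (fun x => x ^ (n + 2) * Y x) (x ^ (n + 1) * g x) x :=
      fun x hx => ((hasDerivAt_pow (n + 2) x).mul (hY x (hsub x hx))).congr_deriv (by
        rw [← heq x (hsub x hx), show n + 2 - 1 = n + 1 by omega]; push_cast; ring)
    have hB : ∀ x, HasDerivAt (fun x => C * x ^ (n + 2) - C * y ^ (n + 2))
        (C * ((n + 2 : ℕ) * x ^ (n + 1))) x :=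
      fun x => (((hasDerivAt_pow (n + 2) x).const_mul C).sub_const _)
    have := image_norm_le_of_norm_deriv_right_le_deriv_boundary (a := y) (b := r)
      (f := fun x => x ^ (n + 2) * Y x - y ^ (n + 2) * Y y) (f' := fun x => x ^ (n + 1) * g x)
      (B := fun x => C * x ^ (n + 2) - C * y ^ (n + 2))
      (B' := fun x => C * ((n + 2 : ℕ) * x ^ (n + 1)))
      (fun x hx => ((hd x hx).continuousAt.sub continuousAt_const).continuousWithinAt)
      (fun x hx => ((hd x ⟨hx.1, hx.2.le⟩).sub_const _).hasDerivWithinAt) (by simp) hB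
      (fun x hx => by
        have hx' := hsub x ⟨hx.1, hx.2.le⟩
        rw [norm_mul, Real.norm_eq_abs, Real.norm_eq_abs,
          abs_of_nonneg (pow_nonneg hx'.1.le _)]
        have h1 := mul_le_mul_of_nonneg_left (hC x hx') (pow_nonneg hx'.1.le (n + 1))
        have h2 : 0 ≤ C * x ^ (n + 1) := mul_nonneg hC0 (pow_nonneg hx'.1.le _)
        have h3 : (0 : ℝ) ≤ n := n.cast_nonneg
        push_cast
        nlinarith [mul_nonneg h2 h3]) (right_mem_Icc.2 hy.2.le)
    simpa using this
  have hlim0 : Tendsto (fun y => C * r ^ (n + 2) + M * y ^ (n + 1)) (nhdsWithin 0 (Ioi 0))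
      (nhds (C * r ^ (n + 2))) := by simpa using hlim.const_add (C * r ^ (n + 2))
  have hev : ∀ᶠ y in nhdsWithin (0 : ℝ) (Ioi 0), |r ^ (n + 2) * Y r| ≤
      C * r ^ (n + 2) + M * y ^ (n + 1) := by
    filter_upwards [Ioo_mem_nhdsGT hr.1] with y hy
    have h1 := hbound y hy
    have h2 := abs_sub_abs_le_abs_sub (r ^ (n + 2) * Y r) (y ^ (n + 2) * Y y)
    have h3 : |y ^ (n + 2) * Y y| ≤ M * y ^ (n + 1) := by
      rw [show y ^ (n + 2) * Y y = (y * Y y) * y ^ (n + 1) by ring, abs_mul,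
        abs_of_nonneg (pow_nonneg hy.1.le (n + 1))]
      exact mul_le_mul_of_nonneg_right (hM y ⟨hy.1, hy.2.trans hr.2⟩) (pow_nonneg hy.1.le _)
    have h4 : 0 ≤ C * y ^ (n + 2) := mul_nonneg hC0 (pow_nonneg hy.1.le _)
    linarith
  have hfin := ge_of_tendsto hlim0 hev
  rw [abs_mul, abs_of_nonneg (pow_nonneg hr.1.le _), mul_comm] at hfin
  exact le_of_mul_le_mul_right hfin (pow_pos hr.1 _)

lemma wReg_of_fuchs {k : ℕ} (hid : WReg (Ioo 0 R) w k fun r => r)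
    (hv : WReg (Ioo 0 R) w k (radSlope w)) {b : ℕ} (hb : 2 ≤ b)
    {Y Y' g : ℝ → ℝ} (hY : ∀ r ∈ Ioo 0 R, HasDerivAt Y (Y' r) r)
    (heq : ∀ r ∈ Ioo 0 R, r * Y' r + b * Y r = g r)
    (hM : ∃ M, ∀ r ∈ Ioo 0 R, |r * Y r| ≤ M) (hg : WReg (Ioo 0 R) w k g) :
    WReg (Ioo 0 R) w k Y := by
  induction k generalizing b Y Y' g with
  | zero =>
    obtain ⟨C, hC⟩ := hg
    exact ⟨C, abs_le_of_fuchs hb hY heq hM hC⟩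
  | succ k ih =>
    have hYk : WReg (Ioo 0 R) w k Y := ih hid.of_succ hv.of_succ hb hY heq hM hg.of_succ
    obtain ⟨CY, hCY⟩ := hYk.bounded
    obtain ⟨⟨C, hC⟩, g', g1, g2⟩ := id hg
    refine ⟨⟨CY, hCY⟩, Y', hY, ?_⟩
    have hY'eq : ∀ r ∈ Ioo 0 R, Y' r = (g r - b * Y r) / r := fun r hr => by
      rw [eq_div_iff hr.1.ne', ← heq r hr]; ring
    have hY' : ∀ r ∈ Ioo 0 R, HasDerivAt Y' ((g' r - b * Y' r - Y' r) / r) r := fun r hr => by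
      have h1 := ((g1 r hr).sub ((hY r hr).const_mul (b : ℝ))).div (hasDerivAt_id r) hr.1.ne'
      refine (h1.congr_of_eventuallyEq ?_).congr_deriv ?_
      · filter_upwards [isOpen_Ioo.mem_nhds hr] with x hx using hY'eq x hx
      · have hr0 := hr.1.ne'
        simp only [Pi.sub_apply, id]
        rw [hY'eq r hr]
        field_simp
    refine ih hid.of_succ hv.of_succ (b := b + 1) (by omega)
      (Y' := fun r => r * radSlope w r * Y' r + w r * ((g' r - b * Y' r - Y' r) / r))
      (g := fun r => w r • g' r + r • radSlope w r • (g r - (b : ℝ) • Y r))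
      (fun r hr => (P.hasDerivAt hr).mul (hY' r hr)) (fun r hr => ?_)
      ⟨C + b * CY, fun r hr => ?_⟩
      (g2.add (hid.of_succ.smul (hv.of_succ.smul (hg.of_succ.sub (hYk.const_smul b)))))
    · have hr0 := hr.1.ne'
      rw [hY'eq r hr]
      simp only [smul_eq_mul]
      push_cast
      field_simp
      ring
    · have hw0 := P.w_pos hr
      have hw1 := P.w_le_one ⟨hr.1.le, hr.2.le⟩
      have hr0 := hr.1.ne'
      have h1 : r * (w r • Y' r) = w r * (g r - b * Y r) := by
        rw [hY'eq r hr, smul_eq_mul]; field_simp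
      rw [h1, abs_mul, abs_of_pos hw0]
      refine (mul_le_of_le_one_left (abs_nonneg _) hw1).trans ((abs_sub _ _).trans ?_)
      rw [abs_mul, Nat.abs_cast]
      have := hC r hr
      have := mul_le_mul_of_nonneg_left (hCY r hr) (Nat.cast_nonneg (α := ℝ) b)
      simp only [Real.norm_eq_abs] at *
      linarith

lemma wReg_rpow_of_radSlope {k : ℕ} (hid : ∀ j < k, WReg (Ioo 0 R) w j fun r => r)
    (hv : ∀ j < k, WReg (Ioo 0 R) w j (radSlope w)) {s : ℝ} (hs : 0 ≤ s) :
    WReg (Ioo 0 R) w k fun r => w r ^ s := by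
  have hb : ∃ C, ∀ r ∈ Ioo 0 R, ‖w r ^ s‖ ≤ C := ⟨1, fun r hr => by
    rw [Real.norm_of_nonneg (rpow_nonneg (P.w_pos hr).le _)]
    exact rpow_le_one (P.w_pos hr).le (P.w_le_one ⟨hr.1.le, hr.2.le⟩) hs⟩
  induction k with
  | zero => exact hb
  | succ k ih =>
    refine ⟨hb, _, fun r hr => P.hasDerivAt_rpow hr s, ?_⟩
    have h1 := ih (fun j hj => hid j (by omega)) fun j hj => hv j (by omega)
    refine ((h1.smul ((hid k (by omega)).smul (hv k (by omega)))).const_smul s).congr isOpen_Ioo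
      fun r hr => ?_
    rw [rpow_sub_one (P.w_pos hr).ne']
    have := (P.w_pos hr).ne'
    simp only [smul_eq_mul]
    field_simp

lemma wReg_profile (k : ℕ) : WReg (Ioo 0 R) w k (radSlope w) ∧
    WReg (Ioo 0 R) w k (radSlopeDeriv α c w) ∧ (WReg (Ioo 0 R) w k fun r => r) ∧
    WReg (Ioo 0 R) w k w := by
  induction k using Nat.strong_induction_on with
  | _ k ih =>
    have hid' : ∀ j < k, WReg (Ioo 0 R) w j fun r => r := fun j hj => (ih j hj).2.2.1
    have hv' : ∀ j < k, WReg (Ioo 0 R) w j (radSlope w) := fun j hj => (ih j hj).1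
    have hw : WReg (Ioo 0 R) w k w := by
      refine (P.wReg_rpow_of_radSlope hid' hv' zero_le_one).congr isOpen_Ioo fun r _ => ?_
      rw [rpow_one]
    have hvb : ∃ C, ∀ r ∈ Ioo 0 R, ‖radSlope w r‖ ≤ C := ⟨c / 3, fun r hr => P.abs_radSlope_le hr⟩
    have hidb : ∃ C, ∀ r ∈ Ioo 0 R, ‖r‖ ≤ C :=
      ⟨R, fun r hr => by rw [Real.norm_of_nonneg hr.1.le]; exact hr.2.le⟩
    have hid : WReg (Ioo 0 R) w k fun r => r := by
      cases k with
      | zero => exact hidb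
      | succ k => exact ⟨hidb, fun _ => 1, fun r _ => hasDerivAt_id r, by simpa using hw.of_succ⟩
    have hv : WReg (Ioo 0 R) w k (radSlope w) := by
      cases k with
      | zero => exact hvb
      | succ k =>
        obtain ⟨-, h2, -, h4⟩ := ih k (by omega)
        exact ⟨hvb, _, fun r hr => P.hasDerivAt_radSlope hr, h4.smul h2⟩
    have hα := P.lt_α
    have hpow := P.wReg_rpow_of_radSlope hid' hv' (s := α - 1) (by linarith)
    refine ⟨hv, ?_, hid, hw⟩
    have hd : ∀ r ∈ Ioo 0 R, HasDerivAt (radSlopeDeriv α c w)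
        ((-c * (α * w r ^ (α - 1) * (r * radSlope w r)) - 3 * radSlopeDeriv α c w r -
          radSlopeDeriv α c w r) / r) r := fun r hr => by
      refine ((((P.hasDerivAt_rpow hr α).const_mul (-c)).sub
        ((P.hasDerivAt_radSlope hr).const_mul 3)).div (hasDerivAt_id r) hr.1.ne').congr_deriv ?_
      have := hr.1.ne'
      simp only [radSlopeDeriv, Pi.sub_apply, id]
      field_simp
    refine P.wReg_of_fuchs hid hv (b := 4) (by norm_num) hd
      (g := fun r => (-c * α) • (w r ^ (α - 1)) • r • radSlope w r) (fun r hr => ?_)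
      ⟨c + 3 * (c / 3), fun r hr => ?_⟩ ((hpow.smul (hid.smul hv)).const_smul _)
    · have := hr.1.ne'
      simp only [smul_eq_mul]
      push_cast
      field_simp
      ring
    · have h0 := hr.1.ne'
      rw [radSlopeDeriv, mul_div_cancel₀ _ h0]
      have h1 : w r ^ α ≤ 1 :=
        rpow_le_one (P.w_pos hr).le (P.w_le_one ⟨hr.1.le, hr.2.le⟩) P.α_pos.le
      have h2 := abs_le.1 (P.abs_radSlope_le hr)
      have h3 : 0 ≤ w r ^ α := rpow_nonneg (P.w_pos hr).le _
      have hc := P.c_pos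
      rw [abs_le]
      constructor <;> nlinarith

end IsProfile

namespace IsProfile

variable {α c R : ℝ} {w : ℝ → ℝ} (P : IsProfile α c R w)

include P

/-! ### Regularity for perturbed first order equations -/

lemma exists_fuchs_bound {a : ℝ} (ha : 1 < a) {b : ℕ} (hb : 2 ≤ b) :
    ∃ C > 0, ∃ κ₀ > 0, ∀ (A : Type) [NormedCommRing A] [NormedAlgebra ℝ A]
      (Y Y' h κ : ℝ → A) (H M : ℝ), (∀ r ∈ Ioo 0 R, HasDerivAt Y (Y' r) r) →
      (∀ r ∈ Ioo 0 R, (w r * r) • Y' r + (b * w r + a * (r ^ 2 * radSlope w r)) • Y r =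
        h r + κ r * Y r) →
      (∀ r ∈ Ioo 0 R, ‖h r‖ ≤ H) → (∀ r ∈ Ioo 0 R, ‖κ r‖ ≤ κ₀) →
      (∀ r ∈ Ioo 0 R, ‖(w r * r) • Y r‖ ≤ M) → ∀ r ∈ Ioo 0 R, ‖Y r‖ ≤ C * H := by
  obtain ⟨C, hC, hardy⟩ := P.exists_hardy ha hb
  refine ⟨2 * C, by positivity, 1 / (2 * C), by positivity, ?_⟩
  intro A _ _ Y Y' h κ H M hY heq hh hκ hM
  have hR := P.R_pos
  have hmid : R / 2 ∈ Ioo 0 R := ⟨by linarith, by linarith⟩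
  have hH0 : 0 ≤ H := (norm_nonneg _).trans (hh _ hmid)
  have hwr : ∀ r ∈ Ioo 0 R, 0 < w r * r := fun r hr => mul_pos (P.w_pos hr) hr.1
  have hweight : ∀ r ∈ Ioo 0 R, w r ^ a * r ^ b = w r ^ (a - 1) * r ^ (b - 1) * (w r * r) := by
    intro r hr
    obtain ⟨n, rfl⟩ : ∃ n, b = n + 1 := ⟨b - 1, by omega⟩
    rw [rpow_sub_one (P.w_pos hr).ne', Nat.add_sub_cancel]
    have := (P.w_pos hr).ne'
    field_simp
    ring
  have hpos : ∀ r ∈ Ioo 0 R, 0 < w r ^ (a - 1) * r ^ (b - 1) := fun r hr =>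
    mul_pos (rpow_pos_of_pos (P.w_pos hr) _) (pow_pos hr.1 _)
  have hFle : ∀ r ∈ Ioo 0 R, ‖(w r ^ a * r ^ b) • Y r‖ ≤ w r ^ (a - 1) * r ^ (b - 1) * M := by
    intro r hr
    rw [hweight r hr, mul_smul, norm_smul, Real.norm_of_nonneg (hpos r hr).le]
    exact mul_le_mul_of_nonneg_left (hM r hr) (hpos r hr).le
  have hcont : ContinuousOn (fun r => w r ^ (a - 1) * r ^ (b - 1) * M) (Icc 0 R) :=
    ((P.continuousOn_rpow (by linarith)).mul (continuousOn_pow _)).mul continuousOn_const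
  have hlim0 : Tendsto (fun r => (w r ^ a * r ^ b) • Y r) (nhdsWithin 0 (Ioi 0)) (nhds 0) := by
    have h1 := (hcont 0 (left_mem_Icc.2 hR.le)).mono_left
      (nhdsWithin_mono 0 (Ioo_subset_Icc_self : Ioo 0 R ⊆ Icc 0 R))
    simp only [] at h1
    rw [nhdsWithin_Ioo_eq_nhdsGT hR, zero_pow (by omega), mul_zero, zero_mul] at h1
    refine squeeze_zero_norm' ?_ h1
    filter_upwards [Ioo_mem_nhdsGT hR] with r hr using hFle r hr
  have hlimR : Tendsto (fun r => (w r ^ a * r ^ b) • Y r) (nhdsWithin R (Iio R)) (nhds 0) := by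
    have h1 := (hcont R (right_mem_Icc.2 hR.le)).mono_left
      (nhdsWithin_mono R (Ioo_subset_Icc_self : Ioo 0 R ⊆ Icc 0 R))
    simp only [] at h1
    rw [nhdsWithin_Ioo_eq_nhdsLT hR, P.apply_R, zero_rpow (by linarith), zero_mul, zero_mul] at h1
    refine squeeze_zero_norm' ?_ h1
    filter_upwards [Ioo_mem_nhdsLT hR] with r hr using hFle r hr
  have key : ∀ δ > 0, ∀ r ∈ Ioo 0 R, ‖Y r‖ ≤ 2 * C * H * (1 + δ / (w r * r)) := by
    intro δ hδ
    set g : Ioo 0 R → ℝ := fun r => ‖Y r‖ * (w r * r) / (w r * r + δ) with hg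
    have hbdd : BddAbove (range g) := by
      refine ⟨M / δ, ?_⟩
      rintro _ ⟨⟨r, hr⟩, rfl⟩
      have h1 := hM r hr
      have h2 := hwr r hr
      rw [norm_smul, Real.norm_of_nonneg h2.le, mul_comm] at h1
      exact div_le_div₀ ((by positivity : 0 ≤ ‖Y r‖ * (w r * r)).trans h1) h1 hδ (by linarith)
    have : Nonempty (Ioo 0 R) := ⟨⟨_, hmid⟩⟩
    set S := iSup g with hS
    have hS0 : 0 ≤ S := by
      refine le_trans ?_ (le_ciSup hbdd ⟨_, hmid⟩)
      have := hwr _ hmid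
      positivity
    have hYS : ∀ r ∈ Ioo 0 R, ‖Y r‖ ≤ S * (1 + δ / (w r * r)) := by
      intro r hr
      have h1 : ‖Y r‖ * (w r * r) / (w r * r + δ) ≤ S := le_ciSup hbdd ⟨r, hr⟩
      have h2 := hwr r hr
      rw [div_le_iff₀ (by linarith)] at h1
      rw [one_add_div h2.ne', ← mul_div_assoc, le_div_iff₀ h2]
      exact h1
    set H₁ := H + 1 / (2 * C) * S with hH₁
    have hH₁0 : 0 ≤ H₁ := by positivity
    have hres := hardy A (fun r => (w r ^ a * r ^ b) • Y r)
      (fun r => (w r ^ (a - 1) * r ^ (b - 1)) • (h r + κ r * Y r)) H₁ (H₁ * δ) hH₁0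
      (by positivity) (fun r hr => by
        refine ((P.hasDerivAt_weight hr a b).smul (hY r hr)).congr_deriv ?_
        have h2 := (P.w_pos hr).ne'
        have h3 := hr.1.ne'
        rw [← heq r hr, hweight r hr, smul_add, smul_smul, smul_smul]
        congr 2
        field_simp) (fun r hr => by
        have h2 := hwr r hr
        rw [norm_smul, Real.norm_of_nonneg (hpos r hr).le]
        refine mul_le_mul_of_nonneg_left ?_ (hpos r hr).le
        have h3 : ‖κ r * Y r‖ ≤ 1 / (2 * C) * (S * (1 + δ / (w r * r))) :=
          (norm_mul_le _ _).trans (mul_le_mul (hκ r hr) (hYS r hr) (norm_nonneg _) (by positivity))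
        have h4 : 0 ≤ H * (δ / (w r * r)) := by positivity
        calc ‖h r + κ r * Y r‖ ≤ H + 1 / (2 * C) * (S * (1 + δ / (w r * r))) :=
              (norm_add_le _ _).trans (add_le_add (hh r hr) h3)
          _ ≤ H + 1 / (2 * C) * (S * (1 + δ / (w r * r))) + H * (δ / (w r * r)) := by linarith
          _ = H₁ + H₁ * δ / (w r * r) := by rw [hH₁]; ring) hlim0 hlimR
    have hYle : ∀ r ∈ Ioo 0 R, ‖Y r‖ ≤ C * H₁ * (1 + δ / (w r * r)) := by
      intro r hr
      have h1 := hres r hr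
      have h2 : 0 < w r ^ a * r ^ b := by rw [hweight r hr]; exact mul_pos (hpos r hr) (hwr r hr)
      rw [norm_smul, Real.norm_of_nonneg h2.le] at h1
      refine le_of_mul_le_mul_left (h1.trans_eq ?_) h2
      ring
    have hSle : S ≤ C * H₁ := by
      refine ciSup_le fun ⟨r, hr⟩ => ?_
      have h2 := hwr r hr
      have h1 := hYle r hr
      rw [one_add_div h2.ne', ← mul_div_assoc, le_div_iff₀ h2] at h1
      rw [hg]
      simp only
      rwa [div_le_iff₀ (by linarith)]
    have hS2 : S ≤ 2 * C * H := by
      have : C * H₁ = C * H + S / 2 := by rw [hH₁]; field_simp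
      linarith
    intro r hr
    have h2 := hwr r hr
    exact (hYS r hr).trans (mul_le_mul_of_nonneg_right hS2 (by positivity))
  intro r hr
  have hlim : Tendsto (fun δ : ℝ => 2 * C * H * (1 + δ / (w r * r))) (nhdsWithin 0 (Ioi 0))
      (nhds (2 * C * H)) := by
    have : Continuous fun δ : ℝ => 2 * C * H * (1 + δ / (w r * r)) := by fun_prop
    simpa using (this.tendsto 0).mono_left nhdsWithin_le_nhds
  exact ge_of_tendsto hlim (by filter_upwards [self_mem_nhdsWithin] with δ hδ using key δ hδ r hr)

lemma exists_wReg_of_fuchs {a : ℝ} (ha : 1 < a) (k : ℕ) {b : ℕ} (hb : 2 ≤ b) :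
    ∃ κ₀ > 0, ∀ (A : Type) [NormedCommRing A] [NormedAlgebra ℝ A] (Y Y' h κ : ℝ → A),
      (∀ r ∈ Ioo 0 R, HasDerivAt Y (Y' r) r) →
      (∀ r ∈ Ioo 0 R, (w r * r) • Y' r + (b * w r + a * (r ^ 2 * radSlope w r)) • Y r =
        h r + κ r * Y r) →
      WReg (Ioo 0 R) w k h → WReg (Ioo 0 R) w k κ → (∀ r ∈ Ioo 0 R, ‖κ r‖ ≤ κ₀) →
      (∃ M, ∀ r ∈ Ioo 0 R, ‖(w r * r) • Y r‖ ≤ M) → WReg (Ioo 0 R) w k Y := by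
  induction k generalizing b with
  | zero =>
    obtain ⟨C, hC, κ₀, hκ₀, hb⟩ := P.exists_fuchs_bound ha hb
    refine ⟨κ₀, hκ₀, fun A _ _ Y Y' h κ hY heq ⟨H, hH⟩ _ hκ ⟨M, hM⟩ => ?_⟩
    exact ⟨C * H, hb A Y Y' h κ H M hY heq hH hκ hM⟩
  | succ k ih =>
    obtain ⟨κ₁, hκ₁, ih1⟩ := ih hb
    obtain ⟨κ₂, hκ₂, ih2⟩ := ih (b := b + 1) (by omega)
    refine ⟨min κ₁ κ₂, lt_min hκ₁ hκ₂, fun A _ _ Y Y' h κ hY heq hh hκ hκle hM => ?_⟩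
    have hYk : WReg (Ioo 0 R) w k Y := ih1 A Y Y' h κ hY heq hh.of_succ hκ.of_succ
      (fun r hr => (hκle r hr).trans (min_le_left _ _)) hM
    obtain ⟨CY, hCY⟩ := hYk.bounded
    obtain ⟨⟨Ch, hCh⟩, h', h1, h2⟩ := id hh
    obtain ⟨⟨Cκ, hCκ⟩, κ', κ1, κ2⟩ := id hκ
    obtain ⟨hv, hv1, hid, hw⟩ := P.wReg_profile k
    refine ⟨⟨CY, hCY⟩, Y', hY, ?_⟩
    set D : ℝ → ℝ := fun r => b * w r + a * (r ^ 2 * radSlope w r) with hD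
    set D' : ℝ → ℝ := fun r => b * (r * radSlope w r) +
      a * (2 * r * radSlope w r + r ^ 2 * radSlopeDeriv α c w r) with hD'
    have hDd : ∀ r ∈ Ioo 0 R, HasDerivAt D (D' r) r := fun r hr => by
      refine (((P.hasDerivAt hr).const_mul (b : ℝ)).add
        (((hasDerivAt_pow 2 r).mul (P.hasDerivAt_radSlope hr)).const_mul a)).congr_deriv ?_
      simp [hD']
    have hDk : WReg (Ioo 0 R) w k D := (hw.const_smul (b : ℝ)).add
      (((hid.pow 2).smul hv).const_smul a)
    have hD'k : WReg (Ioo 0 R) w k fun r => w r • D' r :=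
      hw.smul (((hid.smul hv).const_smul (b : ℝ)).add
        ((((hid.const_smul 2).smul hv).add ((hid.pow 2).smul hv1)).const_smul a))
    have hwr : ∀ r ∈ Ioo 0 R, w r * r ≠ 0 := fun r hr => (mul_pos (P.w_pos hr) hr.1).ne'
    have hwrY : ∀ r ∈ Ioo 0 R, (w r * r) • Y' r = h r + κ r * Y r - D r • Y r := fun r hr =>
      eq_sub_of_add_eq (heq r hr)
    have hY'eq : ∀ r ∈ Ioo 0 R, Y' r = (w r * r)⁻¹ • (h r + κ r * Y r - D r • Y r) :=
      fun r hr => by rw [← hwrY r hr, inv_smul_smul₀ (hwr r hr)]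
    have hwrd : ∀ r ∈ Ioo 0 R, HasDerivAt (fun r => w r * r) (w r + r * (r * radSlope w r)) r :=
      fun r hr => ((P.hasDerivAt hr).mul (hasDerivAt_id r)).congr_deriv (by simp; ring)
    have hGd : ∀ r ∈ Ioo 0 R, HasDerivAt (fun r => h r + κ r * Y r - D r • Y r)
        (h' r + (κ' r * Y r + κ r * Y' r) - (D' r • Y r + D r • Y' r)) r := fun r hr => by
      refine (((h1 r hr).add ((κ1 r hr).mul (hY r hr))).sub
        ((hDd r hr).smul (hY r hr))).congr_deriv ?_
      rw [add_comm (D r • Y' r)]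
    have hY'd : ∀ r ∈ Ioo 0 R, ∃ y, HasDerivAt Y' y r := fun r hr => by
      refine ⟨_, (((hwrd r hr).inv (hwr r hr)).smul (hGd r hr)).congr_of_eventuallyEq ?_⟩
      filter_upwards [isOpen_Ioo.mem_nhds hr] with x hx using hY'eq x hx
    have hY'diff : ∀ r ∈ Ioo 0 R, HasDerivAt Y' (deriv Y' r) r := fun r hr =>
      (hY'd r hr).elim fun y hy => hy.differentiableAt.hasDerivAt
    have hode2 : ∀ r ∈ Ioo 0 R, (w r + r * (r * radSlope w r)) • Y' r +
        (w r * r) • deriv Y' r =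
        h' r + (κ' r * Y r + κ r * Y' r) - (D' r • Y r + D r • Y' r) := fun r hr => by
      have e1 := (hwrd r hr).smul (hY'diff r hr)
      have e2 := (hGd r hr).congr_of_eventuallyEq (f₁ := fun r => (w r * r) • Y' r) (by
        filter_upwards [isOpen_Ioo.mem_nhds hr] with x hx using hwrY x hx)
      rw [← e1.unique e2, add_comm]
    refine ih2 A (fun r => w r • Y' r) (fun r => w r • deriv Y' r + (r * radSlope w r) • Y' r)
      (fun r => w r • h' r + (w r • κ' r) * Y r - (w r • D' r) • Y r) κ
      (fun r hr => (P.hasDerivAt hr).smul (hY'diff r hr)) (fun r hr => ?_)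
      ((h2.add (κ2.mul hYk)).sub (hD'k.smul hYk)) hκ.of_succ
      (fun r hr => (hκle r hr).trans (min_le_right _ _))
      ⟨Ch + Cκ * CY + (b * 1 + |a| * (R ^ 2 * (c / 3))) * CY, fun r hr => ?_⟩
    · have e := congrArg (fun z => w r • z) (hode2 r hr)
      simp only [smul_add, smul_sub, smul_smul] at e
      simp only [smul_add, smul_smul, smul_mul_assoc, mul_smul_comm, hD] at e ⊢
      push_cast
      linear_combination (norm := module) e
    · have hw0 := P.w_pos hr
      have hw1 := P.w_le_one ⟨hr.1.le, hr.2.le⟩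
      rw [smul_comm, hwrY r hr, norm_smul, Real.norm_of_nonneg hw0.le]
      refine (mul_le_of_le_one_left (norm_nonneg _) hw1).trans ((norm_sub_le _ _).trans
        (add_le_add ((norm_add_le _ _).trans (add_le_add (hCh r hr) ((norm_mul_le _ _).trans
        (mul_le_mul (hCκ r hr) (hCY r hr) (norm_nonneg _)
          ((norm_nonneg _).trans (hCκ r hr)))))) ?_))
      rw [norm_smul]
      refine mul_le_mul ?_ (hCY r hr) (norm_nonneg _)
        (by have := P.c_pos; positivity)
      rw [hD, Real.norm_eq_abs]
      refine (abs_add_le _ _).trans (add_le_add ?_ ?_)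
      · rw [abs_mul, abs_of_pos hw0, Nat.abs_cast]
        exact mul_le_mul_of_nonneg_left hw1 (Nat.cast_nonneg _)
      · rw [abs_mul, abs_mul, abs_of_nonneg (sq_nonneg r)]
        exact mul_le_mul_of_nonneg_left (mul_le_mul (pow_le_pow_left₀ hr.1.le hr.2.le 2)
          (P.abs_radSlope_le hr) (abs_nonneg _) (by positivity)) (abs_nonneg _)

end IsProfile

section BulkDeriv

variable {A : Type*} [NormedCommRing A] [NormedAlgebra ℝ A]

/-- The coefficient of the derivative of the slope in the derivative of `bulk` along a curve. -/
noncomputable def bulkCoef (γ : ℝ) (b r₂ q : A) (x : A × A × A) : A :=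
  r₂ * (powSeries (binomCoeff (2 * γ - 4)) x.1 *
      powSeries (derivSeries (binomCoeff (γ + 1))) (x.1 + r₂ * x.2.2) *
      ((1 + x.1) ^ 2 * x.2.1 + b) - (1 + γ) • b)
    - (4 * γ) • (q * x.2.2 * powSeries (binomCoeff (-1)) x.1)

/-- The terms without the derivative of the slope in the derivative of `bulk` along a curve. -/
noncomputable def bulkRest (γ : ℝ) (b r₂ q b' r₂' q' : A) (x : A × A × A) (a' τ' : A) : A :=
  powSeries (derivSeries (binomCoeff (2 * γ - 4))) x.1 * a' *
      powSeries (binomCoeff (γ + 1)) (x.1 + r₂ * x.2.2) * ((1 + x.1) ^ 2 * x.2.1 + b)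
    + powSeries (binomCoeff (2 * γ - 4)) x.1 *
      (powSeries (derivSeries (binomCoeff (γ + 1))) (x.1 + r₂ * x.2.2) * (a' + r₂' * x.2.2)) *
      ((1 + x.1) ^ 2 * x.2.1 + b)
    + powSeries (binomCoeff (2 * γ - 4)) x.1 * powSeries (binomCoeff (γ + 1)) (x.1 + r₂ * x.2.2) *
      ((2 : ℝ) • ((1 + x.1) * a') * x.2.1 + (1 + x.1) ^ 2 * τ' + b')
    - b' * (1 + x.1 + r₂ * x.2.2) - b * (a' + r₂' * x.2.2)
    - (2 * γ) • (q' * x.2.2 ^ 2 * powSeries (binomCoeff (-1)) x.1 +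
        q * x.2.2 ^ 2 * (powSeries (derivSeries (binomCoeff (-1))) x.1 * a'))
    - γ • (b' * (r₂ * x.2.2) + b * (r₂' * x.2.2))

lemma hasDerivAt_bulk [CompleteSpace A] (γ : ℝ) {b r₂ q a τ y : ℝ → A}
    {b' r₂' q' a' τ' y' : A} {r : ℝ} (hb : HasDerivAt b b' r) (hr₂ : HasDerivAt r₂ r₂' r)
    (hq : HasDerivAt q q' r) (ha : HasDerivAt a a' r) (hτ : HasDerivAt τ τ' r)
    (hy : HasDerivAt y y' r) (h1 : ‖a r‖ < 1) (h2 : ‖a r + r₂ r * y r‖ < 1) :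
    HasDerivAt (fun r => bulk γ (b r) (r₂ r) (q r) (a r, τ r, y r))
      (bulkRest γ (b r) (r₂ r) (q r) b' r₂' q' (a r, τ r, y r) a' τ' +
        bulkCoef γ (b r) (r₂ r) (q r) (a r, τ r, y r) * y') r := by
  have p1 := (unitDiscSeries_binomCoeff (2 * γ - 4)).hasDerivAt_comp ha h1
  have dJ := ha.add (hr₂.mul hy)
  have p2 := (unitDiscSeries_binomCoeff (γ + 1)).hasDerivAt_comp dJ h2
  have p3 := (unitDiscSeries_binomCoeff (-1)).hasDerivAt_comp ha h1
  have e1 := (p1.mul p2).mul ((((ha.const_add 1).pow 2).mul hτ).add hb)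
  have e2 := hb.mul ((ha.const_add 1).add (hr₂.mul hy))
  have e3 := ((hq.mul (hy.pow 2)).mul p3).const_smul (2 * γ)
  have e4 := (hb.mul (hr₂.mul hy)).const_smul γ
  have n2 : algebraMap ℝ A 2 = 2 := map_ofNat _ 2
  have n4 : algebraMap ℝ A 4 = 4 := map_ofNat _ 4
  refine (((e1.sub e2).sub e3).sub e4).congr_deriv ?_
  simp [bulkRest, bulkCoef, Algebra.smul_def, n2, n4]
  ring

variable {s : Set ℝ} {w : ℝ → ℝ} {k : ℕ} {b r₂ q a τ y : ℝ → A} {ρ : ℝ}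

lemma WReg.bulk [CompleteSpace A] (γ : ℝ) (hρ : ρ < 1) (h1 : ∀ r ∈ s, ‖a r‖ ≤ ρ)
    (h2 : ∀ r ∈ s, ‖a r + r₂ r * y r‖ ≤ ρ) (hb : WReg s w k b) (hr₂ : WReg s w k r₂)
    (hq : WReg s w k q) (ha : WReg s w k a) (hτ : WReg s w k τ) (hy : WReg s w k y) :
    WReg s w k fun r => LaneEmden.bulk γ (b r) (r₂ r) (q r) (a r, τ r, y r) := by
  have hJ := ha.add (hr₂.mul hy)
  have hX : WReg s w k fun r => 1 + a r := (WReg.const 1).add ha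
  have p1 := ha.powSeries (unitDiscSeries_binomCoeff (2 * γ - 4)) hρ h1
  have p2 := hJ.powSeries (unitDiscSeries_binomCoeff (γ + 1)) hρ h2
  have p3 := ha.powSeries (unitDiscSeries_binomCoeff (-1)) hρ h1
  exact ((((p1.mul p2).mul (((hX.pow 2).mul hτ).add hb)).sub (hb.mul (hX.add (hr₂.mul hy)))).sub
    (((hq.mul (hy.pow 2)).mul p3).const_smul (2 * γ))).sub ((hb.mul (hr₂.mul hy)).const_smul γ)

lemma WReg.bulkCoef [CompleteSpace A] (γ : ℝ) (hρ : ρ < 1) (h1 : ∀ r ∈ s, ‖a r‖ ≤ ρ)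
    (h2 : ∀ r ∈ s, ‖a r + r₂ r * y r‖ ≤ ρ) (hb : WReg s w k b) (hr₂ : WReg s w k r₂)
    (hq : WReg s w k q) (ha : WReg s w k a) (hτ : WReg s w k τ) (hy : WReg s w k y) :
    WReg s w k fun r => LaneEmden.bulkCoef γ (b r) (r₂ r) (q r) (a r, τ r, y r) := by
  have hJ := ha.add (hr₂.mul hy)
  have hX : WReg s w k fun r => 1 + a r := (WReg.const 1).add ha
  have p1 := ha.powSeries (unitDiscSeries_binomCoeff (2 * γ - 4)) hρ h1
  have p2 := hJ.powSeries (unitDiscSeries_binomCoeff (γ + 1)).deriv hρ h2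
  have p3 := ha.powSeries (unitDiscSeries_binomCoeff (-1)) hρ h1
  exact (hr₂.mul (((p1.mul p2).mul (((hX.pow 2).mul hτ).add hb)).sub
    (hb.const_smul (1 + γ)))).sub (((hq.mul hy).mul p3).const_smul (4 * γ))

lemma WReg.bulkRest [CompleteSpace A] (γ : ℝ) {b' r₂' q' a' τ' : ℝ → A} (hρ : ρ < 1)
    (h1 : ∀ r ∈ s, ‖a r‖ ≤ ρ) (h2 : ∀ r ∈ s, ‖a r + r₂ r * y r‖ ≤ ρ) (hb : WReg s w k b)
    (hr₂ : WReg s w k r₂) (hq : WReg s w k q) (hb' : WReg s w k b') (hr₂' : WReg s w k r₂')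
    (hq' : WReg s w k q') (ha : WReg s w k a) (hτ : WReg s w k τ) (hy : WReg s w k y)
    (ha' : WReg s w k a') (hτ' : WReg s w k τ') :
    WReg s w k fun r => LaneEmden.bulkRest γ (b r) (r₂ r) (q r) (b' r) (r₂' r) (q' r)
      (a r, τ r, y r) (a' r) (τ' r) := by
  have hJ := ha.add (hr₂.mul hy)
  have hJ' := ha'.add (hr₂'.mul hy)
  have hX : WReg s w k fun r => 1 + a r := (WReg.const 1).add ha
  have p1 := ha.powSeries (unitDiscSeries_binomCoeff (2 * γ - 4)) hρ h1
  have p1' := ha.powSeries (unitDiscSeries_binomCoeff (2 * γ - 4)).deriv hρ h1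
  have p2 := hJ.powSeries (unitDiscSeries_binomCoeff (γ + 1)) hρ h2
  have p2' := hJ.powSeries (unitDiscSeries_binomCoeff (γ + 1)).deriv hρ h2
  have p3 := ha.powSeries (unitDiscSeries_binomCoeff (-1)) hρ h1
  have p3' := ha.powSeries (unitDiscSeries_binomCoeff (-1)).deriv hρ h1
  have hT := ((hX.pow 2).mul hτ).add hb
  exact (((((((p1'.mul ha').mul p2).mul hT).add ((p1.mul (p2'.mul hJ')).mul hT)).add
    ((p1.mul p2).mul (((((hX.mul ha').const_smul 2).mul hτ).add ((hX.pow 2).mul hτ')).add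
      hb'))).sub (hb'.mul (hX.add (hr₂.mul hy)))).sub (hb.mul hJ')).sub
    ((((hq'.mul (hy.pow 2)).mul p3).add ((hq.mul (hy.pow 2)).mul (p3'.mul ha'))).const_smul
      (2 * γ)) |>.sub (((hb'.mul (hr₂.mul hy)).add (hb.mul (hr₂'.mul hy))).const_smul γ)

variable (A) in
/-- The coefficient `bulkCoef` is small for small perturbations. -/
lemma exists_norm_bulkCoef_le [CompleteSpace A] (γ B : ℝ) {ε : ℝ} (hε : 0 < ε) :
    ∃ η > 0, ∀ (β ω χ : ℝ) (x : A × A × A), |β| ≤ B → |ω| ≤ B → |χ| ≤ B → ‖x‖ ≤ η →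
      ‖bulkCoef γ (algebraMap ℝ A β) (algebraMap ℝ A ω) (algebraMap ℝ A χ) x‖ ≤ ε := by
  set f₁ : A × A → A := fun z => powSeries (binomCoeff (2 * γ - 4)) z.1 *
    powSeries (derivSeries (binomCoeff (γ + 1))) z.2 with hf₁
  set f : (A × A × A) × A → A × A × A := fun z => (f₁ (z.1.1, z.2) - (1 + γ) • 1,
    f₁ (z.1.1, z.2) * ((1 + z.1.1) ^ 2 * z.1.2.1), z.1.2.2 * powSeries (binomCoeff (-1)) z.1.1)
    with hf
  have hpow : ∀ {d : ℕ → ℝ}, UnitDiscSeries d → ContinuousAt (powSeries d) (0 : A) := fun hd =>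
    (hd.hasStrictFDerivAt (x := (0 : A)) (by simp)).continuousAt
  have hcomp : ∀ {d : ℕ → ℝ}, UnitDiscSeries d → ∀ g : (A × A × A) × A → A, Continuous g →
      g 0 = 0 → ContinuousAt (fun z => powSeries d (g z)) 0 := fun hd g hg h0 =>
    ContinuousAt.comp (g := powSeries _) (by rw [h0]; exact hpow hd) hg.continuousAt
  have c1 := hcomp (unitDiscSeries_binomCoeff (2 * γ - 4)) (fun z => z.1.1) (by fun_prop) rfl
  have c2 := hcomp (unitDiscSeries_binomCoeff (γ + 1)).deriv (fun z => z.2) (by fun_prop) rfl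
  have c3 := hcomp (unitDiscSeries_binomCoeff (-1)) (fun z => z.1.1) (by fun_prop) rfl
  have hcont : ContinuousAt f 0 :=
    ((c1.mul c2).sub continuousAt_const).prodMk (((c1.mul c2).mul
      (Continuous.continuousAt (by fun_prop : Continuous fun z : (A × A × A) × A =>
        (1 + z.1.1) ^ 2 * z.1.2.1))).prodMk ((Continuous.continuousAt (by fun_prop)).mul c3))
  have hf0 : f 0 = 0 := by
    simp [hf, hf₁, powSeries_zero, binomCoeff_zero, derivSeries_binomCoeff_zero,
      Algebra.smul_def, add_comm]
  set M := |B| * (|B| + 1 + ‖4 * γ‖) + 1 with hM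
  have hM0 : 0 < M := by positivity
  obtain ⟨η, hη, hη'⟩ := Metric.continuousAt_iff.1 hcont (ε / M) (by positivity)
  refine ⟨η / (2 * (|B| + 1)), by positivity, fun β ω χ x hβ hω hχ hx => ?_⟩
  have hB : 0 ≤ |B| := abs_nonneg _
  have hle : ∀ t : ℝ, |t| ≤ B → |t| ≤ |B| := fun t ht => ht.trans (le_abs_self _)
  have hx1 : ‖x‖ < η := hx.trans_lt ((div_lt_iff₀ (by positivity)).2 (by nlinarith))
  have hJ : ‖x.1 + algebraMap ℝ A ω * x.2.2‖ < η := by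
    rw [← Algebra.smul_def]
    have hx22 : ‖x.2.2‖ ≤ ‖x‖ := (norm_snd_le x.2).trans (norm_snd_le x)
    have h2 : ‖ω • x.2.2‖ ≤ |B| * ‖x‖ := by
      rw [norm_smul]
      exact mul_le_mul (hle _ hω) hx22 (norm_nonneg _) hB
    have h3 : (|B| + 1) * ‖x‖ ≤ η / 2 := by
      have := mul_le_mul_of_nonneg_left hx (by positivity : 0 ≤ |B| + 1)
      refine this.trans_eq ?_
      field_simp
    have := norm_add_le x.1 (ω • x.2.2)
    have := norm_fst_le x
    linarith
  have hfx := hη' (x := (x, x.1 + algebraMap ℝ A ω * x.2.2)) (by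
    rw [dist_zero_right, Prod.norm_def]; exact max_lt hx1 hJ)
  rw [hf0, dist_zero_right] at hfx
  set F := f (x, x.1 + algebraMap ℝ A ω * x.2.2) with hF
  have hF1 : ‖F.1‖ ≤ ε / M := (norm_fst_le F).trans hfx.le
  have hF2 : ‖F.2.1‖ ≤ ε / M := ((norm_fst_le F.2).trans (norm_snd_le F)).trans hfx.le
  have hF3 : ‖F.2.2‖ ≤ ε / M := ((norm_snd_le F.2).trans (norm_snd_le F)).trans hfx.le
  have heq : bulkCoef γ (algebraMap ℝ A β) (algebraMap ℝ A ω) (algebraMap ℝ A χ) x =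
      ω • (β • F.1 + F.2.1) - (4 * γ) • χ • F.2.2 := by
    simp only [bulkCoef, hF, hf, hf₁, Algebra.smul_def, mul_one, map_mul]
    ring
  rw [heq]
  have e0 : 0 ≤ ε / M := by positivity
  have n1 : ‖ω • (β • F.1 + F.2.1)‖ ≤ |B| * (|B| * (ε / M) + ε / M) := by
    rw [norm_smul]
    refine mul_le_mul (hle _ hω) ((norm_add_le _ _).trans (add_le_add ?_ hF2)) (norm_nonneg _) hB
    rw [norm_smul]
    exact mul_le_mul (hle _ hβ) hF1 (norm_nonneg _) hB
  have n2 : ‖(4 * γ) • χ • F.2.2‖ ≤ ‖4 * γ‖ * (|B| * (ε / M)) := by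
    rw [norm_smul, norm_smul]
    exact mul_le_mul_of_nonneg_left (mul_le_mul (hle _ hχ) hF3 (norm_nonneg _) hB) (norm_nonneg _)
  refine (norm_sub_le _ _).trans ((add_le_add n1 n2).trans ?_)
  have : |B| * (|B| * (ε / M) + ε / M) + ‖4 * γ‖ * (|B| * (ε / M)) = (M - 1) * (ε / M) := by
    rw [hM]; ring
  rw [this, sub_mul, mul_div_cancel₀ _ hM0.ne']
  linarith

end BulkDeriv

namespace RadFun

variable {R : ℝ}

/-- Evaluation at an interior radius. -/
noncomputable def evalHom (r : Ioo (0 : ℝ) R) : RadFun R →ₐ[ℝ] ℝ where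
  toFun f := f r
  map_one' := rfl
  map_mul' _ _ := rfl
  map_zero' := rfl
  map_add' _ _ := rfl
  commutes' _ := rfl

lemma abs_evalHom_le (r : Ioo (0 : ℝ) R) (f : RadFun R) : ‖evalHom r f‖ ≤ ‖f‖ :=
  f.norm_coe_le_norm r

/-- The value at a radius of a power series of radial functions. -/
noncomputable def slice (f : Wiener (RadFun R)) (r : ℝ) : Wiener ℝ :=
  open Classical in
    if h : r ∈ Ioo 0 R then Wiener.map (evalHom ⟨r, h⟩) (abs_evalHom_le _) f else 0

lemma slice_apply (f : Wiener (RadFun R)) {r : ℝ} (hr : r ∈ Ioo 0 R) :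
    slice f r = Wiener.map (evalHom ⟨r, hr⟩) (abs_evalHom_le _) f := dif_pos hr

lemma coeff_slice (f : Wiener (RadFun R)) (n : ℕ) (r : ℝ) :
    Wiener.coeff n (slice f r) = ext (Wiener.coeff n f) r := by
  by_cases hr : r ∈ Ioo 0 R
  · rw [slice_apply f hr, Wiener.coeff_map, ext_apply _ hr]; rfl
  · rw [slice, dif_neg hr, map_zero, ext_of_notMem _ hr]

lemma norm_slice_le (f : Wiener (RadFun R)) (r : ℝ) : ‖slice f r‖ ≤ ‖f‖ := by
  by_cases hr : r ∈ Ioo 0 R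
  · rw [slice_apply f hr]; exact Wiener.norm_map_le _ _ _
  · rw [slice, dif_neg hr, norm_zero]; exact norm_nonneg _

end RadFun

/-- The right-hand side of the slope equation along a family of power series. -/
noncomputable def bulkAt (α : ℝ) (w : ℝ → ℝ) (a τ y : ℝ → Wiener ℝ) (r : ℝ) : Wiener ℝ :=
  bulk ((1 + α) / α) (algebraMap ℝ _ (-(1 + α) * radSlope w r)) (algebraMap ℝ _ (r ^ 2))
    (algebraMap ℝ _ (w r * r ^ 2)) (a r, τ r, y r)

/-- The derivative of the slope along a family of power series. -/
noncomputable def slopeDeriv (α : ℝ) (w : ℝ → ℝ) (a τ y : ℝ → Wiener ℝ) (r : ℝ) : Wiener ℝ :=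
  (w r * r)⁻¹ • ((α / (1 + α)) • bulkAt α w a τ y r -
    (5 * w r + (1 + α) * (r ^ 2 * radSlope w r)) • y r)

/-- Families of power series in the growing mode, indexed by the radius, which solve the radial
equations. -/
structure IsRadialSeries (α R : ℝ) (w : ℝ → ℝ) (μ κ : ℝ) (a τ y : ℝ → Wiener ℝ) : Prop where
  norm_a : ∀ r ∈ Ioo 0 R, ‖a r‖ ≤ κ
  norm_τ : ∀ r ∈ Ioo 0 R, ‖τ r‖ ≤ κ
  norm_y : ∀ r ∈ Ioo 0 R, ‖y r‖ ≤ κ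
  coeff_zero_a : ∀ r ∈ Ioo 0 R, Wiener.coeff 0 (a r) = 0
  coeff_zero_y : ∀ r ∈ Ioo 0 R, Wiener.coeff 0 (y r) = 0
  coeff_τ : ∀ r ∈ Ioo 0 R, ∀ n, Wiener.coeff n (τ r) = (n : ℝ) ^ 2 * μ * Wiener.coeff n (a r)
  hasDerivAt_a : ∀ r ∈ Ioo 0 R, HasDerivAt a (r • y r) r
  hasDerivAt_y : ∀ r ∈ Ioo 0 R, HasDerivAt y (slopeDeriv α w a τ y r) r

namespace IsProfile

variable {α c R : ℝ} {w : ℝ → ℝ} (P : IsProfile α c R w)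

include P

open RadFun in
lemma slice_bulkSeries {x : Wiener (RadFun R) × Wiener (RadFun R) × Wiener (RadFun R)}
    (h1 : ‖x.1‖ < 1) (h2 : ‖x.1 + Wiener.const (radius R * radius R) * x.2.2‖ < 1) {r : ℝ}
    (hr : r ∈ Ioo 0 R) :
    slice (P.bulkSeries x) r = bulkAt α w (slice x.1) (slice x.2.1) (slice x.2.2) r := by
  have hc : ∀ f : RadFun R, Wiener.map (evalHom ⟨r, hr⟩) (abs_evalHom_le _) (Wiener.const f) =
      algebraMap ℝ (Wiener ℝ) (ext f r) := fun f => by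
    refine Wiener.ext fun n => ?_
    rw [Wiener.coeff_map, Wiener.coeff_const, Algebra.algebraMap_eq_smul_one, map_smul,
      Wiener.coeff_one, ext_apply _ hr]
    split_ifs
    · rw [smul_eq_mul, mul_one]; rfl
    · rw [smul_zero, map_zero]
  have hcont : Continuous (Wiener.map (evalHom ⟨r, hr⟩) (abs_evalHom_le _)) :=
    AddMonoidHomClass.continuous_of_bound _ 1 fun f => by
      rw [one_mul]; exact Wiener.norm_map_le _ _ _
  rw [slice_apply _ hr, bulkSeries, map_bulk _ hcont _ _ _ _ _ h1 h2, hc, hc, hc,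
    P.ext_gravity hr, ext_mul, ext_radius hr, P.ext_radEnthalpy hr, ← pow_two, bulkAt,
    slice_apply _ hr, slice_apply _ hr, slice_apply _ hr]

open RadFun in
theorem exists_isRadialSeries {μ : ℝ} (hμ : 0 < μ) (hμ0 : ¬ P.IsRegular μ)
    (hreg : ∀ s, μ < s → P.IsRegular s) {κ : ℝ} (hκ : 0 < κ) (hκ1 : κ * (1 + R ^ 2) ≤ 1 / 2) :
    ∃ a τ y : ℝ → Wiener ℝ, IsRadialSeries α R w μ κ a τ y ∧
      ∃ r ∈ Ioo 0 R, Wiener.coeff 1 (a r) ≠ 0 := by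
  obtain ⟨x, hx, hx0, hx0', hx1, hτ, ha, hy⟩ := P.exists_series hμ hμ0 hreg hκ
  have hR := P.R_pos
  have n1 : ‖x.1‖ ≤ κ := (norm_fst_le x).trans hx
  have n2 : ‖x.2.1‖ ≤ κ := ((norm_fst_le x.2).trans (norm_snd_le x)).trans hx
  have n3 : ‖x.2.2‖ ≤ κ := ((norm_snd_le x.2).trans (norm_snd_le x)).trans hx
  have hκ2 : κ < 1 := by nlinarith [sq_nonneg R]
  have hrad : ‖radius R * radius R‖ ≤ R ^ 2 := norm_le (sq_nonneg R) fun r hr => by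
    rw [ext_mul, ext_radius hr, abs_of_nonneg (by nlinarith [hr.1])]
    nlinarith [hr.1, hr.2]
  have h2 : ‖x.1 + Wiener.const (radius R * radius R) * x.2.2‖ < 1 := by
    have e1 : ‖Wiener.const (radius R * radius R) * x.2.2‖ ≤ R ^ 2 * κ :=
      (norm_mul_le _ _).trans (mul_le_mul (by rwa [Wiener.norm_const]) n3 (norm_nonneg _)
        (sq_nonneg R))
    have := norm_add_le x.1 (Wiener.const (radius R * radius R) * x.2.2)
    nlinarith
  have hbulk : ∀ n, ∀ r ∈ Ioo 0 R, Wiener.coeff n (bulkAt α w (slice x.1) (slice x.2.1)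
      (slice x.2.2) r) = ext (Wiener.coeff n (P.bulkSeries x)) r := fun n r hr => by
    rw [← P.slice_bulkSeries (n1.trans_lt hκ2) h2 hr, coeff_slice]
  have hsd : ∀ n, ∀ r ∈ Ioo 0 R, Wiener.coeff n (slopeDeriv α w (slice x.1) (slice x.2.1)
      (slice x.2.2) r) = (α / (1 + α) * ext (Wiener.coeff n (P.bulkSeries x)) r -
          (5 * w r + (1 + α) * (r ^ 2 * radSlope w r)) * ext (Wiener.coeff n x.2.2) r) /
          (w r * r) := fun n r hr => by
    rw [slopeDeriv, map_smul, map_sub, map_smul, map_smul, hbulk n r hr, coeff_slice,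
      smul_eq_mul, smul_eq_mul, smul_eq_mul, div_eq_inv_mul _ (w r * r)]
  refine ⟨slice x.1, slice x.2.1, slice x.2.2, ⟨fun r _ => (norm_slice_le _ r).trans n1,
    fun r _ => (norm_slice_le _ r).trans n2, fun r _ => (norm_slice_le _ r).trans n3,
    fun r _ => by rw [coeff_slice, hx0, ext_zero], fun r _ => by rw [coeff_slice, hx0', ext_zero],
    fun r _ n => by rw [coeff_slice, coeff_slice, hτ, ext_smul], fun r hr => ?_, fun r hr => ?_⟩,
    ?_⟩
  · refine Wiener.hasDerivAt_of_coeff isOpen_Ioo isPreconnected_Ioo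
      (f' := fun r => r • slice x.2.2 r) (x.2.2.summable_norm_coeff.mul_left R)
      (fun n r hr => ?_) (fun n r hr => ?_) hr
    · simp only [map_smul, coeff_slice, smul_eq_mul]
      exact ha n r hr
    · rw [map_smul, coeff_slice, norm_smul, Real.norm_of_nonneg hr.1.le]
      exact mul_le_mul hr.2.le (abs_ext_le _ r) (norm_nonneg _) hR.le
  · obtain ⟨r₁, h11, h12⟩ := exists_between hr.1
    obtain ⟨r₂, h21, h22⟩ := exists_between hr.2
    have hr₂ : r₂ ∈ Ioo 0 R := ⟨hr.1.trans h21, h22⟩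
    have hsub : Ioo r₁ r₂ ⊆ Ioo 0 R := Ioo_subset_Ioo h11.le h22.le
    have hm : 0 < w r₂ * r₁ := mul_pos (P.w_pos hr₂) h11
    have hα := P.α_pos
    have hc := P.c_pos
    refine Wiener.hasDerivAt_of_coeff isOpen_Ioo isPreconnected_Ioo
      (f' := slopeDeriv α w (slice x.1) (slice x.2.1) (slice x.2.2))
      ((((P.bulkSeries x).summable_norm_coeff.mul_left (α / (1 + α))).add
        (x.2.2.summable_norm_coeff.mul_left (5 + (1 + α) * (R ^ 2 * (c / 3))))).div_const
        (w r₂ * r₁))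
      (fun n r hr => ?_) (fun n r hr => ?_) ⟨h12, h21⟩
    · simp only [coeff_slice]
      rw [hsd n r (hsub hr)]
      exact hy n r (hsub hr)
    · have hr' := hsub hr
      have hw0 := P.w_pos hr'
      rw [hsd n r hr', norm_div, Real.norm_of_nonneg (mul_pos hw0 hr'.1).le]
      have hle : w r₂ * r₁ ≤ w r * r :=
        mul_le_mul (P.strictAntiOn.antitoneOn ⟨hr'.1.le, hr'.2.le⟩ ⟨hr₂.1.le, hr₂.2.le⟩ hr.2.le)
          hr.1.le h11.le hw0.le
      refine div_le_div₀ (by positivity) ?_ hm hle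
      refine (norm_sub_le _ _).trans (add_le_add ?_ ?_)
      · rw [norm_mul, Real.norm_of_nonneg (by positivity)]
        exact mul_le_mul_of_nonneg_left (abs_ext_le _ r) (by positivity)
      · rw [norm_mul]
        refine mul_le_mul ?_ (abs_ext_le _ r) (norm_nonneg _) (by positivity)
        rw [Real.norm_eq_abs]
        refine (abs_add_le _ _).trans (add_le_add ?_ ?_)
        · rw [abs_of_nonneg (by positivity)]
          have := P.w_le_one ⟨hr'.1.le, hr'.2.le⟩
          linarith
        · rw [abs_mul, abs_mul, abs_of_nonneg (sq_nonneg r), abs_of_nonneg (by positivity)]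
          exact mul_le_mul_of_nonneg_left (mul_le_mul (pow_le_pow_left₀ hr'.1.le hr'.2.le 2)
            (P.abs_radSlope_le hr') (abs_nonneg _) (by positivity)) (by positivity)
  · by_contra! h
    refine hx1 (eq_of_ext fun r hr => ?_)
    rw [ext_zero, ← coeff_slice]
    exact h r hr

end IsProfile

namespace IsRadialSeries

variable {α R μ κ : ℝ} {w : ℝ → ℝ} {a τ y : ℝ → Wiener ℝ}

lemma norm_a_add_le (S : IsRadialSeries α R w μ κ a τ y) (hκ1 : κ * (1 + R ^ 2) ≤ 1 / 2) {r : ℝ}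
    (hr : r ∈ Ioo 0 R) : ‖a r + algebraMap ℝ _ (r ^ 2) * y r‖ ≤ 1 / 2 := by
  have h1 := S.norm_a r hr
  have h2 := S.norm_y r hr
  have h3 := norm_add_le (a r) (algebraMap ℝ _ (r ^ 2) * y r)
  rw [← Algebra.smul_def, norm_smul, Real.norm_of_nonneg (sq_nonneg r)] at h3
  have h4 : r ^ 2 ≤ R ^ 2 := pow_le_pow_left₀ hr.1.le hr.2.le 2
  have h5 : r ^ 2 * ‖y r‖ ≤ R ^ 2 * κ := mul_le_mul h4 h2 (norm_nonneg _) (sq_nonneg R)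
  rw [← Algebra.smul_def]
  linarith

lemma norm_a_le_half (S : IsRadialSeries α R w μ κ a τ y) (hκ1 : κ * (1 + R ^ 2) ≤ 1 / 2) {r : ℝ}
    (hr : r ∈ Ioo 0 R) : ‖a r‖ ≤ 1 / 2 := by
  have h1 := S.norm_a r hr
  have h0 := (norm_nonneg _).trans h1
  nlinarith [mul_nonneg h0 (sq_nonneg R)]

lemma dilate_bulkAt (S : IsRadialSeries α R w μ κ a τ y) (hκ1 : κ * (1 + R ^ 2) ≤ 1 / 2) {ρ : ℝ}
    (hρ : |ρ| ≤ 1) {r : ℝ} (hr : r ∈ Ioo 0 R) : Wiener.dilate ρ hρ (bulkAt α w a τ y r) =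
      bulkAt α w (fun r => Wiener.dilate ρ hρ (a r)) (fun r => Wiener.dilate ρ hρ (τ r))
        (fun r => Wiener.dilate ρ hρ (y r)) r := by
  have hcont : Continuous (Wiener.dilate (E := ℝ) ρ hρ) :=
    AddMonoidHomClass.continuous_of_bound _ 1 fun f => by
      rw [one_mul]; exact Wiener.norm_dilate_le _ _ _
  have h1 := S.norm_a_le_half hκ1 hr
  have h2 := S.norm_a_add_le hκ1 hr
  simp only [bulkAt]
  rw [map_bulk _ hcont _ _ _ _ _ (by dsimp only; linarith) (by dsimp only; linarith),
    AlgHom.commutes, AlgHom.commutes, AlgHom.commutes]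

lemma dilate_slopeDeriv (S : IsRadialSeries α R w μ κ a τ y) (hκ1 : κ * (1 + R ^ 2) ≤ 1 / 2)
    {ρ : ℝ} (hρ : |ρ| ≤ 1) {r : ℝ} (hr : r ∈ Ioo 0 R) :
    Wiener.dilate ρ hρ (slopeDeriv α w a τ y r) =
      slopeDeriv α w (fun r => Wiener.dilate ρ hρ (a r)) (fun r => Wiener.dilate ρ hρ (τ r))
        (fun r => Wiener.dilate ρ hρ (y r)) r := by
  rw [slopeDeriv, map_smul, map_sub, map_smul, map_smul, S.dilate_bulkAt hκ1 hρ hr, slopeDeriv]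

lemma dilate (S : IsRadialSeries α R w μ κ a τ y) (hκ1 : κ * (1 + R ^ 2) ≤ 1 / 2) {ρ : ℝ}
    (hρ : |ρ| ≤ 1) : IsRadialSeries α R w μ κ (fun r => Wiener.dilate ρ hρ (a r))
      (fun r => Wiener.dilate ρ hρ (τ r)) (fun r => Wiener.dilate ρ hρ (y r)) := by
  set L : Wiener ℝ →L[ℝ] Wiener ℝ := (Wiener.dilate ρ hρ).toLinearMap.mkContinuous 1 fun f => by
    rw [one_mul]; exact Wiener.norm_dilate_le ρ hρ f with hL
  have hLd : ∀ {f : ℝ → Wiener ℝ} {f' : Wiener ℝ} {r : ℝ}, HasDerivAt f f' r →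
      HasDerivAt (fun r => Wiener.dilate ρ hρ (f r)) (Wiener.dilate ρ hρ f') r := fun h =>
    L.hasFDerivAt.comp_hasDerivAt _ h
  refine ⟨fun r hr => (Wiener.norm_dilate_le _ _ _).trans (S.norm_a r hr),
    fun r hr => (Wiener.norm_dilate_le _ _ _).trans (S.norm_τ r hr),
    fun r hr => (Wiener.norm_dilate_le _ _ _).trans (S.norm_y r hr), fun r hr => ?_,
    fun r hr => ?_, fun r hr n => ?_, fun r hr => ?_, fun r hr => ?_⟩
  · rw [Wiener.coeff_dilate, S.coeff_zero_a r hr, smul_zero]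
  · rw [Wiener.coeff_dilate, S.coeff_zero_y r hr, smul_zero]
  · rw [Wiener.coeff_dilate, Wiener.coeff_dilate, S.coeff_τ r hr, smul_eq_mul, smul_eq_mul]
    ring
  · have := hLd (S.hasDerivAt_a r hr)
    rwa [map_smul] at this
  · rw [← S.dilate_slopeDeriv hκ1 hρ hr]
    exact hLd (S.hasDerivAt_y r hr)

end IsRadialSeries

lemma exists_sq_mul_pow_le {x : ℝ} (h0 : 0 ≤ x) (h1 : x < 1) (μ : ℝ) :
    ∃ C, ∀ n : ℕ, ‖(n : ℝ) ^ 2 * μ * x ^ n‖ ≤ C := by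
  have hs := (summable_pow_mul_geometric_of_norm_lt_one (R := ℝ) 2
    (r := x) (by rwa [Real.norm_of_nonneg h0])).mul_left μ
  obtain ⟨C, hC⟩ := hs.tendsto_atTop_zero.norm.bddAbove_range
  exact ⟨C, fun n => (le_of_eq (by ring_nf)).trans (hC ⟨n, rfl⟩)⟩

namespace IsRadialSeries

variable {α R μ κ : ℝ} {w : ℝ → ℝ} {a τ y : ℝ → Wiener ℝ}

lemma exists_dilate_τ_eq (S : IsRadialSeries α R w μ κ a τ y) {ρ ρ' : ℝ} (hρ : |ρ| ≤ 1)
    (hρ' : |ρ'| ≤ 1) (h0 : 0 < ρ) (h1 : ρ < ρ') : ∃ L : Wiener ℝ →L[ℝ] Wiener ℝ,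
      ∀ r ∈ Ioo 0 R, Wiener.dilate ρ hρ (τ r) = L (Wiener.dilate ρ' hρ' (a r)) := by
  have h2 : 0 < ρ' := h0.trans h1
  obtain ⟨C, hC⟩ := exists_sq_mul_pow_le (x := ρ / ρ') (by positivity)
    ((div_lt_one h2).2 h1) μ
  refine ⟨Wiener.multiplier (fun n => ((n : ℝ) ^ 2 * μ * (ρ / ρ') ^ n) •
    ContinuousLinearMap.id ℝ ℝ) C fun n => ?_, fun r hr => Wiener.ext fun n => ?_⟩
  · rw [norm_smul, ContinuousLinearMap.norm_id, mul_one]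
    exact hC n
  · rw [Wiener.coeff_dilate, S.coeff_τ r hr, Wiener.coeff_multiplier, Wiener.coeff_dilate]
    have := h2.ne'
    simp only [smul_apply, ContinuousLinearMap.id_apply, smul_eq_mul, div_pow]
    field_simp

lemma wReg_a (S : IsRadialSeries α R w μ κ a τ y) {s : Set ℝ} (hs : s ⊆ Ioo 0 R) {k : ℕ}
    (hw : WReg s w k w) (hid : WReg s w k fun r => r) (hy : WReg s w k y) :
    WReg s w (k + 1) a :=
  ⟨⟨κ, fun r hr => S.norm_a r (hs hr)⟩, fun r => r • y r, fun r hr => S.hasDerivAt_a r (hs hr),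
    hw.smul (hid.smul hy)⟩

lemma wReg_bulkAt (S : IsRadialSeries α R w μ κ a τ y) (hκ1 : κ * (1 + R ^ 2) ≤ 1 / 2)
    {s : Set ℝ} (hs : s ⊆ Ioo 0 R) {k : ℕ} (hw : WReg s w k w) (hid : WReg s w k fun r => r)
    (hv : WReg s w k (radSlope w)) (ha : WReg s w k a) (hτ : WReg s w k τ) (hy : WReg s w k y) :
    WReg s w k (bulkAt α w a τ y) :=
  WReg.bulk ((1 + α) / α) (ρ := 1 / 2) (by norm_num) (fun r hr => S.norm_a_le_half hκ1 (hs hr))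
    (fun r hr => S.norm_a_add_le hκ1 (hs hr)) (WReg.algebraMap (hv.const_smul (-(1 + α))))
    (WReg.algebraMap (hid.pow 2)) (WReg.algebraMap (hw.mul (hid.pow 2))) ha hτ hy

lemma wReg_y_succ (S : IsRadialSeries α R w μ κ a τ y) {s : Set ℝ} (hs : s ⊆ Ioo 0 R) {k : ℕ}
    (h : WReg s w k fun r => w r • slopeDeriv α w a τ y r) : WReg s w (k + 1) y :=
  ⟨⟨κ, fun r hr => S.norm_y r (hs hr)⟩, slopeDeriv α w a τ y,
    fun r hr => S.hasDerivAt_y r (hs hr), h⟩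

end IsRadialSeries

namespace IsProfile

variable {α c R : ℝ} {w : ℝ → ℝ} (P : IsProfile α c R w)

include P

lemma exists_wReg_slopeDeriv_of_hasDerivAt (k : ℕ) : ∃ η > 0, ∀ (μ κ : ℝ)
    (a τ τ' y : ℝ → Wiener ℝ), IsRadialSeries α R w μ κ a τ y → κ * (1 + R ^ 2) ≤ 1 / 2 → κ ≤ η →
    (∀ r ∈ Ioo 0 R, HasDerivAt τ (τ' r) r) → WReg (Ioo 0 R) w k y → WReg (Ioo 0 R) w k τ →
    WReg (Ioo 0 R) w k τ' → WReg (Ioo 0 R) w k (slopeDeriv α w a τ y) := by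
  have hα := P.α_pos
  have hc := P.c_pos
  have hR := P.R_pos
  obtain ⟨κ₀, hκ₀, hfuchs⟩ := P.exists_wReg_of_fuchs (a := 2 + α) (by linarith) k (b := 6)
    (by norm_num)
  obtain ⟨η, hη, hcoef⟩ := exists_norm_bulkCoef_le (Wiener ℝ) ((1 + α) / α)
    ((1 + α) * (c / 3) + R ^ 2) hκ₀
  refine ⟨η, hη, fun μ κ a τ τ' y S hκ1 hκη hτd hy hτ hτ' => ?_⟩
  obtain ⟨hv, hv1, hid, hw⟩ := P.wReg_profile k
  have ha := (S.wReg_a subset_rfl hw hid hy).of_succ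
  let b : ℝ → Wiener ℝ := fun r => algebraMap ℝ (Wiener ℝ) (-(1 + α) * radSlope w r)
  let r₂ : ℝ → Wiener ℝ := fun r => algebraMap ℝ (Wiener ℝ) (r ^ 2)
  let q : ℝ → Wiener ℝ := fun r => algebraMap ℝ (Wiener ℝ) (w r * r ^ 2)
  let b' : ℝ → Wiener ℝ := fun r => algebraMap ℝ (Wiener ℝ) (-(1 + α) * radSlopeDeriv α c w r)
  let r₂' : ℝ → Wiener ℝ := fun r => algebraMap ℝ (Wiener ℝ) (2 * r)
  let q' : ℝ → Wiener ℝ := fun r =>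
    algebraMap ℝ (Wiener ℝ) (r * radSlope w r * r ^ 2 + w r * (2 * r))
  have hmap : ∀ {f : ℝ → ℝ} {f' r : ℝ}, HasDerivAt f f' r →
      HasDerivAt (fun r => algebraMap ℝ (Wiener ℝ) (f r)) (algebraMap ℝ (Wiener ℝ) f') r := fun h =>
    (algebraMapCLM ℝ (Wiener ℝ)).hasFDerivAt.comp_hasDerivAt _ h
  have hsq : ∀ r : ℝ, HasDerivAt (fun r : ℝ => r ^ 2) (2 * r) r := fun r => by
    simpa using hasDerivAt_pow 2 r
  have db : ∀ r ∈ Ioo 0 R, HasDerivAt b (b' r) r := fun r hr =>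
    hmap ((P.hasDerivAt_radSlope hr).const_mul _)
  have dr₂ : ∀ r ∈ Ioo 0 R, HasDerivAt r₂ (r₂' r) r := fun r hr => hmap (hsq r)
  have dq : ∀ r ∈ Ioo 0 R, HasDerivAt q (q' r) r := fun r hr =>
    hmap ((P.hasDerivAt hr).mul (hsq r))
  have rb : WReg (Ioo 0 R) w k b := WReg.algebraMap (hv.const_smul (-(1 + α)))
  have rr₂ : WReg (Ioo 0 R) w k r₂ := WReg.algebraMap (hid.pow 2)
  have rq : WReg (Ioo 0 R) w k q := WReg.algebraMap (hw.mul (hid.pow 2))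
  have rb' : WReg (Ioo 0 R) w k b' := WReg.algebraMap (hv1.const_smul (-(1 + α)))
  have rr₂' : WReg (Ioo 0 R) w k r₂' := WReg.algebraMap (hid.const_smul 2)
  have rq' : WReg (Ioo 0 R) w k q' :=
    WReg.algebraMap (((hid.mul hv).mul (hid.pow 2)).add (hw.mul (hid.const_smul 2)))
  have ra' : WReg (Ioo 0 R) w k fun r => r • y r := hid.smul hy
  have n1 : ∀ r ∈ Ioo 0 R, ‖a r‖ ≤ 1 / 2 := fun r hr => S.norm_a_le_half hκ1 hr
  have n2 : ∀ r ∈ Ioo 0 R, ‖a r + r₂ r * y r‖ ≤ 1 / 2 := fun r hr => S.norm_a_add_le hκ1 hr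
  let x : ℝ → Wiener ℝ × Wiener ℝ × Wiener ℝ := fun r => (a r, τ r, y r)
  let coef : ℝ → Wiener ℝ := fun r => bulkCoef ((1 + α) / α) (b r) (r₂ r) (q r) (x r)
  let rest : ℝ → Wiener ℝ := fun r =>
    bulkRest ((1 + α) / α) (b r) (r₂ r) (q r) (b' r) (r₂' r) (q' r) (x r)
    (r • y r) (τ' r)
  have rcoef : WReg (Ioo 0 R) w k coef :=
    WReg.bulkCoef ((1 + α) / α) (by norm_num) n1 n2 rb rr₂ rq ha hτ hy
  have rrest : WReg (Ioo 0 R) w k rest :=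
    WReg.bulkRest ((1 + α) / α) (by norm_num) n1 n2 rb rr₂ rq rb' rr₂' rq' ha hτ hy ra' hτ'
  have rbulk : WReg (Ioo 0 R) w k (bulkAt α w a τ y) :=
    S.wReg_bulkAt hκ1 subset_rfl hw hid hv ha hτ hy
  let Y := slopeDeriv α w a τ y
  have dbulk : ∀ r ∈ Ioo 0 R, HasDerivAt (bulkAt α w a τ y) (rest r + coef r * Y r) r :=
    fun r hr => hasDerivAt_bulk ((1 + α) / α) (db r hr) (dr₂ r hr) (dq r hr)
      (S.hasDerivAt_a r hr) (hτd r hr)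
      (S.hasDerivAt_y r hr) ((n1 r hr).trans_lt (by norm_num)) ((n2 r hr).trans_lt (by norm_num))
  let D : ℝ → ℝ := fun r => 5 * w r + (1 + α) * (r ^ 2 * radSlope w r)
  let D' : ℝ → ℝ := fun r => 5 * (r * radSlope w r) + (1 + α) * (2 * r * radSlope w r +
    r ^ 2 * radSlopeDeriv α c w r)
  have dD : ∀ r ∈ Ioo 0 R, HasDerivAt D (D' r) r := fun r hr =>
    ((P.hasDerivAt hr).const_mul 5).add (((hsq r).mul (P.hasDerivAt_radSlope hr)).const_mul _)
  have rD : WReg (Ioo 0 R) w k D := (hw.const_smul 5).add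
    (((hid.pow 2).smul hv).const_smul (1 + α))
  have rD' : WReg (Ioo 0 R) w k D' := ((hid.smul hv).const_smul 5).add
    ((((hid.const_smul 2).smul hv).add ((hid.pow 2).smul hv1)).const_smul (1 + α))
  have hwr : ∀ r ∈ Ioo 0 R, w r * r ≠ 0 := fun r hr => (mul_pos (P.w_pos hr) hr.1).ne'
  have hwrY : ∀ r ∈ Ioo 0 R, (w r * r) • Y r = (α / (1 + α)) • bulkAt α w a τ y r - D r • y r :=
    fun r hr => by
      show (w r * r) • slopeDeriv α w a τ y r = _
      rw [slopeDeriv, smul_inv_smul₀ (hwr r hr)]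
  have dwr : ∀ r ∈ Ioo 0 R, HasDerivAt (fun r => w r * r) (w r + r * (r * radSlope w r)) r :=
    fun r hr => ((P.hasDerivAt hr).mul (hasDerivAt_id r)).congr_deriv (by simp; ring)
  have dG : ∀ r ∈ Ioo 0 R, HasDerivAt (fun r => (α / (1 + α)) • bulkAt α w a τ y r - D r • y r)
      ((α / (1 + α)) • (rest r + coef r * Y r) - (D r • Y r + D' r • y r)) r := fun r hr => by
    have h1 := (dbulk r hr).const_smul (α / (1 + α))
    have h2 := (dD r hr).smul (S.hasDerivAt_y r hr)
    exact h1.sub h2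
  have dY : ∀ r ∈ Ioo 0 R, HasDerivAt Y (deriv Y r) r := fun r hr =>
    (((dwr r hr).inv (hwr r hr)).smul (dG r hr)).differentiableAt.hasDerivAt
  have hG := ((rbulk.const_smul (α / (1 + α))).sub (rD.smul hy)).bounded
  obtain ⟨M, hM⟩ := hG
  refine hfuchs (Wiener ℝ) Y (deriv Y) (fun r => (α / (1 + α)) • rest r - D' r • y r)
    (fun r => (α / (1 + α)) • coef r) dY (fun r hr => ?_)
    ((rrest.const_smul _).sub (rD'.smul hy)) (rcoef.const_smul _) (fun r hr => ?_)
    ⟨M, fun r hr => by rw [hwrY r hr]; exact hM r hr⟩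
  · have e1 := (dwr r hr).smul (dY r hr)
    have e2 := (dG r hr).congr_of_eventuallyEq (f₁ := fun r => (w r * r) • Y r) (by
      filter_upwards [isOpen_Ioo.mem_nhds hr] with z hz using hwrY z hz)
    have e := e1.unique e2
    simp only [smul_add, D, smul_mul_assoc] at e ⊢
    push_cast
    linear_combination (norm := module) e
  · have hw0 := P.w_pos hr
    have hw1 := P.w_le_one ⟨hr.1.le, hr.2.le⟩
    have hsqle : r ^ 2 ≤ R ^ 2 := pow_le_pow_left₀ hr.1.le hr.2.le 2
    have hpc : 0 ≤ (1 + α) * (c / 3) := by positivity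
    have hle : α / (1 + α) ≤ 1 := (div_le_one (by linarith)).2 (by linarith)
    rw [norm_smul, Real.norm_of_nonneg (by positivity)]
    refine (mul_le_of_le_one_left (norm_nonneg _) hle).trans (hcoef _ _ _ _ ?_ ?_ ?_ ?_)
    · rw [abs_mul, abs_neg, abs_of_pos (by linarith : 0 < 1 + α)]
      have := mul_le_mul_of_nonneg_left (P.abs_radSlope_le hr) (by linarith : 0 ≤ 1 + α)
      nlinarith [sq_nonneg R]
    · rw [abs_of_nonneg (sq_nonneg r)]
      linarith
    · rw [abs_of_nonneg (by positivity)]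
      nlinarith [sq_nonneg r]
    · rw [Prod.norm_def, Prod.norm_def]
      exact max_le ((S.norm_a r hr).trans hκη)
        (max_le ((S.norm_τ r hr).trans hκη) ((S.norm_y r hr).trans hκη))

lemma exists_wReg_slopeDeriv (k : ℕ) : ∃ η > 0, ∀ (μ κ : ℝ) (a τ y : ℝ → Wiener ℝ),
    IsRadialSeries α R w μ κ a τ y → κ * (1 + R ^ 2) ≤ 1 / 2 → κ ≤ η →
    (∀ (ρ : ℝ) (hρ : |ρ| ≤ 1), 0 < ρ → ρ < 1 →
      WReg (Ioo 0 R) w k fun r => Wiener.dilate ρ hρ (y r)) →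
    ∀ (ρ : ℝ) (hρ : |ρ| ≤ 1), 0 < ρ → ρ < 1 →
      WReg (Ioo 0 R) w k fun r => Wiener.dilate ρ hρ (slopeDeriv α w a τ y r) := by
  obtain ⟨η, hη, hmain⟩ := P.exists_wReg_slopeDeriv_of_hasDerivAt k
  refine ⟨η, hη, fun μ κ a τ y S hκ1 hκη hyall ρ hρ hρ0 hρ1 => ?_⟩
  obtain ⟨hv, hv1, hid, hw⟩ := P.wReg_profile k
  have hρ'1 : |(1 + ρ) / 2| ≤ 1 := by rw [abs_le]; constructor <;> linarith
  obtain ⟨L, hL⟩ := S.exists_dilate_τ_eq hρ hρ'1 hρ0 (by linarith)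
  have hy' := hyall _ hρ'1 (by linarith) (by linarith)
  have S' := S.dilate hκ1 hρ'1
  have hτ' : WReg (Ioo 0 R) w k fun r => L (r • Wiener.dilate ((1 + ρ) / 2) hρ'1 (y r)) :=
    (hid.smul hy').clm L
  have hτ : WReg (Ioo 0 R) w k fun r => Wiener.dilate ρ hρ (τ r) :=
    ((S'.wReg_a subset_rfl hw hid hy').of_succ.clm L).congr isOpen_Ioo fun r hr => (hL r hr).symm
  have hτd : ∀ r ∈ Ioo 0 R, HasDerivAt (fun r => Wiener.dilate ρ hρ (τ r))
      (L (r • Wiener.dilate ((1 + ρ) / 2) hρ'1 (y r))) r := fun r hr => by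
    refine (L.hasFDerivAt.comp_hasDerivAt r (S'.hasDerivAt_a r hr)).congr_of_eventuallyEq ?_
    filter_upwards [isOpen_Ioo.mem_nhds hr] with x hx using hL x hx
  exact (hmain μ κ _ _ _ _ (S.dilate hκ1 hρ) hκ1 hκη hτd (hyall ρ hρ hρ0 hρ1) hτ hτ').congr
    isOpen_Ioo fun r hr => (S.dilate_slopeDeriv hκ1 hρ hr).symm

/-- Weighted regularity up to the boundary for small series. -/
theorem exists_wReg (k : ℕ) : ∃ η > 0, ∀ (μ κ : ℝ) (a τ y : ℝ → Wiener ℝ),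
    IsRadialSeries α R w μ κ a τ y → κ * (1 + R ^ 2) ≤ 1 / 2 → κ ≤ η →
    ∀ (ρ : ℝ) (hρ : |ρ| ≤ 1), 0 < ρ → ρ < 1 →
      (WReg (Ioo 0 R) w k fun r => Wiener.dilate ρ hρ (y r)) ∧
      WReg (Ioo 0 R) w k fun r => Wiener.dilate ρ hρ (slopeDeriv α w a τ y r) := by
  induction k with
  | zero =>
    obtain ⟨η, hη, h⟩ := P.exists_wReg_slopeDeriv 0
    refine ⟨η, hη, fun μ κ a τ y S hκ1 hκη => ?_⟩
    have hy : ∀ (ρ : ℝ) (hρ : |ρ| ≤ 1), 0 < ρ → ρ < 1 →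
        WReg (Ioo 0 R) w 0 fun r => Wiener.dilate ρ hρ (y r) :=
      fun ρ hρ _ _ => ⟨κ, (S.dilate hκ1 hρ).norm_y⟩
    exact fun ρ hρ h0 h1 => ⟨hy ρ hρ h0 h1, h μ κ a τ y S hκ1 hκη hy ρ hρ h0 h1⟩
  | succ k ih =>
    obtain ⟨η₁, hη₁, h₁⟩ := ih
    obtain ⟨η₂, hη₂, h₂⟩ := P.exists_wReg_slopeDeriv (k + 1)
    refine ⟨min η₁ η₂, lt_min hη₁ hη₂, fun μ κ a τ y S hκ1 hκη => ?_⟩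
    have hy : ∀ (ρ : ℝ) (hρ : |ρ| ≤ 1), 0 < ρ → ρ < 1 →
        WReg (Ioo 0 R) w (k + 1) fun r => Wiener.dilate ρ hρ (y r) := fun ρ hρ h0 h1 =>
      (S.dilate hκ1 hρ).wReg_y_succ subset_rfl (((P.wReg_profile k).2.2.2.smul
        (h₁ μ κ a τ y S hκ1 (hκη.trans (min_le_left _ _)) ρ hρ h0 h1).2).congr isOpen_Ioo
        fun r hr => by rw [S.dilate_slopeDeriv hκ1 hρ hr])
    exact fun ρ hρ h0 h1 => ⟨hy ρ hρ h0 h1,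
      h₂ μ κ a τ y S hκ1 (hκη.trans (min_le_right _ _)) hy ρ hρ h0 h1⟩

/-- Interior smoothness. -/
theorem contDiffOn_dilate {μ κ : ℝ} {a τ y : ℝ → Wiener ℝ} (S : IsRadialSeries α R w μ κ a τ y)
    (hκ1 : κ * (1 + R ^ 2) ≤ 1 / 2) {ρ : ℝ} (hρ : |ρ| ≤ 1) (hρ0 : 0 < ρ) (hρ1 : ρ < 1) :
    ContDiffOn ℝ (⊤ : ℕ∞) (fun r => Wiener.dilate ρ hρ (a r)) (Ioo 0 R) := by
  intro r₀ hr₀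
  obtain ⟨r₁, h11, h12⟩ := exists_between hr₀.1
  obtain ⟨r₂, h21, h22⟩ := exists_between hr₀.2
  have hs : Ioo r₁ r₂ ⊆ Ioo 0 R := Ioo_subset_Ioo h11.le h22.le
  have hR := P.R_pos
  have hα := P.α_pos
  have hw : ∀ k, WReg (Ioo r₁ r₂) w k w := fun k => (P.wReg_profile k).2.2.2.mono_set hs
  have hid : ∀ k, WReg (Ioo r₁ r₂) w k fun r => r := fun k =>
    (P.wReg_profile k).2.2.1.mono_set hs
  have hv : ∀ k, WReg (Ioo r₁ r₂) w k (radSlope w) := fun k => (P.wReg_profile k).1.mono_set hs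
  have hinv : ∀ k, WReg (Ioo r₁ r₂) w k fun r => r⁻¹ := by
    have hb : ∃ C, ∀ r ∈ Ioo r₁ r₂, ‖r⁻¹‖ ≤ C := ⟨r₁⁻¹, fun r hr => by
      rw [Real.norm_of_nonneg (inv_nonneg.2 (hs hr).1.le)]
      exact inv_anti₀ h11 hr.1.le⟩
    intro k
    induction k with
    | zero => exact hb
    | succ k ih =>
      refine ⟨hb, fun r => -(r ^ 2)⁻¹, fun r hr => hasDerivAt_inv (hs hr).1.ne', ?_⟩
      simpa only [inv_pow] using (hw k).smul (ih.pow 2).neg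
  have hy : ∀ k, ∀ (ρ : ℝ) (hρ : |ρ| ≤ 1), 0 < ρ → ρ < 1 →
      WReg (Ioo r₁ r₂) w k fun r => Wiener.dilate ρ hρ (y r) := by
    intro k
    induction k with
    | zero => exact fun ρ hρ _ _ => ⟨κ, fun r hr => (S.dilate hκ1 hρ).norm_y r (hs hr)⟩
    | succ k ih =>
      intro ρ hρ h0 h1
      have hρ' : |(1 + ρ) / 2| ≤ 1 := by rw [abs_le]; constructor <;> linarith
      obtain ⟨L, hL⟩ := S.exists_dilate_τ_eq hρ hρ' h0 (by linarith)
      have S₁ := S.dilate hκ1 hρ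
      have hτ : WReg (Ioo r₁ r₂) w k fun r => Wiener.dilate ρ hρ (τ r) :=
        (((S.dilate hκ1 hρ').wReg_a hs (hw k) (hid k)
          (ih _ hρ' (by linarith) (by linarith))).of_succ.clm L).congr isOpen_Ioo
          fun r hr => (hL r (hs hr)).symm
      have ha := (S₁.wReg_a hs (hw k) (hid k) (ih ρ hρ h0 h1)).of_succ
      have hbulk := S₁.wReg_bulkAt hκ1 hs (hw k) (hid k) (hv k) ha hτ (ih ρ hρ h0 h1)
      have hD : WReg (Ioo r₁ r₂) w k fun r => 5 * w r + (1 + α) * (r ^ 2 * radSlope w r) :=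
        ((hw k).const_smul 5).add ((((hid k).pow 2).smul (hv k)).const_smul (1 + α))
      refine S₁.wReg_y_succ hs (((hinv k).smul ((hbulk.const_smul (α / (1 + α))).sub
        (hD.smul (ih ρ hρ h0 h1)))).congr isOpen_Ioo fun r hr => ?_)
      have hw0 := (P.w_pos (hs hr)).ne'
      rw [slopeDeriv, mul_inv, smul_smul, mul_inv_cancel_left₀ hw0]
  have hfin : ContDiffOn ℝ (⊤ : ℕ∞) (fun r => Wiener.dilate ρ hρ (a r)) (Ioo r₁ r₂) := by
    refine contDiffOn_infty.2 fun n => ?_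
    exact WReg.contDiffOn isOpen_Ioo
      (fun r hr => ((P.contDiffAt (hs hr)).of_le (by exact_mod_cast le_top)).contDiffWithinAt)
      (fun r hr => (P.w_pos (hs hr)).ne')
      ((S.dilate hκ1 hρ).wReg_a hs (hw n) (hid n) (hy n ρ hρ hρ0 hρ1))
  exact (hfin.contDiffAt (Ioo_mem_nhds h12 h21)).contDiffWithinAt

end IsProfile

/-- The functional `f ↦ ∑ (n l)ⁱ e^{n l t} fₙ` on Wiener series, the `i`-th time derivative of the
evaluation at `e^{l t}`. -/
noncomputable def expEval (l : ℝ) (i : ℕ) (t : ℝ) : Wiener ℝ →L[ℝ] ℝ :=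
  ∑' n : ℕ, ((n * l) ^ i * rexp (n * l * t)) • Wiener.coeff n

namespace expEval

variable {l t : ℝ}

lemma norm_coeff_clm_le (n : ℕ) : ‖(Wiener.coeff n : Wiener ℝ →L[ℝ] ℝ)‖ ≤ 1 :=
  ContinuousLinearMap.opNorm_le_bound _ zero_le_one fun f => by
    simpa using Wiener.norm_coeff_le n f

lemma summable_weight (hl : 0 < l) (ht : t < 0) (i : ℕ) :
    Summable fun n : ℕ => (n * l) ^ i * rexp (n * l * t) := by
  refine ((summable_pow_mul_exp_neg_nat_mul i (r := -(l * t)) (by nlinarith)).mul_left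
    (l ^ i)).congr fun n => ?_
  rw [mul_pow, neg_neg]
  ring_nf

lemma weight_nonneg (hl : 0 < l) (i n : ℕ) (t : ℝ) : 0 ≤ (n * l) ^ i * rexp (n * l * t) := by
  positivity

lemma norm_term_le (hl : 0 < l) (i n : ℕ) (t : ℝ) :
    ‖((n * l) ^ i * rexp (n * l * t)) • (Wiener.coeff n : Wiener ℝ →L[ℝ] ℝ)‖ ≤
      (n * l) ^ i * rexp (n * l * t) := by
  rw [norm_smul, Real.norm_of_nonneg (weight_nonneg hl i n t)]
  exact mul_le_of_le_one_right (weight_nonneg hl i n t) (norm_coeff_clm_le n)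

lemma summable (hl : 0 < l) (ht : t < 0) (i : ℕ) :
    Summable fun n : ℕ => ((n * l) ^ i * rexp (n * l * t)) •
      (Wiener.coeff n : Wiener ℝ →L[ℝ] ℝ) :=
  .of_norm_bounded (summable_weight hl ht i) fun n => norm_term_le hl i n t

lemma hasSum_apply (hl : 0 < l) (ht : t < 0) (i : ℕ) (f : Wiener ℝ) :
    HasSum (fun n : ℕ => (n * l) ^ i * rexp (n * l * t) * Wiener.coeff n f) (expEval l i t f) := by
  simpa [expEval] using (summable hl ht i).hasSum.mapL (ContinuousLinearMap.apply ℝ ℝ f)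

lemma hasDerivAt (hl : 0 < l) (ht : t < 0) (i : ℕ) :
    HasDerivAt (expEval l i) (expEval l (i + 1) t) t := by
  have h2 : t / 2 < 0 := by linarith
  refine hasDerivAt_tsum_of_isPreconnected (t := Iio (t / 2)) (y₀ := t)
    (summable_weight hl h2 (i + 1)) isOpen_Iio isPreconnected_Iio (fun n x _ => ?_)
    (fun n x hx => (norm_term_le hl (i + 1) n x).trans ?_) (by simp; linarith) (summable hl ht i)
    (by simp; linarith)
  · have h := ((((hasDerivAt_id x).const_mul (n * l : ℝ))).exp).const_mul ((n * l : ℝ) ^ i)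
    have h' : HasDerivAt (fun t => (n * l) ^ i * rexp (n * l * t))
        ((n * l) ^ (i + 1) * rexp (n * l * x)) x := h.congr_deriv (by simp only [id]; ring)
    exact h'.smul_const (Wiener.coeff n : Wiener ℝ →L[ℝ] ℝ)
  · gcongr
    exact (mem_Iio.1 hx).le

lemma contDiffOn (hl : 0 < l) (i : ℕ) : ContDiffOn ℝ (⊤ : ℕ∞) (expEval l i) (Iio 0) := by
  refine contDiffOn_infty.2 fun n => ?_
  induction n generalizing i with
  | zero => exact contDiffOn_zero.2 fun t ht => (hasDerivAt hl ht i).continuousAt.continuousWithinAt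
  | succ n ih =>
    rw [Nat.cast_add, Nat.cast_one, contDiffOn_succ_iff_deriv_of_isOpen isOpen_Iio]
    refine ⟨fun t ht => (hasDerivAt hl ht i).differentiableAt.differentiableWithinAt, by simp, ?_⟩
    exact (ih (i + 1)).congr fun t ht => (hasDerivAt hl ht i).deriv

lemma abs_apply_le (hl : 0 < l) (ht : t < 0) (f : Wiener ℝ) : |expEval l 0 t f| ≤ ‖f‖ := by
  rw [Wiener.norm_eq_tsum, ← Real.norm_eq_abs]
  refine (hasSum_apply hl ht 0 f).tsum_eq ▸
    tsum_of_norm_bounded (Wiener.summable_norm_coeff f).hasSum fun n => ?_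
  rw [norm_mul]
  refine mul_le_of_le_one_left (norm_nonneg _) ?_
  rw [pow_zero, one_mul, Real.norm_of_nonneg (exp_pos _).le, exp_le_one_iff]
  exact mul_nonpos_of_nonneg_of_nonpos (by positivity) ht.le

lemma map_mul (hl : 0 < l) (ht : t < 0) (f g : Wiener ℝ) :
    expEval l 0 t (f * g) = expEval l 0 t f * expEval l 0 t g := by
  have hs := fun f => (hasSum_apply hl ht 0 f).summable.norm
  rw [← (hasSum_apply hl ht 0 f).tsum_eq, ← (hasSum_apply hl ht 0 g).tsum_eq,
    ← (hasSum_apply hl ht 0 (f * g)).tsum_eq,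
    tsum_mul_tsum_eq_tsum_sum_antidiagonal_of_summable_norm (hs f) (hs g)]
  refine tsum_congr fun n => ?_
  rw [Wiener.coeff_mul, Finset.mul_sum]
  refine Finset.sum_congr rfl fun p hp => ?_
  obtain rfl : p.1 + p.2 = n := by simpa using hp
  rw [Nat.cast_add]
  simp only [add_mul, Real.exp_add, pow_zero]
  ring

lemma map_one (hl : 0 < l) (ht : t < 0) : expEval l 0 t 1 = 1 := by
  rw [← (hasSum_apply hl ht 0 1).tsum_eq, tsum_eq_single 0]
  · simp [Wiener.coeff_one]
  · intro n hn
    simp [Wiener.coeff_one, hn]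

/-- Evaluation at `e^{l t}` as an algebra homomorphism. -/
noncomputable def hom (hl : 0 < l) (ht : t < 0) : Wiener ℝ →ₐ[ℝ] ℝ :=
  AlgHom.ofLinearMap (expEval l 0 t).toLinearMap (map_one hl ht) (map_mul hl ht)

@[simp] lemma hom_apply (hl : 0 < l) (ht : t < 0) (f : Wiener ℝ) :
    hom hl ht f = expEval l 0 t f := rfl

lemma continuous_hom (hl : 0 < l) (ht : t < 0) : Continuous (hom hl ht) :=
  (expEval l 0 t).continuous

/-- Exponential decay on series without constant term. -/
lemma exists_abs_apply_le (hl : 0 < l) {t₁ : ℝ} (ht₁ : t₁ < 0) (i : ℕ) :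
    ∃ C, 0 ≤ C ∧ ∀ t ≤ t₁, ∀ f : Wiener ℝ, Wiener.coeff 0 f = 0 →
      |expEval l i t f| ≤ C * rexp (l * t) * ‖f‖ := by
  have hs := summable_weight hl ht₁ i
  have hC0 : 0 ≤ ∑' n : ℕ, (n * l) ^ i * rexp (n * l * t₁) :=
    tsum_nonneg fun n => weight_nonneg hl i n t₁
  refine ⟨rexp (-(l * t₁)) * ∑' n : ℕ, (n * l) ^ i * rexp (n * l * t₁), by positivity,
    fun t ht f hf => ?_⟩
  have hb : ∀ n : ℕ, ‖(n * l) ^ i * rexp (n * l * t) * Wiener.coeff n f‖ ≤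
      (n * l) ^ i * rexp (n * l * t₁) * (rexp (-(l * t₁)) * rexp (l * t) * ‖f‖) := by
    intro n
    rcases Nat.eq_zero_or_pos n with rfl | hn
    · rw [hf, mul_zero, norm_zero]
      positivity
    · have hexp : rexp (n * l * t) ≤ rexp (n * l * t₁) * (rexp (-(l * t₁)) * rexp (l * t)) := by
        rw [← Real.exp_add, ← Real.exp_add, exp_le_exp]
        have h1 : (1 : ℝ) ≤ n := by exact_mod_cast hn
        nlinarith [mul_nonneg (mul_nonneg (sub_nonneg.2 h1) hl.le) (sub_nonneg.2 ht)]
      rw [norm_mul, Real.norm_of_nonneg (weight_nonneg hl i n t)]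
      calc _ ≤ (n * l) ^ i * (rexp (n * l * t₁) * (rexp (-(l * t₁)) * rexp (l * t))) * ‖f‖ := by
            gcongr
            exact Wiener.norm_coeff_le n f
        _ = _ := by ring
  have := (hasSum_apply hl (ht.trans_lt ht₁) i f).tsum_eq ▸
    tsum_of_norm_bounded (hs.hasSum.mul_right _) hb
  rw [← Real.norm_eq_abs]
  refine this.trans (le_of_eq (by ring))

end expEval

lemma iteratedDeriv_clm_comp {E F : Type*} [NormedAddCommGroup E] [NormedSpace ℝ E]
    [NormedAddCommGroup F] [NormedSpace ℝ F] (L : E →L[ℝ] F) {f : ℝ → E} {x : ℝ} {k : ℕ}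
    (hf : ContDiffAt ℝ k f x) : iteratedDeriv k (fun s => L (f s)) x = L (iteratedDeriv k f x) := by
  simp only [iteratedDeriv_eq_iteratedFDeriv]
  have := L.iteratedFDeriv_comp_left hf le_rfl
  exact congrArg (fun m => m fun _ => (1 : ℝ)) this

/-- The perturbation `ζ(t,r) = ∑ e^{n l (t - t₀)} aₙ(r)`. -/
noncomputable def perturb (l t₀ : ℝ) (a : ℝ → Wiener ℝ) (t r : ℝ) : ℝ := expEval l 0 (t - t₀) (a r)

section

variable {l t₀ R : ℝ} {a : ℝ → Wiener ℝ}

lemma iteratedDeriv_expEval (hl : 0 < l) (f : Wiener ℝ) (i : ℕ) {t : ℝ} (ht : t < t₀) :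
    iteratedDeriv i (fun s => expEval l 0 (s - t₀) f) t = expEval l i (t - t₀) f := by
  induction i generalizing t with
  | zero => simp
  | succ i ih =>
    have he : iteratedDeriv i (fun s => expEval l 0 (s - t₀) f) =ᶠ[nhds t]
        fun s => expEval l i (s - t₀) f := by
      filter_upwards [Iio_mem_nhds ht] with s hs using ih hs
    rw [iteratedDeriv_succ, he.deriv_eq]
    have h1 := (expEval.hasDerivAt hl (by linarith : t - t₀ < 0) i).comp_sub_const t t₀
    simpa using (h1.clm_apply (hasDerivAt_const t f)).deriv

lemma dtr_perturb (hl : 0 < l) (ha : ContDiffOn ℝ (⊤ : ℕ∞) a (Ioo 0 R)) (i k : ℕ) {t r : ℝ}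
    (ht : t < t₀) (hr : r ∈ Ioo 0 R) :
    dtr (perturb l t₀ a) i k t r = expEval l i (t - t₀) (iteratedDeriv k a r) := by
  have hak : ContDiffAt ℝ k a r :=
    (ha.contDiffAt (isOpen_Ioo.mem_nhds hr)).of_le (by exact_mod_cast le_top)
  have h : ∀ s, iteratedDeriv k (fun x => perturb l t₀ a s x) r =
      expEval l 0 (s - t₀) (iteratedDeriv k a r) := fun s => iteratedDeriv_clm_comp _ hak
  simp only [dtr, h]
  exact iteratedDeriv_expEval hl _ i ht

lemma contDiffOn_perturb (hl : 0 < l) (ha : ContDiffOn ℝ (⊤ : ℕ∞) a (Ioo 0 R)) {T : ℝ}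
    (hT : T ≤ t₀) : ContDiffOn ℝ (⊤ : ℕ∞) (fun p : ℝ × ℝ => perturb l t₀ a p.1 p.2)
      (Ico 0 T ×ˢ Ioo 0 R) := by
  refine ContDiffOn.clm_apply (f := fun p : ℝ × ℝ => expEval l 0 (p.1 - t₀))
    (g := fun p : ℝ × ℝ => a p.2) ?_ ?_
  · exact (expEval.contDiffOn hl 0).comp (contDiff_fst.sub contDiff_const).contDiffOn
      fun p hp => by simpa using hp.1.2.trans_le hT
  · exact ha.comp contDiff_snd.contDiffOn fun p hp => hp.2

end

/-- The algebra behind the separation of the Euler–Poisson equation. -/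
lemma eulerPoisson_identity {α W w r v Y Y' T X J : ℝ} (hα : 0 < α) (hr : r ≠ 0) (hw : w ≠ 0)
    (hX : 0 < X) (hJ : 0 < J) (hJX : J = X + r ^ 2 * Y)
    (hY' : Y' = (w * r)⁻¹ * (α / (1 + α) *
      (X ^ (2 * ((1 + α) / α) - 4) * J ^ ((1 + α) / α + 1) * (X ^ 2 * T + -(1 + α) * v)
        - -(1 + α) * v * J - 2 * ((1 + α) / α) * (w * r ^ 2 * Y ^ 2 * X⁻¹)
        - (1 + α) / α * (-(1 + α) * v * (r ^ 2 * Y))) - (5 * w + (1 + α) * (r ^ 2 * v)) * Y)) :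
    W * T + X ^ 2 / r * ((1 + α) * W * (r * v) * (X ^ 2 * J) ^ (-(1 + α) / α) +
      w * W * ((2 * X * (r * Y) * J + X ^ 2 * (r * Y + (2 * r * Y + r ^ 2 * Y'))) *
        (-(1 + α) / α) * (X ^ 2 * J) ^ (-(1 + α) / α - 1)))
      + W / (X ^ 2 * r ^ 3) * (1 + α) * (-(r ^ 3 * v)) = 0 := by
  have h1 : X ^ (2 * ((1 + α) / α) - 4) * J ^ ((1 + α) / α + 1) * X ^ 6 *
      (X ^ 2 * J) ^ (-(1 + α) / α - 1) = 1 := by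
    rw [Real.mul_rpow (by positivity) hJ.le, ← Real.rpow_natCast X 6, ← Real.rpow_natCast X 2,
      ← Real.rpow_mul hX.le]
    calc _ = (X ^ (2 * ((1 + α) / α) - 4) * X ^ ((6 : ℕ) : ℝ) *
          X ^ (((2 : ℕ) : ℝ) * (-(1 + α) / α - 1))) *
          (J ^ ((1 + α) / α + 1) * J ^ (-(1 + α) / α - 1)) := by ring
      _ = 1 := by
        rw [← Real.rpow_add hX, ← Real.rpow_add hX, ← Real.rpow_add hJ]
        rw [show 2 * ((1 + α) / α) - 4 + ((6 : ℕ) : ℝ) + ((2 : ℕ) : ℝ) * (-(1 + α) / α - 1) = 0 by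
          push_cast; ring, show (1 + α) / α + 1 + (-(1 + α) / α - 1) = 0 by ring]
        simp
  have h2 : (X ^ 2 * J) ^ (-(1 + α) / α) = X ^ 2 * J * (X ^ 2 * J) ^ (-(1 + α) / α - 1) := by
    rw [Real.rpow_sub_one (by positivity)]
    field_simp
  rw [h2]
  generalize (X ^ 2 * J) ^ (-(1 + α) / α - 1) = G at *
  generalize X ^ (2 * ((1 + α) / α) - 4) * J ^ ((1 + α) / α + 1) = Q at *
  have hα1 : (1 + α) ≠ 0 := by positivity
  have hX0 := hX.ne'
  have hG : G ≠ 0 := by rintro rfl; simp at h1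
  have hQ : Q = (X ^ 6 * G)⁻¹ := by
    field_simp
    linarith
  subst hQ hY'
  field_simp
  linear_combination (-2 * (α + 1) * W * X ^ 5 * G * w * Y) * hJX

/-- Small radial series give solutions of the Euler–Poisson perturbation equation. -/
theorem IsRadialSeries.solvesEP {α c R l μ κ t₀ : ℝ} {w : ℝ → ℝ} {a τ y : ℝ → Wiener ℝ}
    (S : IsRadialSeries α R w μ κ a τ y) (P : IsProfile α c R w) (hκ1 : κ * (1 + R ^ 2) ≤ 1 / 2)
    (hl : 0 < l) (hlμ : l ^ 2 = μ) (ha : ContDiffOn ℝ (⊤ : ℕ∞) a (Ioo 0 R)) {Tset : Set ℝ}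
    (hT : Tset ⊆ Iio t₀) : SolvesEP α c R w (perturb l t₀ a) Tset := by
  intro t ht r hr
  have htt : t < t₀ := hT ht
  have ht0 : t - t₀ < 0 := by linarith
  have hα := P.α_pos
  have hwr := P.w_pos hr
  set ψ := expEval l 0 (t - t₀) with hψ
  have hψle : ∀ f, |ψ f| ≤ ‖f‖ := expEval.abs_apply_le hl ht0
  have dA : ∀ s ∈ Ioo 0 R, HasDerivAt (fun s => ψ (a s)) (s * ψ (y s)) s := fun s hs =>
    (ψ.hasFDerivAt.comp_hasDerivAt s (S.hasDerivAt_a s hs)).congr_deriv (by simp)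
  have dY : HasDerivAt (fun s => ψ (y s)) (ψ (slopeDeriv α w a τ y r)) r :=
    ψ.hasFDerivAt.comp_hasDerivAt r (S.hasDerivAt_y r hr)
  have hdiv : ∀ s ∈ Ioo 0 R, 1 / 2 ≤ 1 + ψ (a s) ∧ 1 / 2 ≤ 1 + ψ (a s) + s ^ 2 * ψ (y s) := by
    intro s hs
    have h1 := (hψle _).trans (S.norm_a_le_half hκ1 hs)
    have h2 := (hψle _).trans (S.norm_a_add_le hκ1 hs)
    have h3 : ψ (a s + algebraMap ℝ (Wiener ℝ) (s ^ 2) * y s) = ψ (a s) + s ^ 2 * ψ (y s) := by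
      rw [← Algebra.smul_def, map_add, map_smul, smul_eq_mul]
    rw [h3] at h2
    rw [abs_le] at h1 h2
    constructor <;> linarith
  obtain ⟨hX, hJ⟩ := hdiv r hr
  have hτ : dtr (perturb l t₀ a) 2 0 t r = ψ (τ r) := by
    rw [dtr_perturb hl ha 2 0 htt hr, iteratedDeriv_zero]
    refine (expEval.hasSum_apply hl ht0 2 (a r)).unique ?_
    convert expEval.hasSum_apply hl ht0 0 (τ r) using 2 with n
    rw [S.coeff_τ r hr, ← hlμ]
    ring
  have hgrav : c * ∫ s in Ioo (0 : ℝ) r, w s ^ α * s ^ 2 = -(r ^ 3 * radSlope w r) := by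
    rw [P.flux hr, intervalIntegral.integral_of_le hr.1.le, integral_Ioc_eq_integral_Ioo]
    ring
  have hbulk : ψ (bulkAt α w a τ y r) = (1 + ψ (a r)) ^ (2 * ((1 + α) / α) - 4) *
      (1 + ψ (a r) + r ^ 2 * ψ (y r)) ^ ((1 + α) / α + 1) *
        ((1 + ψ (a r)) ^ 2 * ψ (τ r) + -(1 + α) * radSlope w r)
        - -(1 + α) * radSlope w r * (1 + ψ (a r) + r ^ 2 * ψ (y r))
        - 2 * ((1 + α) / α) * (w r * r ^ 2 * ψ (y r) ^ 2 * (1 + ψ (a r))⁻¹)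
        - (1 + α) / α * (-(1 + α) * radSlope w r * (r ^ 2 * ψ (y r))) := by
    have h1 := S.norm_a_le_half hκ1 hr
    have h2 := S.norm_a_add_le hκ1 hr
    have h := map_bulk (expEval.hom hl ht0) (expEval.continuous_hom hl ht0) ((1 + α) / α)
      (algebraMap ℝ (Wiener ℝ) (-(1 + α) * radSlope w r)) (algebraMap ℝ (Wiener ℝ) (r ^ 2))
      (algebraMap ℝ (Wiener ℝ) (w r * r ^ 2)) (a r, τ r, y r) (h1.trans_lt (by norm_num))
      (h2.trans_lt (by norm_num))
    have h3 : ψ (a r + algebraMap ℝ (Wiener ℝ) (r ^ 2) * y r) = ψ (a r) + r ^ 2 * ψ (y r) := by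
      rw [← Algebra.smul_def, map_add, map_smul, smul_eq_mul]
    have h1' : |ψ (a r)| < 1 := ((hψle _).trans h1).trans_lt (by norm_num)
    have h2' : |ψ (a r) + r ^ 2 * ψ (y r)| < 1 := by
      rw [← h3]
      exact ((hψle _).trans h2).trans_lt (by norm_num)
    refine h.trans ?_
    simp only [AlgHom.commutes, expEval.hom_apply, bulk, ← hψ, Algebra.algebraMap_self,
      RingHom.id_apply, smul_eq_mul, powSeries_binomCoeff _ h1', powSeries_binomCoeff _ h2',
      Real.rpow_neg_one, add_assoc]
  have hY' : ψ (slopeDeriv α w a τ y r) = (w r * r)⁻¹ * (α / (1 + α) * ψ (bulkAt α w a τ y r) -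
      (5 * w r + (1 + α) * (r ^ 2 * radSlope w r)) * ψ (y r)) := by
    simp only [slopeDeriv, map_smul, map_sub, smul_eq_mul]
  rw [hbulk] at hY'
  have dX2 : HasDerivAt (fun s => (1 + ψ (a s)) ^ 2) (2 * (1 + ψ (a r)) * (r * ψ (y r))) r :=
    (((dA r hr).const_add 1).pow 2).congr_deriv (by norm_num)
  have dJ : HasDerivAt (fun s => 1 + ψ (a s) + s ^ 2 * ψ (y s))
      (r * ψ (y r) + (2 * r * ψ (y r) + r ^ 2 * ψ (slopeDeriv α w a τ y r))) r :=
    ((dA r hr).const_add 1).add (((hasDerivAt_pow 2 r).mul dY).congr_deriv (by norm_num))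
  have hM : 0 < (1 + ψ (a r)) ^ 2 * (1 + ψ (a r) + r ^ 2 * ψ (y r)) := by
    have : 0 < 1 + ψ (a r) := by linarith
    have : 0 < 1 + ψ (a r) + r ^ 2 * ψ (y r) := by linarith
    positivity
  have dXJ : HasDerivAt (fun s => (1 + ψ (a s)) ^ 2 * (1 + ψ (a s) + s ^ 2 * ψ (y s))) _ r :=
    dX2.mul dJ
  have dM := dXJ.rpow_const (p := -(1 + α) / α) (Or.inl hM.ne')
  have dfull := (P.hasDerivAt_rpow hr (1 + α)).mul dM
  have hcongr : (fun s => w s ^ (1 + α) * ((1 + perturb l t₀ a t s) ^ 2 *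
      (1 + perturb l t₀ a t s + s * deriv (fun x => perturb l t₀ a t x) s)) ^ (-(1 + α) / α))
      =ᶠ[nhds r] fun s => w s ^ (1 + α) * ((1 + ψ (a s)) ^ 2 *
        (1 + ψ (a s) + s ^ 2 * ψ (y s))) ^ (-(1 + α) / α) := by
    filter_upwards [isOpen_Ioo.mem_nhds hr] with s hs
    have : deriv (fun x => perturb l t₀ a t x) s = s * ψ (y s) := (dA s hs).deriv
    rw [this, perturb, ← hψ, ← mul_assoc, ← sq]
  have hd : deriv (fun s => w s ^ (1 + α) * ((1 + perturb l t₀ a t s) ^ 2 *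
      (1 + perturb l t₀ a t s + s * deriv (fun x => perturb l t₀ a t x) s)) ^ (-(1 + α) / α)) r =
      _ := hcongr.deriv_eq.trans dfull.deriv
  rw [hd, hτ, mul_assoc _ c, hgrav]
  have hid := eulerPoisson_identity (W := w r ^ α) hα hr.1.ne' hwr.ne'
    (by linarith : 0 < 1 + ψ (a r)) (by linarith : 0 < 1 + ψ (a r) + r ^ 2 * ψ (y r)) rfl hY'
  refine Eq.trans ?_ hid
  have hp : w r ^ (1 + α) = w r * w r ^ α := by rw [Real.rpow_add hwr, Real.rpow_one]
  simp only [perturb, ← hψ, hp, add_sub_cancel_left]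

namespace IsProfile

variable {α c R : ℝ} {w : ℝ → ℝ} (P : IsProfile α c R w)

include P

lemma continuousOn_rpow_Ioo (e : ℝ) : ContinuousOn (fun r => w r ^ e) (Ioo 0 R) := fun _ hr =>
  (P.hasDerivAt_rpow hr e).continuousAt.continuousWithinAt

lemma integrableOn_energy {e C : ℝ} {m : ℕ} (he : -1 < e - 2 * m) {g : ℝ → ℝ}
    (hg : ContinuousOn g (Ioo 0 R)) (hC : ∀ r ∈ Ioo 0 R, |w r ^ m * g r| ≤ C) :
    IntegrableOn (fun r => w r ^ e * r ^ 4 * g r ^ 2) (Ioo 0 R) := by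
  have hcont : ContinuousOn (fun r => w r ^ e * r ^ 4 * g r ^ 2) (Ioo 0 R) :=
    ((P.continuousOn_rpow_Ioo e).mul (continuousOn_pow 4)).mul (hg.pow 2)
  refine ((P.integrableOn_rpow_mul he).const_mul (R ^ 3 * C ^ 2)).mono'
    (hcont.aestronglyMeasurable measurableSet_Ioo)
    ((ae_restrict_iff' measurableSet_Ioo).2 (.of_forall fun r hr => ?_))
  have hw := P.w_pos hr
  have hr0 := hr.1
  have hR := P.R_pos
  have hsplit : w r ^ e = w r ^ (e - 2 * m) * (w r ^ m) ^ 2 := by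
    rw [← pow_mul, ← Real.rpow_natCast, ← Real.rpow_add hw]
    push_cast
    ring_nf
  rw [Real.norm_of_nonneg (by positivity), hsplit]
  have h1 : (w r ^ m * g r) ^ 2 ≤ C ^ 2 := sq_le_sq' (abs_le.1 (hC r hr)).1 (abs_le.1 (hC r hr)).2
  have h2 : r ^ 3 ≤ R ^ 3 := pow_le_pow_left₀ hr0.le hr.2.le 3
  calc _ = r ^ 3 * (w r ^ m * g r) ^ 2 * (w r ^ (e - 2 * m) * r) := by ring
    _ ≤ R ^ 3 * C ^ 2 * (w r ^ (e - 2 * m) * r) := by gcongr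

end IsProfile

namespace IsRadialSeries

variable {α c R l μ κ : ℝ} {w : ℝ → ℝ} {a τ y : ℝ → Wiener ℝ}

lemma iteratedDeriv_add_two (S : IsRadialSeries α R w μ κ a τ y) (m : ℕ) {r : ℝ}
    (hr : r ∈ Ioo 0 R) :
    iteratedDeriv (m + 2) a r = iteratedDeriv m (fun r => y r + r • slopeDeriv α w a τ y r) r := by
  rw [iteratedDeriv_succ', iteratedDeriv_succ']
  refine Filter.EventuallyEq.iteratedDeriv_eq m ?_
  filter_upwards [isOpen_Ioo.mem_nhds hr] with x hx
  have he : deriv a =ᶠ[nhds x] fun r => r • y r := by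
    filter_upwards [isOpen_Ioo.mem_nhds hx] with z hz using (S.hasDerivAt_a z hz).deriv
  rw [he.deriv_eq]
  have := ((hasDerivAt_id x).smul (S.hasDerivAt_y x hx)).deriv
  simp only [id, one_smul] at this
  rw [add_comm (y x)]
  exact this

lemma exists_weighted_bound (S : IsRadialSeries α R w μ κ a τ y) (P : IsProfile α c R w) {K : ℕ}
    (hy : WReg (Ioo 0 R) w K y) (hY : WReg (Ioo 0 R) w K (slopeDeriv α w a τ y)) {k : ℕ}
    (hk : k ≤ K + 2) : ∃ C, ∀ r ∈ Ioo 0 R, ‖w r ^ (k - 2) • iteratedDeriv k a r‖ ≤ C := by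
  match k, hk with
  | 0, _ => exact ⟨κ, fun r hr => by simpa using S.norm_a r hr⟩
  | 1, _ =>
    refine ⟨R * κ, fun r hr => ?_⟩
    rw [pow_zero, one_smul, iteratedDeriv_one, (S.hasDerivAt_a r hr).deriv, norm_smul,
      Real.norm_of_nonneg hr.1.le]
    exact mul_le_mul hr.2.le (S.norm_y r hr) (norm_nonneg _) P.R_pos.le
  | m + 2, hk =>
    have hK := P.wReg_profile K
    have h : WReg (Ioo 0 R) w K fun r => y r + r • slopeDeriv α w a τ y r :=
      hy.add (hK.2.2.1.smul hY)
    have hm : WReg (Ioo 0 R) w (0 + m) fun r => y r + r • slopeDeriv α w a τ y r :=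
      h.mono (by omega)
    obtain ⟨C, hC⟩ := (WReg.weighted_iteratedDeriv isOpen_Ioo
      (w' := fun r => r * radSlope w r) (fun r hr => P.hasDerivAt hr)
      (fun r hr => (P.w_pos hr).ne')
      (fun j => (P.wReg_profile j).2.2.1.mul (P.wReg_profile j).1) hm).bounded
    refine ⟨C, fun r hr => ?_⟩
    rw [S.iteratedDeriv_add_two m hr]
    exact hC r hr

lemma continuousOn_dtr (hl : 0 < l) (ha : ContDiffOn ℝ (⊤ : ℕ∞) a (Ioo 0 R)) (i k : ℕ) {t t₀ : ℝ}
    (ht : t < t₀) : ContinuousOn (fun r => dtr (perturb l t₀ a) i k t r) (Ioo 0 R) := by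
  have h := (ha.continuousOn_iteratedDerivWithin (m := k) (by exact_mod_cast le_top)
    isOpen_Ioo.uniqueDiffOn).congr (iteratedDerivWithin_of_isOpen isOpen_Ioo).symm
  exact ((expEval l i (t - t₀)).continuous.comp_continuousOn h).congr
    fun r hr => dtr_perturb hl ha i k ht hr

lemma exists_weighted_dtr_bound (S : IsRadialSeries α R w μ κ a τ y) (P : IsProfile α c R w)
    (hl : 0 < l) (ha : ContDiffOn ℝ (⊤ : ℕ∞) a (Ioo 0 R)) {K : ℕ}
    (hy : WReg (Ioo 0 R) w K y) (hY : WReg (Ioo 0 R) w K (slopeDeriv α w a τ y)) (i : ℕ) {k : ℕ}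
    (hk : k ≤ K + 2) {t t₀ : ℝ} (ht : t < t₀) :
    ∃ C, ∀ r ∈ Ioo 0 R, |w r ^ (k - 2) * dtr (perturb l t₀ a) i k t r| ≤ C := by
  obtain ⟨C, hC⟩ := S.exists_weighted_bound P hy hY hk
  refine ⟨‖expEval l i (t - t₀)‖ * C, fun r hr => ?_⟩
  rw [dtr_perturb hl ha i k ht hr, ← smul_eq_mul, ← map_smul, ← Real.norm_eq_abs]
  exact ((expEval l i (t - t₀)).le_opNorm _).trans (by gcongr; exact hC r hr)

lemma finiteEnergies (S : IsRadialSeries α R w μ κ a τ y) (P : IsProfile α c R w)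
    (hl : 0 < l) (ha : ContDiffOn ℝ (⊤ : ℕ∞) a (Ioo 0 R))
    (hy : WReg (Ioo 0 R) w (⌈α⌉₊ + 2) y)
    (hY : WReg (Ioo 0 R) w (⌈α⌉₊ + 2) (slopeDeriv α w a τ y)) {t t₀ : ℝ} (ht : t < t₀) :
    FiniteEnergies α R w (perturb l t₀ a) t := by
  have hα := P.lt_α
  have hceil : (⌈α⌉₊ : ℝ) < α + 1 := Nat.ceil_lt_add_one P.α_pos.le
  constructor
  · obtain ⟨C, hC⟩ := S.exists_weighted_dtr_bound P hl ha hy hY 0 (k := 0) (by omega) ht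
    exact P.integrableOn_energy (m := 0) (by push_cast; linarith) (continuousOn_dtr hl ha 0 0 ht) hC
  · intro j hj k hk
    have hk' : k ≤ ⌈α⌉₊ + 3 := by simp at hj hk; omega
    have hkr : (k : ℝ) ≤ ⌈α⌉₊ + 3 := by exact_mod_cast hk'
    constructor
    · obtain ⟨C, hC⟩ := S.exists_weighted_dtr_bound P hl ha hy hY (j - k + 1) (k := k) (by omega) ht
      refine P.integrableOn_energy ?_ (continuousOn_dtr hl ha _ _ ht) hC
      rcases le_total 2 k with h | h
      · push_cast [h]
        linarith
      · rw [Nat.sub_eq_zero_of_le h]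
        push_cast
        linarith [(Nat.cast_nonneg k : (0 : ℝ) ≤ k)]
    · obtain ⟨C, hC⟩ := S.exists_weighted_dtr_bound P hl ha hy hY (j - k) (k := k + 1) (by omega) ht
      refine P.integrableOn_energy ?_ (continuousOn_dtr hl ha _ _ ht) hC
      rcases le_total 2 (k + 1) with h | h
      · have hcast : ((k + 1 - 2 : ℕ) : ℝ) = k - 1 := by
          rw [Nat.cast_sub h]
          push_cast
          ring
        rw [hcast]
        linarith
      · rw [Nat.sub_eq_zero_of_le h]
        push_cast
        linarith [(Nat.cast_nonneg k : (0 : ℝ) ≤ k)]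

end IsRadialSeries

/-- A Wiener series with nonzero linear coefficient does not vanish near `t = -∞`. -/
lemma expEval.exists_apply_ne_zero {l : ℝ} (hl : 0 < l) {f : Wiener ℝ}
    (h0 : Wiener.coeff 0 f = 0) (h1 : Wiener.coeff 1 f ≠ 0) : ∃ t < 0, expEval l 0 t f ≠ 0 := by
  have hf1 : 0 < |Wiener.coeff 1 f| := abs_pos.2 h1
  set x : ℝ := min (1 / 2) (|Wiener.coeff 1 f| / (2 * (‖f‖ + 1))) with hx
  have hx0 : 0 < x := lt_min (by norm_num) (by positivity)
  have hx1 : x < 1 := (min_le_left _ _).trans_lt (by norm_num)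
  have hxf : x * ‖f‖ < |Wiener.coeff 1 f| := by
    have : x * (2 * (‖f‖ + 1)) ≤ |Wiener.coeff 1 f| :=
      (le_div_iff₀ (by positivity)).1 (min_le_right _ _)
    nlinarith [norm_nonneg f]
  have ht : Real.log x / l < 0 := div_neg_of_neg_of_pos (Real.log_neg hx0 hx1) hl
  refine ⟨Real.log x / l, ht, fun hzero => ?_⟩
  have hexp : ∀ n : ℕ, rexp (n * l * (Real.log x / l)) = x ^ n := fun n => by
    rw [mul_assoc, mul_div_cancel₀ _ hl.ne', Real.exp_nat_mul, Real.exp_log hx0]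
  have hs := hasSum_apply hl ht 0 f
  simp only [pow_zero, one_mul, hexp, hzero] at hs
  have hs' := hs.sub (hasSum_ite_eq 1 (x * Wiener.coeff 1 f))
  have hb : ∀ n : ℕ, ‖x ^ n * Wiener.coeff n f - if n = 1 then x * Wiener.coeff 1 f else 0‖ ≤
      x ^ 2 * ‖Wiener.coeff n f‖ := by
    intro n
    match n with
    | 0 => simp [h0]
    | 1 => simp; positivity
    | m + 2 =>
      rw [if_neg (by omega), sub_zero, norm_mul, norm_pow, Real.norm_of_nonneg hx0.le]
      gcongr ?_ * _
      exact pow_le_pow_of_le_one hx0.le hx1.le (by omega)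
  have h := hs'.tsum_eq ▸
    tsum_of_norm_bounded ((Wiener.summable_norm_coeff f).hasSum.mul_left (x ^ 2)) hb
  rw [← Wiener.norm_eq_tsum, zero_sub, norm_neg, norm_mul, Real.norm_of_nonneg hx0.le,
    Real.norm_eq_abs] at h
  nlinarith

lemma IsProfile.abs_energy_le {α c R : ℝ} {w : ℝ → ℝ} (P : IsProfile α c R w) {s g M r : ℝ}
    (hs : 0 ≤ s) (hr : r ∈ Ioo 0 R) (hg : |g| ≤ M) : |w r ^ s * r ^ 4 * g ^ 2| ≤ R ^ 4 * M ^ 2 := by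
  have hw := P.w_pos hr
  have hw1 := Real.rpow_le_one hw.le (P.w_le_one ⟨hr.1.le, hr.2.le⟩) hs
  have hr4 : r ^ 4 ≤ R ^ 4 := pow_le_pow_left₀ hr.1.le hr.2.le 4
  have hg2 : g ^ 2 ≤ M ^ 2 := sq_le_sq' (abs_le.1 hg).1 (abs_le.1 hg).2
  have hR := P.R_pos
  rw [abs_of_nonneg (mul_nonneg (mul_nonneg (Real.rpow_nonneg hw.le s) (by positivity))
    (sq_nonneg g))]
  calc _ ≤ 1 * R ^ 4 * M ^ 2 := by gcongr
    _ = _ := by ring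

lemma E0_perturb_eq {α R l : ℝ} {w : ℝ → ℝ} {a : ℝ → Wiener ℝ} (hl : 0 < l)
    (ha : ContDiffOn ℝ (⊤ : ℕ∞) a (Ioo 0 R)) {t t₀ : ℝ} (ht : t < t₀) :
    E0 α R w (perturb l t₀ a) t = E0 α R w (perturb l 0 a) (t - t₀) := by
  refine setIntegral_congr_fun measurableSet_Ioo fun r hr => ?_
  have ht' : t - t₀ < 0 := by linarith
  simp only [dtr_perturb hl ha _ _ ht hr, dtr_perturb hl ha _ _ ht' hr, perturb, sub_zero]

namespace IsRadialSeries

variable {α c R l μ κ : ℝ} {w : ℝ → ℝ} {a τ y : ℝ → Wiener ℝ}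

lemma dtr_one (S : IsRadialSeries α R w μ κ a τ y) (hl : 0 < l)
    (ha : ContDiffOn ℝ (⊤ : ℕ∞) a (Ioo 0 R)) (i : ℕ) {t t₀ r : ℝ} (ht : t < t₀)
    (hr : r ∈ Ioo 0 R) : dtr (perturb l t₀ a) i 1 t r = r * expEval l i (t - t₀) (y r) := by
  rw [dtr_perturb hl ha i 1 ht hr, iteratedDeriv_one, (S.hasDerivAt_a r hr).deriv, map_smul,
    smul_eq_mul]

lemma exists_abs_dtr_le (S : IsRadialSeries α R w μ κ a τ y) (P : IsProfile α c R w) (hl : 0 < l)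
    (ha : ContDiffOn ℝ (⊤ : ℕ∞) a (Ioo 0 R)) {t₁ : ℝ} (ht₁ : t₁ < 0) (i : ℕ) :
    ∃ C, 0 ≤ C ∧ ∀ t t₀, t - t₀ ≤ t₁ → ∀ r ∈ Ioo 0 R,
      |dtr (perturb l t₀ a) i 0 t r| ≤ C * rexp (l * (t - t₀)) ∧
      |dtr (perturb l t₀ a) i 1 t r| ≤ C * rexp (l * (t - t₀)) := by
  obtain ⟨C, hC, hle⟩ := expEval.exists_abs_apply_le hl ht₁ i
  have hR := P.R_pos
  obtain ⟨r', hr'⟩ : (Ioo 0 R).Nonempty := nonempty_Ioo.2 hR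
  have hκ : 0 ≤ κ := (norm_nonneg _).trans (S.norm_a r' hr')
  refine ⟨C * κ * (1 + R), by positivity, fun t t₀ h r hr => ⟨?_, ?_⟩⟩
  · have h1 := hle _ h (a r) (S.coeff_zero_a r hr)
    rw [dtr_perturb hl ha i 0 (by linarith) hr, iteratedDeriv_zero]
    calc _ ≤ C * rexp (l * (t - t₀)) * ‖a r‖ := h1
      _ ≤ C * rexp (l * (t - t₀)) * κ := by gcongr; exact S.norm_a r hr
      _ ≤ C * rexp (l * (t - t₀)) * κ * (1 + R) := le_mul_of_one_le_right (by positivity)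
          (by linarith)
      _ = _ := by ring
  · have h1 := hle _ h (y r) (S.coeff_zero_y r hr)
    rw [S.dtr_one hl ha i (by linarith) hr, abs_mul, abs_of_pos hr.1]
    calc _ ≤ (1 + R) * (C * rexp (l * (t - t₀)) * ‖y r‖) := by
          gcongr
          linarith [hr.2]
      _ ≤ (1 + R) * (C * rexp (l * (t - t₀)) * κ) := by gcongr; exact S.norm_y r hr
      _ = _ := by ring

lemma exists_Etot_le (S : IsRadialSeries α R w μ κ a τ y) (P : IsProfile α c R w) (hl : 0 < l)
    (ha : ContDiffOn ℝ (⊤ : ℕ∞) a (Ioo 0 R)) {t₁ : ℝ} (ht₁ : t₁ < 0) :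
    ∃ C, 0 ≤ C ∧ ∀ t t₀, t - t₀ ≤ t₁ →
      Etot α R w (perturb l t₀ a) t ≤ C * rexp (l * (t - t₀)) ^ 2 := by
  have hα := P.α_pos
  have hR := P.R_pos
  choose C hC hle using fun i => S.exists_abs_dtr_le P hl ha ht₁ i
  have hvol : volume (Ioo (0 : ℝ) R) < ⊤ := by simp
  have hreal : volume.real (Ioo (0 : ℝ) R) = R := by simp [hR.le]
  set γ := (1 + α) / α with hγ
  have hγ0 : 0 ≤ γ := by positivity
  have hE0 : ∀ t t₀, t - t₀ ≤ t₁ → E0 α R w (perturb l t₀ a) t ≤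
      (C 1 ^ 2 + γ * C 0 ^ 2 + C 0 ^ 2) * R ^ 5 * rexp (l * (t - t₀)) ^ 2 := by
    intro t t₀ h
    suffices h5 : ‖E0 α R w (perturb l t₀ a) t‖ ≤
        (C 1 ^ 2 + γ * C 0 ^ 2 + C 0 ^ 2) * R ^ 4 * rexp (l * (t - t₀)) ^ 2 *
          volume.real (Ioo (0 : ℝ) R) by
      rw [hreal] at h5
      exact (Real.le_norm_self _).trans (h5.trans (le_of_eq (by ring)))
    refine norm_setIntegral_le_of_norm_le_const hvol fun r hr => ?_
    have b1 := P.abs_energy_le hα.le hr (hle 1 t t₀ h r hr).1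
    have b2 := P.abs_energy_le (by linarith : 0 ≤ 1 + α) hr (hle 0 t t₀ h r hr).2
    have b3 : |w r ^ α * r ^ 4 * perturb l t₀ a t r ^ 2| ≤ _ :=
      P.abs_energy_le hα.le hr (hle 0 t t₀ h r hr).1
    have b4 := mul_le_mul_of_nonneg_left b2 hγ0
    rw [← abs_of_nonneg hγ0, ← abs_mul, abs_of_nonneg hγ0] at b4
    refine (abs_add_three _ _ _).trans ?_
    rw [← hγ, mul_assoc γ, mul_assoc γ]
    linarith
  have hEj : ∀ j t t₀, t - t₀ ≤ t₁ → Ejk α R w (perturb l t₀ a) j 0 t ≤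
      (C (j + 1) ^ 2 + γ * C j ^ 2) * R ^ 5 * rexp (l * (t - t₀)) ^ 2 := by
    intro j t t₀ h
    suffices h5 : ‖Ejk α R w (perturb l t₀ a) j 0 t‖ ≤
        (C (j + 1) ^ 2 + γ * C j ^ 2) * R ^ 4 * rexp (l * (t - t₀)) ^ 2 *
          volume.real (Ioo (0 : ℝ) R) by
      rw [hreal] at h5
      exact (Real.le_norm_self _).trans (h5.trans (le_of_eq (by ring)))
    refine norm_setIntegral_le_of_norm_le_const hvol fun r hr => ?_
    have b1 := P.abs_energy_le (s := α + (0 : ℕ)) (by push_cast; linarith) hr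
      (hle (j + 1) t t₀ h r hr).1
    have b2 := P.abs_energy_le (s := 1 + α + (0 : ℕ)) (by push_cast; linarith) hr
      (hle j t t₀ h r hr).2
    have b4 := mul_le_mul_of_nonneg_left b2 hγ0
    rw [← abs_of_nonneg hγ0, ← abs_mul, abs_of_nonneg hγ0] at b4
    refine (abs_add_le _ _).trans ?_
    rw [← hγ, mul_assoc γ, mul_assoc γ, Nat.sub_zero, zero_add]
    linarith
  refine ⟨(C 1 ^ 2 + γ * C 0 ^ 2 + C 0 ^ 2) * R ^ 5 + ∑ j ∈ Finset.Icc 1 (⌈α⌉₊ + 3),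
    (C (j + 1) ^ 2 + γ * C j ^ 2) * R ^ 5, by positivity, fun t t₀ h => ?_⟩
  rw [add_mul, Finset.sum_mul]
  exact add_le_add (hE0 t t₀ h) (Finset.sum_le_sum fun j _ => hEj j t t₀ h)

lemma E0_pos (S : IsRadialSeries α R w μ κ a τ y) (P : IsProfile α c R w) (hl : 0 < l)
    (ha : ContDiffOn ℝ (⊤ : ℕ∞) a (Ioo 0 R)) (hy : WReg (Ioo 0 R) w (⌈α⌉₊ + 2) y)
    (hY : WReg (Ioo 0 R) w (⌈α⌉₊ + 2) (slopeDeriv α w a τ y)) {t r : ℝ} (ht : t < 0)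
    (hr : r ∈ Ioo 0 R) (hne : expEval l 0 t (a r) ≠ 0) : 0 < E0 α R w (perturb l 0 a) t := by
  have hα := P.α_pos
  have hfin := S.finiteEnergies P hl ha hy hY ht
  have h0 := hfin.2 0 (by simp) 0 (by simp)
  simp only [Nat.cast_zero, add_zero, Nat.sub_zero, zero_add] at h0
  have hE : IntegrableOn (fun r => w r ^ α * r ^ 4 * dtr (perturb l 0 a) 1 0 t r ^ 2 +
      (1 + α) / α * w r ^ (1 + α) * r ^ 4 * dtr (perturb l 0 a) 0 1 t r ^ 2 +
      w r ^ α * r ^ 4 * perturb l 0 a t r ^ 2) (Ioo 0 R) :=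
    ((h0.1.add (h0.2.const_mul ((1 + α) / α))).add hfin.1).congr_fun
      (fun x _ => by simp only [Pi.add_apply]; ring) measurableSet_Ioo
  have hcont : ContinuousOn (perturb l 0 a t) (Ioo 0 R) := continuousOn_dtr hl ha 0 0 ht
  have hopen := hcont.isOpen_inter_preimage isOpen_Ioo (isOpen_compl_singleton (x := (0 : ℝ)))
  refine (setIntegral_pos_iff_support_of_nonneg_ae
    ((ae_restrict_iff' measurableSet_Ioo).2 (.of_forall fun x hx => ?_)) hE).2
    ((hopen.measure_pos volume ⟨r, hr, by simpa [perturb] using hne⟩).trans_le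
      (measure_mono fun x hx => ⟨?_, hx.1⟩))
  · have := P.w_pos hx
    have := hx.1
    simp only [Pi.zero_apply]
    positivity
  · have h1 := P.w_pos hx.1
    have h2 := hx.1.1
    have h3 : 0 < perturb l 0 a t x ^ 2 := by
      have : perturb l 0 a t x ≠ 0 := hx.2
      positivity
    rw [Function.mem_support]
    positivity

end IsRadialSeries

/-- An unstable perturbation profile, smooth inside the star and regular up to its boundary. -/
lemma IsProfile.exists_unstable_series {α c R : ℝ} {w : ℝ → ℝ} (P : IsProfile α c R w) {μ : ℝ}
    (hμ : 0 < μ) (hμ0 : ¬P.IsRegular μ) (hreg : ∀ s, μ < s → P.IsRegular s) :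
    ∃ (κ : ℝ) (a τ y : ℝ → Wiener ℝ), κ * (1 + R ^ 2) ≤ 1 / 2 ∧
      IsRadialSeries α R w μ κ a τ y ∧ ContDiffOn ℝ (⊤ : ℕ∞) a (Ioo 0 R) ∧
      WReg (Ioo 0 R) w (⌈α⌉₊ + 2) y ∧ WReg (Ioo 0 R) w (⌈α⌉₊ + 2) (slopeDeriv α w a τ y) ∧
      ∃ r ∈ Ioo 0 R, Wiener.coeff 1 (a r) ≠ 0 := by
  obtain ⟨η, hη, hwreg⟩ := P.exists_wReg (⌈α⌉₊ + 2)
  have hκ : 0 < min η (1 / 2 / (1 + R ^ 2)) := lt_min hη (by positivity)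
  have hκ1 : min η (1 / 2 / (1 + R ^ 2)) * (1 + R ^ 2) ≤ 1 / 2 :=
    (le_div_iff₀ (by positivity)).1 (min_le_right _ _)
  obtain ⟨a, τ, y, S, r, hr, hne⟩ := P.exists_isRadialSeries hμ hμ0 hreg hκ hκ1
  have hρ : |(1 / 2 : ℝ)| ≤ 1 := by norm_num [abs_of_pos]
  have hreg := hwreg μ _ a τ y S hκ1 (min_le_left _ _) (1 / 2) hρ (by norm_num) (by norm_num)
  refine ⟨_, _, _, _, hκ1, S.dilate hκ1 hρ,
    P.contDiffOn_dilate S hκ1 hρ (by norm_num) (by norm_num), hreg.1,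
    hreg.2.congr isOpen_Ioo fun r hr => S.dilate_slopeDeriv hκ1 hρ hr, r, hr, ?_⟩
  rw [Wiener.coeff_dilate]
  simpa using hne

theorem IsProfile.nonlinear_instability {α c R : ℝ} {w : ℝ → ℝ} (P : IsProfile α c R w) {μ₀ : ℝ}
    (hμ₀ : 0 < μ₀)
    (hlub : IsLUB {q : ℝ | ∃ φ : ℝ → ℝ, DifferentiableOn ℝ φ (Ioo 0 R) ∧
      FiniteNorm α R w φ ∧ Ifun α R w φ = 1 ∧ q = Qfun α R w φ} μ₀) :
    ∃ θ₀ > (0 : ℝ), ∃ C > (0 : ℝ), ∃ δ₀ : ℝ, 0 < δ₀ ∧ δ₀ < 2 * θ₀ ∧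
      ∀ δ, 0 < δ → δ ≤ δ₀ → ∃ T : ℝ, Real.log (2 * θ₀ / δ) / √μ₀ < T ∧
        ∃ ζ : ℝ → ℝ → ℝ,
          ContDiffOn ℝ (⊤ : ℕ∞) (fun p : ℝ × ℝ => ζ p.1 p.2) (Ico 0 T ×ˢ Ioo 0 R) ∧
          SolvesEP α c R w ζ (Ico 0 T) ∧ (∀ t ∈ Ico (0 : ℝ) T, FiniteEnergies α R w ζ t) ∧
          √(Etot α R w ζ 0) ≤ C * δ ∧
          ∃ t ∈ Icc (0 : ℝ) (Real.log (2 * θ₀ / δ) / √μ₀), θ₀ ≤ √(E0 α R w ζ t) := by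
  obtain ⟨μ, hμμ₀, hμ0, hreg⟩ := P.exists_max_not_isRegular hlub
  have hμ : 0 < μ := hμ₀.trans_le hμμ₀
  obtain ⟨κ, a, τ, y, hκ1, S, ha, hy, hY, r, hr, hne⟩ := P.exists_unstable_series hμ hμ0 hreg
  have hl : 0 < √μ := Real.sqrt_pos.2 hμ
  have hl₀ : 0 < √μ₀ := Real.sqrt_pos.2 hμ₀
  obtain ⟨s, hs, hsne⟩ := expEval.exists_apply_ne_zero hl (S.coeff_zero_a r hr) hne
  obtain ⟨B, hB, hE⟩ := S.exists_Etot_le P hl ha hs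
  have hpos := S.E0_pos P hl ha hy hY hs hr hsne
  set θ := √(E0 α R w (perturb √μ 0 a) s) with hθ
  have hθ0 : 0 < θ := Real.sqrt_pos.2 hpos
  refine ⟨θ, hθ0, (√B + 1) / (2 * θ), by positivity, θ, hθ0, by linarith, fun δ hδ hδθ => ?_⟩
  have hq : 1 ≤ 2 * θ / δ := (one_le_div hδ).2 (by linarith)
  set Tδ := Real.log (2 * θ / δ) / √μ₀ with hTδ
  have hT0 : 0 ≤ Tδ := div_nonneg (Real.log_nonneg hq) hl₀.le
  have hlT : Real.log (2 * θ / δ) ≤ √μ * Tδ := by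
    rw [show Real.log (2 * θ / δ) = √μ₀ * Tδ by rw [hTδ, mul_div_cancel₀ _ hl₀.ne']]
    exact mul_le_mul_of_nonneg_right (Real.sqrt_le_sqrt hμμ₀) hT0
  have hexp : rexp (√μ * (0 - (Tδ - s))) ≤ δ / (2 * θ) := by
    rw [← Real.exp_log (show 0 < δ / (2 * θ) by positivity), exp_le_exp,
      show δ / (2 * θ) = (2 * θ / δ)⁻¹ by rw [inv_div], Real.log_inv]
    nlinarith
  refine ⟨Tδ - s / 2, by linarith, perturb √μ (Tδ - s) a, contDiffOn_perturb hl ha (by linarith),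
    S.solvesEP P hκ1 hl (Real.sq_sqrt hμ.le) ha fun t ht => ?_,
    fun t ht => S.finiteEnergies P hl ha hy hY ?_, ?_, Tδ, ⟨hT0, le_rfl⟩, ?_⟩
  · have := ht.2
    simp only [mem_Iio]
    linarith
  · have := ht.2
    linarith
  · calc _ ≤ √(B * rexp (√μ * (0 - (Tδ - s))) ^ 2) :=
          Real.sqrt_le_sqrt (hE 0 (Tδ - s) (by linarith))
      _ = √B * rexp (√μ * (0 - (Tδ - s))) := by
          rw [Real.sqrt_mul hB, Real.sqrt_sq (exp_pos _).le]
      _ ≤ (√B + 1) * (δ / (2 * θ)) := by gcongr; linarith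
      _ = _ := by ring
  · rw [E0_perturb_eq hl ha (by linarith), sub_sub_cancel]

end LaneEmden

/-- Nonlinear instability of Lane-Emden stars: there exist `θ₀ > 0`,
`C > 0` and `0 < δ₀ < 2θ₀` such that for every `0 < δ ≤ δ₀` there is a solution `ζ^δ`
on `[0,T)` with `T > T^δ = (1/√μ₀) ln(2θ₀/δ)` satisfying `√E(0) ≤ C δ` but
`sup_{0 ≤ t ≤ T^δ} √E⁰(t) ≥ θ₀`. -/
theorem nonlinear_instability_laneEmden
    (α c R : ℝ) (hα : 3 < α) (hα' : α < 5) (hc : 0 < c) (hR : 0 < R)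
    (w : ℝ → ℝ)
    (hw_cont : ContinuousOn w (Set.Icc 0 R))
    (hw_smooth : ContDiffOn ℝ (⊤ : ℕ∞) w (Set.Ico 0 R))
    (hw0 : w 0 = 1) (hw'0 : deriv w 0 = 0)
    (hw_pos : ∀ r, 0 ≤ r → r < R → 0 < w r)
    (hwR : w R = 0)
    (hw_dec : ∀ r, 0 < r → r < R → deriv w r < 0)
    (hw_pv : ∃ w'R : ℝ, w'R < 0 ∧
      Filter.Tendsto (deriv w) (nhdsWithin R (Set.Iio R)) (nhds w'R))
    (hw_ode : ∀ r, 0 < r → r < R →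
      deriv (deriv w) r + (2 / r) * deriv w r + c * w r ^ α = 0)
    (μ₀ : ℝ) (hμ₀ : 0 < μ₀)
    (hμ₀_lub : IsLUB {q : ℝ | ∃ φ : ℝ → ℝ, DifferentiableOn ℝ φ (Set.Ioo 0 R) ∧
      FiniteNorm α R w φ ∧ Ifun α R w φ = 1 ∧ q = Qfun α R w φ} μ₀) :
    ∃ θ₀ > (0:ℝ), ∃ C > (0:ℝ), ∃ δ₀ : ℝ, 0 < δ₀ ∧ δ₀ < 2 * θ₀ ∧
      ∀ δ, 0 < δ → δ ≤ δ₀ →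
        ∃ T : ℝ, Real.log (2 * θ₀ / δ) / Real.sqrt μ₀ < T ∧
        ∃ ζ : ℝ → ℝ → ℝ,
          ContDiffOn ℝ (⊤ : ℕ∞) (fun p : ℝ × ℝ => ζ p.1 p.2) (Set.Ico 0 T ×ˢ Set.Ioo 0 R) ∧
          SolvesEP α c R w ζ (Set.Ico 0 T) ∧
          (∀ t ∈ Set.Ico (0:ℝ) T, FiniteEnergies α R w ζ t) ∧
          Real.sqrt (Etot α R w ζ 0) ≤ C * δ ∧
          ∃ t ∈ Set.Icc (0:ℝ) (Real.log (2 * θ₀ / δ) / Real.sqrt μ₀),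
            θ₀ ≤ Real.sqrt (E0 α R w ζ t) := by
  have P : LaneEmden.IsProfile α c R w :=
    ⟨hα, hα', hc, hR, hw_cont, hw_smooth, hw0, hw_pos, hwR, hw_dec, hw_ode⟩
  exact P.nonlinear_instability hμ₀ hμ₀_lub
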